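/- arXiv:1809.00779 — 3 statements merged into one kernel-verified Lean document; each statement's English description precedes it below -/
import Mathlib

section
/- There exists an integer t₀ such that for every integer t ≥ t₀ the following holds. If H is a graph on exactly 2t−1 vertices with minimum degree δ(H) ≥ (2−10⁻⁶)t, then for every function c from the edge set of H to {1,2} there exists a color i ∈ {1,2} such that for every integer s with 3 ≤ s ≤ t, H contains a cycle of length s all of whose edges receive color i under c. -/
/-- `F` has a cycle of length `m`, all of whose edges get color `i` under `c`. -/
def HasMonoCycle {V : Type*} (F : SimpleGraph V) {k : ℕ} (c : F.edgeSet → Fin k)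
    (i : Fin k) (m : ℕ) : Prop :=
  ∃ (v : V) (w : F.Walk v v), w.IsCycle ∧ w.length = m ∧
    ∀ e (h : e ∈ w.edges), c ⟨e, w.edges_subset_edgeSet h⟩ = i

namespace MonoCycle

open Finset
open scoped Classical

/-- The list `L` is a path of `G` from `a` to `b`. -/
def IsP {V : Type*} (G : SimpleGraph V) (a b : V) (L : List V) : Prop :=
  L.Nodup ∧ L.IsChain G.Adj ∧ L.head? = some a ∧ L.getLast? = some b

/-- The list `L` is the vertex sequence of a cycle of `G`. -/
def IsCyc {V : Type*} (G : SimpleGraph V) (L : List V) : Prop :=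
  ∃ a b, IsP G a b L ∧ G.Adj b a ∧ 3 ≤ L.length

/-- `G` has a cycle of length `l`. -/
def HasCyc {V : Type*} (G : SimpleGraph V) (l : ℕ) : Prop :=
  ∃ L, IsCyc G L ∧ L.length = l

/-- `G` has cycles of all lengths from `3` to `t`. -/
def Win {V : Type*} (G : SimpleGraph V) (t : ℕ) : Prop :=
  ∀ l, 3 ≤ l → l ≤ t → HasCyc G l

/-- The list `f a, f (a + 1), …` with `n` entries. -/
def seg {V : Type*} (f : ℕ → V) (a n : ℕ) : List V :=
  (List.range n).map fun j => f (a + j)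

/-- `f` runs periodically around a cycle of `G` of length `m`. -/
structure CycFn {V : Type*} (G : SimpleGraph V) (m : ℕ) (f : ℕ → V) : Prop where
  three_le : 3 ≤ m
  per : ∀ i, f (i + m) = f i
  inj : ∀ i j, i < j → j < i + m → f i ≠ f j
  adj : ∀ i, G.Adj (f i) (f (i + 1))

/-- `f 0, …, f (n - 1)` is a path of `G`. -/
structure PathFn {V : Type*} (G : SimpleGraph V) (n : ℕ) (f : ℕ → V) : Prop where
  inj : ∀ i j, i < j → j < n → f i ≠ f j
  adj : ∀ i, i + 1 < n → G.Adj (f i) (f (i + 1))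

/-- The number of neighbours of `v` in `S`. -/
noncomputable def dg {V : Type*} (G : SimpleGraph V) (S : Finset V) (v : V) : ℕ :=
  #(S.filter (G.Adj v))

/-- Twice the number of edges of `G` inside `S`. -/
noncomputable def es {V : Type*} (G : SimpleGraph V) (S : Finset V) : ℕ :=
  ∑ v ∈ S, dg G S v

section Basic

variable {V : Type*} {G : SimpleGraph V} {a b c d : V} {L L₁ L₂ : List V}

theorem IsP.single (G : SimpleGraph V) (a : V) : IsP G a a [a] := by
  simp [IsP]

theorem IsP.reverse (h : IsP G a b L) : IsP G b a L.reverse := by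
  obtain ⟨h1, h2, h3, h4⟩ := h
  refine ⟨by simpa using h1, ?_, by simpa using h4, by simpa using h3⟩
  rw [List.isChain_reverse]
  refine h2.imp ?_
  intro x y hxy
  exact hxy.symm

theorem IsP.append (h₁ : IsP G a b L₁) (h₂ : IsP G c d L₂) (hbc : G.Adj b c)
    (hd : ∀ x ∈ L₁, x ∉ L₂) : IsP G a d (L₁ ++ L₂) := by
  obtain ⟨h1, h2, h3, h4⟩ := h₁
  obtain ⟨k1, k2, k3, k4⟩ := h₂
  refine ⟨?_, ?_, ?_, ?_⟩
  · rw [List.nodup_append']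
    exact ⟨h1, k1, fun x hx hx' => hd x hx hx'⟩
  · rw [List.isChain_append]
    refine ⟨h2, k2, ?_⟩
    intro x hx y hy
    rw [h4] at hx
    rw [k3] at hy
    simp at hx hy
    subst hx hy
    exact hbc
  · simp [List.head?_append, h3]
  · simp [List.getLast?_append, k4]

theorem IsP.cons (h : IsP G a b L) (hc : G.Adj c a) (hd : c ∉ L) : IsP G c b (c :: L) := by
  have := (IsP.single G c).append h hc (by simpa using hd)
  simpa using this

theorem IsP.head_mem (h : IsP G a b L) : a ∈ L := List.mem_of_head? h.2.2.1

theorem IsP.last_mem (h : IsP G a b L) : b ∈ L := h.reverse.head_mem |> List.mem_reverse.1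

theorem IsP.length_pos (h : IsP G a b L) : 0 < L.length := List.length_pos_of_mem h.head_mem

@[simp] theorem length_seg (f : ℕ → V) (a n : ℕ) : (seg f a n).length = n := by simp [seg]

theorem mem_seg {f : ℕ → V} {a n : ℕ} {x : V} :
    x ∈ seg f a n ↔ ∃ i, a ≤ i ∧ i < a + n ∧ f i = x := by
  simp only [seg, List.mem_map, List.mem_range]
  constructor
  · rintro ⟨j, hj, rfl⟩
    exact ⟨a + j, by omega, by omega, rfl⟩
  · rintro ⟨i, h1, h2, rfl⟩
    exact ⟨i - a, by omega, by congr 1; omega⟩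

theorem isP_seg {f : ℕ → V} {a n : ℕ}
    (hinj : ∀ i j, a ≤ i → i < j → j < a + n + 1 → f i ≠ f j)
    (hadj : ∀ i, a ≤ i → i < a + n → G.Adj (f i) (f (i + 1))) :
    IsP G (f a) (f (a + n)) (seg f a (n + 1)) := by
  induction n with
  | zero => simpa [seg] using IsP.single G (f a)
  | succ n ih =>
    have ih' := ih (fun i j h1 h2 h3 => hinj i j h1 h2 (by omega))
      (fun i h1 h2 => hadj i h1 (by omega))
    have h2 := ih'.append (IsP.single G (f (a + (n + 1)))) (hadj (a + n) (by omega) (by omega))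
      (by
        intro x hx hx'
        rw [mem_seg] at hx
        obtain ⟨i, h1, h2, rfl⟩ := hx
        simp at hx'
        exact hinj i (a + (n + 1)) h1 (by omega) (by omega) hx')
    have : seg f a (n + 1 + 1) = seg f a (n + 1) ++ [f (a + (n + 1))] := by
      simp only [seg]
      rw [List.range_succ (n := n + 1), List.map_append]
      rfl
    rw [this]
    exact h2

theorem CycFn.isP_seg {m : ℕ} {f : ℕ → V} (h : CycFn G m f) (a n : ℕ) (hn : n + 1 ≤ m) :
    IsP G (f a) (f (a + n)) (seg f a (n + 1)) :=
  MonoCycle.isP_seg (fun i j h1 h2 h3 => h.inj i j h2 (by omega)) (fun i _ _ => h.adj i)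

theorem PathFn.isP_seg {m : ℕ} {f : ℕ → V} (h : PathFn G m f) (a n : ℕ) (hn : a + n < m) :
    IsP G (f a) (f (a + n)) (seg f a (n + 1)) :=
  MonoCycle.isP_seg (fun i j h1 h2 h3 => h.inj i j h2 (by omega))
    (fun i _ _ => h.adj i (by omega))

theorem CycFn.shift {m : ℕ} {f : ℕ → V} (h : CycFn G m f) (k : ℕ) :
    CycFn G m (fun i => f (i + k)) where
  three_le := h.three_le
  per i := by
    have := h.per (i + k)
    rw [← this]; congr 1; omega
  inj i j h1 h2 := h.inj _ _ (by omega) (by omega)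
  adj i := by
    have := h.adj (i + k)
    rwa [show i + k + 1 = i + 1 + k by omega] at this

theorem CycFn.isCyc {m : ℕ} {f : ℕ → V} (h : CycFn G m f) : IsCyc G (seg f 0 m) := by
  have h3 := h.three_le
  have := h.isP_seg 0 (m - 1) (by omega)
  rw [show m - 1 + 1 = m by omega] at this
  refine ⟨_, _, this, ?_, by simpa using h3⟩
  have h4 := h.adj (m - 1)
  rw [show m - 1 + 1 = 0 + m by omega, h.per] at h4
  simpa using h4

theorem CycFn.mod {m : ℕ} {f : ℕ → V} (h : CycFn G m f) (i : ℕ) : f i = f (i % m) := by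
  have : ∀ k r, f (r + m * k) = f r := by
    intro k
    induction k with
    | zero => simp
    | succ k ih =>
      intro r
      rw [show r + m * (k + 1) = r + m * k + m by ring, h.per, ih]
  conv_lhs => rw [← Nat.mod_add_div i m, this]

theorem exists_cycFn (h : IsCyc G L) : ∃ f, CycFn G L.length f ∧
    ∀ x, x ∈ L ↔ ∃ i < L.length, f i = x := by
  obtain ⟨a, b, ⟨h1, h2, h3, h4⟩, hba, hl⟩ := h
  have hm : ∀ i, i % L.length < L.length := fun i => Nat.mod_lt _ (by omega)
  have e0 : L[0] = a := by
    rw [List.head?_eq_getElem?] at h3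
    rw [List.getElem?_eq_getElem (by omega)] at h3
    simpa using h3
  have e1 : L[L.length - 1] = b := by
    rw [List.getLast?_eq_getElem?] at h4
    rw [List.getElem?_eq_getElem (by omega)] at h4
    simpa using h4
  refine ⟨fun i => L[i % L.length]'(hm i), ⟨hl, ?_, ?_, ?_⟩, ?_⟩
  · intro i; simp
  · intro i j hij hj he
    rw [h1.getElem_inj_iff] at he
    have := Nat.sub_mod_eq_zero_of_mod_eq he.symm
    have := Nat.eq_zero_of_dvd_of_lt (Nat.dvd_of_mod_eq_zero this) (by omega)
    omega
  · intro i
    rw [List.isChain_iff_getElem] at h2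
    have hmi := hm i
    have e : (i + 1) % L.length = if i % L.length + 1 = L.length then 0 else i % L.length + 1 := by
      rw [Nat.add_mod, Nat.mod_eq_of_lt (show 1 < L.length by omega)]
      split_ifs with h
      · rw [h, Nat.mod_self]
      · rw [Nat.mod_eq_of_lt (by omega)]
    by_cases h : i % L.length + 1 = L.length
    · simp only [e, h, if_true]
      have : i % L.length = L.length - 1 := by omega
      simp only [this, e0, e1]
      exact hba
    · simp only [e, h, if_false]
      exact h2 _ (by omega)
  · intro x
    rw [List.mem_iff_getElem]
    constructor
    · rintro ⟨i, hi, rfl⟩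
      exact ⟨i, hi, by simp [Nat.mod_eq_of_lt hi]⟩
    · rintro ⟨i, hi, rfl⟩
      exact ⟨i % L.length, hm i, rfl⟩

theorem exists_pathFn (h : IsP G a b L) : ∃ f, PathFn G L.length f ∧ f 0 = a ∧
    f (L.length - 1) = b ∧ (∀ x, x ∈ L ↔ ∃ i < L.length, f i = x) ∧
    ∀ i (hi : i < L.length), f i = L[i] := by
  have hl := h.length_pos
  obtain ⟨h1, h2, h3, h4⟩ := h
  rw [List.isChain_iff_getElem] at h2
  refine ⟨fun i => L.getD i a, ⟨?_, ?_⟩, ?_, ?_, ?_, fun i hi => List.getD_eq_getElem _ _ hi⟩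
  · intro i j hij hj
    rw [List.getD_eq_getElem _ _ hj, List.getD_eq_getElem _ _ (by omega : i < L.length)]
    intro he
    rw [h1.getElem_inj_iff] at he
    omega
  · intro i hi
    rw [List.getD_eq_getElem _ _ hi, List.getD_eq_getElem _ _ (by omega : i < L.length)]
    exact h2 i hi
  · rw [List.head?_eq_getElem?] at h3
    simp [List.getD, h3]
  · rw [List.getLast?_eq_getElem?] at h4
    simp [List.getD, h4]
  · intro x
    rw [List.mem_iff_getElem]
    constructor
    · rintro ⟨i, hi, rfl⟩
      exact ⟨i, hi, List.getD_eq_getElem _ _ hi⟩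
    · rintro ⟨i, hi, rfl⟩
      exact ⟨i, hi, (List.getD_eq_getElem _ _ hi).symm⟩

/-- The vertex set of the cycle described by `f`. -/
noncomputable def vs (f : ℕ → V) (m : ℕ) : Finset V := (range m).image f

theorem mem_vs {f : ℕ → V} {m : ℕ} {x : V} : x ∈ vs f m ↔ ∃ i < m, f i = x := by
  simp [vs]

theorem CycFn.card_vs {m : ℕ} {f : ℕ → V} (h : CycFn G m f) : #(vs f m) = m := by
  rw [vs, card_image_of_injOn, card_range]
  intro i hi j hj hij
  simp at hi hj
  by_contra hne
  rcases Nat.lt_or_gt_of_ne hne with h1 | h1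
  · exact h.inj i j h1 (by omega) hij
  · exact h.inj j i h1 (by omega) hij.symm

theorem PathFn.card_vs {m : ℕ} {f : ℕ → V} (h : PathFn G m f) : #(vs f m) = m := by
  rw [vs, card_image_of_injOn, card_range]
  intro i hi j hj hij
  simp at hi hj
  by_contra hne
  rcases Nat.lt_or_gt_of_ne hne with h1 | h1
  · exact h.inj i j h1 (by omega) hij
  · exact h.inj j i h1 (by omega) hij.symm

theorem CycFn.mem_vs {m : ℕ} {f : ℕ → V} (h : CycFn G m f) (i : ℕ) : f i ∈ vs f m := by
  rw [MonoCycle.mem_vs]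
  exact ⟨i % m, Nat.mod_lt _ (by have := h.three_le; omega), (h.mod i).symm⟩

theorem CycFn.vs_shift {m : ℕ} {f : ℕ → V} (h : CycFn G m f) (k : ℕ) :
    vs (fun i => f (i + k)) m = vs f m := by
  apply Finset.eq_of_subset_of_card_le
  · intro x hx
    rw [MonoCycle.mem_vs] at hx
    obtain ⟨i, _, rfl⟩ := hx
    exact h.mem_vs _
  · rw [h.card_vs, (h.shift k).card_vs]

theorem CycFn.exists_shift {m : ℕ} {f : ℕ → V} (h : CycFn G m f) {x : V} (hx : x ∈ vs f m) :
    ∃ g, CycFn G m g ∧ g 0 = x ∧ vs g m = vs f m := by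
  rw [MonoCycle.mem_vs] at hx
  obtain ⟨i, _, rfl⟩ := hx
  exact ⟨_, h.shift i, by simp, h.vs_shift i⟩

theorem CycFn.hasCyc {m : ℕ} {f : ℕ → V} (h : CycFn G m f) : HasCyc G m :=
  ⟨_, h.isCyc, by simp⟩

theorem IsP.hasCyc (h : IsP G a b L) (hba : G.Adj b a) (hl : 3 ≤ L.length) : HasCyc G L.length :=
  ⟨L, ⟨a, b, h, hba, hl⟩, rfl⟩

theorem dg_mono {S T : Finset V} (h : S ⊆ T) (v : V) : dg G S v ≤ dg G T v :=
  card_le_card (filter_subset_filter _ h)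

theorem dg_le_card (S : Finset V) (v : V) : dg G S v ≤ #S := card_filter_le _ _

theorem dg_union {S T : Finset V} (h : Disjoint S T) (v : V) :
    dg G (S ∪ T) v = dg G S v + dg G T v := by
  rw [dg, filter_union, card_union_of_disjoint]
  · rfl
  · exact disjoint_filter_filter h

theorem dg_sdiff_add {S T : Finset V} (h : S ⊆ T) (v : V) :
    dg G (T \ S) v + dg G S v = dg G T v := by
  rw [← dg_union (sdiff_disjoint), sdiff_union_of_subset h]

theorem dg_lt_card {S : Finset V} {v : V} (hv : v ∈ S) : dg G S v < #S := by
  apply card_lt_card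
  refine ⟨filter_subset _ _, fun h => ?_⟩
  have := h hv
  simp at this

theorem sum_dg_comm (S T : Finset V) : ∑ v ∈ S, dg G T v = ∑ v ∈ T, dg G S v := by
  simp only [dg, card_filter]
  rw [sum_comm]
  refine sum_congr rfl fun x _ => sum_congr rfl fun y _ => ?_
  simp [G.adj_comm]

theorem es_union {S T : Finset V} (h : Disjoint S T) :
    es G (S ∪ T) = es G S + 2 * (∑ v ∈ T, dg G S v) + es G T := by
  unfold es
  rw [sum_union h]
  simp only [dg_union h, sum_add_distrib]
  rw [sum_dg_comm S T]
  ring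

theorem es_le_card_sq (S : Finset V) : es G S ≤ #S * #S := by
  unfold es
  calc _ ≤ ∑ v ∈ S, #S := sum_le_sum fun v _ => dg_le_card S v
    _ = _ := by simp

theorem es_mono {S T : Finset V} (h : S ⊆ T) : es G S ≤ es G T := by
  unfold es
  calc _ ≤ ∑ v ∈ S, dg G T v := sum_le_sum fun v _ => dg_mono h v
    _ ≤ _ := sum_le_sum_of_subset h

theorem sum_vs {m : ℕ} {f : ℕ → V} (h : CycFn G m f) (g : V → ℕ) :
    ∑ v ∈ vs f m, g v = ∑ i ∈ range m, g (f i) := by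
  rw [vs, sum_image]
  intro i hi j hj hij
  simp at hi hj
  by_contra hne
  rcases Nat.lt_or_gt_of_ne hne with h1 | h1
  · exact h.inj i j h1 (by omega) hij
  · exact h.inj j i h1 (by omega) hij.symm

theorem CycFn.sum_succ {m : ℕ} {f : ℕ → V} (h : CycFn G m f) (g : V → ℕ) :
    ∑ i ∈ range m, g (f (i + 1)) = ∑ i ∈ range m, g (f i) := by
  have h1 := sum_range_succ (fun i => g (f i)) m
  have h2 := sum_range_succ' (fun i => g (f i)) m
  have h3 := h.per 0
  simp only [zero_add] at h3
  rw [h3] at h1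
  omega

/-- The end vertices of an edge of a cycle of length `m` have at most `m` neighbours on the
cycle in total, unless there is a cycle of length `l`. -/
theorem CycFn.dg_add_dg_le {m : ℕ} {f : ℕ → V} (h : CycFn G m f) {l : ℕ} (hl : 3 ≤ l) (hlm : l < m)
    (hno : ¬ HasCyc G l) : dg G (vs f m) (f (m - 1)) + dg G (vs f m) (f 0) ≤ m := by
  set X := (range (m - 2)).filter fun a => G.Adj (f 0) (f (a + 1)) with hX
  set Y := (range (m - 2)).filter fun a => G.Adj (f (m - 1)) (f (a + 1)) with hY
  have hx : dg G (vs f m) (f 0) ≤ #X + 1 := by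
    have : (vs f m).filter (G.Adj (f 0)) ⊆ insert (f (m - 1)) (X.image fun a => f (a + 1)) := by
      intro y hy
      rw [mem_filter, MonoCycle.mem_vs] at hy
      obtain ⟨⟨i, hi, rfl⟩, hy⟩ := hy
      rw [mem_insert, mem_image]
      by_cases hi1 : i = m - 1
      · left; rw [hi1]
      · right
        have : i ≠ 0 := by rintro rfl; exact G.loopless.irrefl _ hy
        refine ⟨i - 1, ?_, by congr 1; omega⟩
        rw [hX, mem_filter, mem_range, show i - 1 + 1 = i by omega]
        exact ⟨by omega, hy⟩
    calc _ ≤ _ := card_le_card this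
      _ ≤ _ := card_insert_le _ _
      _ ≤ _ := by have := card_image_le (s := X) (f := fun a => f (a + 1)); omega
  have hy : dg G (vs f m) (f (m - 1)) ≤ #Y + 1 := by
    have : (vs f m).filter (G.Adj (f (m - 1))) ⊆ insert (f 0) (Y.image fun a => f (a + 1)) := by
      intro y hy
      rw [mem_filter, MonoCycle.mem_vs] at hy
      obtain ⟨⟨i, hi, rfl⟩, hy⟩ := hy
      rw [mem_insert, mem_image]
      by_cases hi1 : i = 0
      · left; rw [hi1]
      · right
        have : i ≠ m - 1 := by rintro rfl; exact G.loopless.irrefl _ hy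
        refine ⟨i - 1, ?_, by congr 1; omega⟩
        rw [hY, mem_filter, mem_range, show i - 1 + 1 = i by omega]
        exact ⟨by omega, hy⟩
    calc _ ≤ _ := card_le_card this
      _ ≤ _ := card_insert_le _ _
      _ ≤ _ := by have := card_image_le (s := Y) (f := fun a => f (a + 1)); omega
  obtain ⟨φ, hφ⟩ : ∃ φ : ℕ → ℕ, ∀ a, φ a = if a + l ≤ m then a + l - 3 else a + l - m - 1 :=
    ⟨_, fun _ => rfl⟩
  have hinj : Set.InjOn φ X := by
    intro i hi j hj hij
    rw [mem_coe, hX, mem_filter, mem_range] at hi hj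
    rw [hφ, hφ] at hij
    split_ifs at hij <;> omega
  have hlast : G.Adj (f (m - 1)) (f 0) := by
    have h4 := h.adj (m - 1)
    have h3 := h.three_le
    rw [show m - 1 + 1 = 0 + m by omega, h.per] at h4
    simpa using h4
  have hdis : Disjoint (X.image φ) Y := by
    rw [disjoint_left]
    intro b hb hbY
    rw [mem_image] at hb
    obtain ⟨a, ha, rfl⟩ := hb
    rw [hX, mem_filter, mem_range] at ha
    rw [hY, mem_filter, mem_range] at hbY
    obtain ⟨ha, haX⟩ := ha
    obtain ⟨_, hbY⟩ := hbY
    apply hno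
    rw [hφ] at hbY
    split_ifs at hbY with hc
    · have p := h.isP_seg (a + 1) (l - 3) (by omega)
      have p1 := p.cons (c := f 0) haX (by
        rw [mem_seg]
        rintro ⟨i, h1, h2, h3⟩
        exact h.inj 0 i (by omega) (by omega) h3.symm)
      have p2 := p1.append (IsP.single G (f (m - 1))) (by
        rw [show a + 1 + (l - 3) = a + l - 3 + 1 by omega]
        exact hbY.symm) (by
        intro x hx hx'
        simp only [List.mem_singleton] at hx'
        subst hx'
        rw [List.mem_cons, mem_seg] at hx
        rcases hx with hx | ⟨i, h1, h2, h3⟩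
        · exact h.inj 0 (m - 1) (by omega) (by omega) hx.symm
        · exact h.inj i (m - 1) (by omega) (by omega) h3)
      have := p2.hasCyc hlast (by simp)
      simp only [List.length_append, List.length_cons, length_seg, List.length_nil] at this
      rwa [show l - 3 + 1 + 1 + (0 + 1) = l by omega] at this
    · have p := h.isP_seg 0 (a + l - m) (by omega)
      have q := h.isP_seg (a + 1) (m - 2 - a) (by omega)
      rw [show a + 1 + (m - 2 - a) = m - 1 by omega] at q
      have p2 := p.append q.reverse (by
        rw [show 0 + (a + l - m) = a + l - m - 1 + 1 by omega]
        exact hbY.symm) (by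
        intro x hx hx'
        rw [List.mem_reverse, mem_seg] at hx'
        rw [mem_seg] at hx
        obtain ⟨i, h1, h2, rfl⟩ := hx
        obtain ⟨j, k1, k2, h3⟩ := hx'
        exact h.inj i j (by omega) (by omega) h3.symm)
      have := p2.hasCyc haX.symm (by simp; omega)
      simp only [List.length_append, List.length_reverse, length_seg] at this
      rwa [show a + l - m + 1 + (m - 2 - a + 1) = l by omega] at this
  have hsub : X.image φ ∪ Y ⊆ range (m - 2) := by
    intro b hb
    rw [mem_union, mem_image] at hb
    rcases hb with ⟨a, ha, rfl⟩ | hb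
    · rw [hX, mem_filter, mem_range] at ha
      rw [mem_range]
      rw [hφ]
      split_ifs <;> omega
    · rw [hY, mem_filter] at hb
      exact hb.1
  have := card_le_card hsub
  rw [card_union_of_disjoint hdis, card_image_of_injOn hinj, card_range] at this
  omega

/-- A Hamiltonian graph on `m` vertices with more than `m² / 4` edges is pancyclic. -/
theorem CycFn.pancyclic {m : ℕ} {f : ℕ → V} (h : CycFn G m f) (he : m * m < 2 * es G (vs f m))
    {l : ℕ} (hl : 3 ≤ l) (hlm : l ≤ m) : HasCyc G l := by
  rcases hlm.lt_or_eq with hlm | rfl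
  swap
  · exact h.hasCyc
  by_contra hno
  have key : ∀ i, dg G (vs f m) (f i) + dg G (vs f m) (f (i + 1)) ≤ m := by
    intro i
    have := (h.shift (i + 1)).dg_add_dg_le hl hlm hno
    rw [h.vs_shift] at this
    rw [show m - 1 + (i + 1) = i + m by omega, h.per] at this
    simpa using this
  have h1 : ∑ i ∈ range m, (dg G (vs f m) (f i) + dg G (vs f m) (f (i + 1))) ≤ m * m := by
    calc _ ≤ ∑ i ∈ range m, m := sum_le_sum fun i _ => key i
      _ = _ := by simp
  rw [sum_add_distrib, h.sum_succ (dg G (vs f m)), ← sum_vs h] at h1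
  unfold es at he
  omega

end Basic

/-- `K` lists the interior vertices of a path of `G` from `a` to `b`. -/
def Conn {V : Type*} (G : SimpleGraph V) (a b : V) (K : List V) : Prop :=
  (K = [] ∧ G.Adj a b) ∨ ∃ k k', G.Adj a k ∧ IsP G k k' K ∧ G.Adj k' b

section Dirac

variable {V : Type*} {G : SimpleGraph V} {a b c d : V} {K P Q : List V}

theorem Conn.join (hP : IsP G c a P) (hK : Conn G a b K) (hQ : IsP G b d Q)
    (h1 : ∀ x ∈ P, x ∉ Q) (h2 : ∀ x ∈ P, x ∉ K) (h3 : ∀ x ∈ K, x ∉ Q) :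
    IsP G c d (P ++ (K ++ Q)) := by
  rcases hK with ⟨rfl, h⟩ | ⟨k, k', hk, hp, hk'⟩
  · simpa using hP.append hQ h h1
  · refine hP.append (hp.append hQ hk' h3) hk ?_
    intro x hx
    rw [List.mem_append]
    rintro (h | h)
    · exact h2 x hx h
    · exact h1 x hx h

theorem Conn.close (hQ : IsP G b a Q) (hK : Conn G a b K) (h : ∀ x ∈ Q, x ∉ K)
    (h3 : 3 ≤ Q.length) : IsCyc G (Q ++ K) := by
  rcases hK with ⟨rfl, h'⟩ | ⟨k, k', hk, hp, hk'⟩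
  · exact ⟨b, a, by simpa using hQ, h', by simpa using h3⟩
  · exact ⟨b, k', hQ.append hp hk h, hk', by simp; omega⟩

theorem exists_greatest {P : ℕ → Prop} (N : ℕ) (h : ∃ n, P n) (hN : ∀ n, P n → n ≤ N) :
    ∃ n, P n ∧ ∀ m, P m → m ≤ n := by
  obtain ⟨n, hn⟩ := h
  exact ⟨_, Nat.findGreatest_spec (hN n hn) hn, fun m hm => Nat.le_findGreatest (hN m hm) hm⟩

theorem length_le_card {L : List V} {S : Finset V} (h : L.Nodup) (hS : ∀ x ∈ L, x ∈ S) :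
    L.length ≤ #S := by
  rw [← List.toFinset_card_of_nodup h]
  exact card_le_card fun x hx => hS x (List.mem_toFinset.1 hx)

theorem exists_longest {S : Finset V} (hS : S.Nonempty) : ∃ a b L, IsP G a b L ∧ (∀ x ∈ L, x ∈ S) ∧
    ∀ a' b' L', IsP G a' b' L' → (∀ x ∈ L', x ∈ S) → L'.length ≤ L.length := by
  obtain ⟨x, hx⟩ := hS
  obtain ⟨n, ⟨a, b, L, h1, h2, h3⟩, h4⟩ := exists_greatest (P := fun n => ∃ a b L, IsP G a b L ∧
    (∀ x ∈ L, x ∈ S) ∧ L.length = n) #S ⟨1, x, x, [x], IsP.single G x, by simpa using hx, rfl⟩ (by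
      rintro n ⟨a, b, L, h1, h2, rfl⟩
      exact length_le_card h1.1 h2)
  refine ⟨a, b, L, h1, h2, fun a' b' L' k1 k2 => ?_⟩
  rw [h3]
  exact h4 _ ⟨a', b', L', k1, k2, rfl⟩

theorem exists_longest_from {S : Finset V} {x : V} (hx : x ∈ S) :
    ∃ b L, IsP G x b L ∧ (∀ x ∈ L, x ∈ S) ∧
    ∀ b' L', IsP G x b' L' → (∀ x ∈ L', x ∈ S) → L'.length ≤ L.length := by
  obtain ⟨n, ⟨b, L, h1, h2, h3⟩, h4⟩ := exists_greatest (P := fun n => ∃ b L, IsP G x b L ∧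
    (∀ x ∈ L, x ∈ S) ∧ L.length = n) #S ⟨1, x, [x], IsP.single G x, by simpa using hx, rfl⟩ (by
      rintro n ⟨b, L, h1, h2, rfl⟩
      exact length_le_card h1.1 h2)
  refine ⟨b, L, h1, h2, fun b' L' k1 k2 => ?_⟩
  rw [h3]
  exact h4 _ ⟨b', L', k1, k2, rfl⟩

theorem mem_of_longest_from {S : Finset V} {x b : V} {L : List V} (h : IsP G x b L)
    (hS : ∀ x ∈ L, x ∈ S) (hmax : ∀ b' L', IsP G x b' L' → (∀ x ∈ L', x ∈ S) →
      L'.length ≤ L.length) {y : V} (hy : y ∈ S) (hby : G.Adj b y) : y ∈ L := by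
  by_contra hyL
  have h1 := h.append (IsP.single G y) hby (by
    intro z hz hz'
    simp at hz'
    exact hyL (hz' ▸ hz))
  have := hmax _ _ h1 (by
    intro z hz
    rw [List.mem_append, List.mem_singleton] at hz
    rcases hz with hz | rfl
    · exact hS z hz
    · exact hy)
  simp at this

/-- Closing up a path whose end vertices have non-crossing neighbourhoods. -/
theorem PathFn.close {n : ℕ} {f : ℕ → V} (hf : PathFn G n f) {i j : ℕ} (hi : 1 ≤ i)
    (hij : i ≤ j) (hj : j + 1 < n) (h0 : G.Adj (f 0) (f i)) (h1 : G.Adj (f (n - 1)) (f j))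
    (hK : Conn G (f (j + 1)) (f (i - 1)) K) (hd : ∀ k < n, f k ∉ K) :
    ∃ L, IsCyc G L ∧ (∀ x ∈ L, x ∈ vs f n ∨ x ∈ K) ∧ L.length = n + K.length := by
  have p1 := (hf.isP_seg 0 (i - 1) (by omega)).reverse
  have p2 := hf.isP_seg i (j - i) (by omega)
  have p3 := (hf.isP_seg (j + 1) (n - 2 - j) (by omega)).reverse
  rw [show 0 + (i - 1) = i - 1 by omega] at p1
  rw [show i + (j - i) = j by omega] at p2
  rw [show j + 1 + (n - 2 - j) = n - 1 by omega] at p3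
  have p12 := p1.append p2 h0 (by
    intro x hx hx'
    rw [List.mem_reverse, mem_seg] at hx
    rw [mem_seg] at hx'
    obtain ⟨a, _, _, rfl⟩ := hx
    obtain ⟨b, _, _, h⟩ := hx'
    exact hf.inj a b (by omega) (by omega) h.symm)
  have p := p12.append p3 h1.symm (by
    intro x hx hx'
    rw [List.mem_append, List.mem_reverse, mem_seg, mem_seg] at hx
    rw [List.mem_reverse, mem_seg] at hx'
    obtain ⟨b, _, _, h⟩ := hx'
    rcases hx with ⟨a, _, _, rfl⟩ | ⟨a, _, _, rfl⟩
    · exact hf.inj a b (by omega) (by omega) h.symm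
    · exact hf.inj a b (by omega) (by omega) h.symm)
  have hmem : ∀ x ∈ (seg f 0 (i - 1 + 1)).reverse ++ seg f i (j - i + 1) ++
      (seg f (j + 1) (n - 2 - j + 1)).reverse, x ∈ vs f n := by
    intro x hx
    simp only [List.mem_append, List.mem_reverse, mem_seg] at hx
    rw [mem_vs]
    rcases hx with (⟨a, _, _, rfl⟩ | ⟨a, _, _, rfl⟩) | ⟨a, _, _, rfl⟩ <;>
      exact ⟨a, by omega, rfl⟩
  refine ⟨_, hK.close p ?_ ?_, ?_, ?_⟩
  · intro x hx
    obtain ⟨a, ha, rfl⟩ := mem_vs.1 (hmem x hx)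
    exact hd a ha
  · simp only [List.length_append, List.length_reverse, length_seg]; omega
  · intro x hx
    rw [List.mem_append] at hx
    exact hx.imp_left (hmem x)
  · simp only [List.length_append, List.length_reverse, length_seg]; omega

theorem PathFn.cross {n : ℕ} {f : ℕ → V} (hf : PathFn G n f) {i j : ℕ}
    (hij : i < j) (hj : j < n) (h0 : G.Adj (f 0) (f j)) (h1 : G.Adj (f (n - 1)) (f i))
    (h3 : 3 ≤ i + 1 + (n - j)) :
    ∃ L, IsCyc G L ∧ (∀ x ∈ L, x ∈ vs f n) ∧ L.length = i + 1 + (n - j) := by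
  have p1 := hf.isP_seg 0 i (by omega)
  have p2 := (hf.isP_seg j (n - 1 - j) (by omega)).reverse
  rw [show 0 + i = i by omega] at p1
  rw [show j + (n - 1 - j) = n - 1 by omega] at p2
  have p := p1.append p2 h1.symm (by
    intro x hx hx'
    rw [mem_seg] at hx
    rw [List.mem_reverse, mem_seg] at hx'
    obtain ⟨b, _, _, h⟩ := hx'
    obtain ⟨a, _, _, rfl⟩ := hx
    exact hf.inj a b (by omega) (by omega) h.symm)
  refine ⟨_, ⟨_, _, p, h0.symm, ?_⟩, ?_, ?_⟩
  · simp only [List.length_append, List.length_reverse, length_seg]; omega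
  · intro x hx
    simp only [List.mem_append, List.mem_reverse, mem_seg] at hx
    rw [mem_vs]
    rcases hx with ⟨a, _, _, rfl⟩ | ⟨a, _, _, rfl⟩ <;>
      exact ⟨a, by omega, rfl⟩
  · simp only [List.length_append, List.length_reverse, length_seg]; omega

/-- The positions on a path of the neighbours of a vertex. -/
theorem card_positions {n : ℕ} {f : ℕ → V} {S : Finset V} {v : V}
    (h : ∀ y ∈ S, G.Adj v y → y ∈ vs f n) :
    dg G S v ≤ #((range n).filter fun i => f i ∈ S ∧ G.Adj v (f i)) := by
  rw [dg]
  calc _ ≤ #(((range n).filter fun i => f i ∈ S ∧ G.Adj v (f i)).image f) := by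
        apply card_le_card
        intro y hy
        rw [mem_filter] at hy
        obtain ⟨i, hi, rfl⟩ := mem_vs.1 (h y hy.1 hy.2)
        exact mem_image.2 ⟨i, by simp [hi, hy.1, hy.2], rfl⟩
    _ ≤ _ := card_image_le

theorem PathFn.card_image {n : ℕ} {f : ℕ → V} (hf : PathFn G n f) {I : Finset ℕ} {s : ℕ → ℕ}
    (hs : ∀ i ∈ I, s i < n) (hinj : Set.InjOn s I) : #(I.image fun i => f (s i)) = #I := by
  rw [card_image_of_injOn]
  intro i hi j hj hij
  by_contra hne
  have hne' : s i ≠ s j := fun h => hne (hinj hi hj h)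
  rcases Nat.lt_or_gt_of_ne hne' with h1 | h1
  · exact hf.inj _ _ h1 (hs j hj) hij
  · exact hf.inj _ _ h1 (hs i hi) hij.symm

/-- A path with non-crossing end neighbourhoods closes up to a long cycle. -/
theorem PathFn.exists_close {n : ℕ} {f : ℕ → V} (hf : PathFn G n f) {I J : Finset ℕ} {d : ℕ}
    (hI : ∀ i ∈ I, i < n ∧ G.Adj (f 0) (f i)) (hJ : ∀ j ∈ J, j < n ∧ G.Adj (f (n - 1)) (f j))
    (hnc : ∀ i ∈ I, ∀ j ∈ J, i ≤ j) (hId : d ≤ #I) (hJd : d ≤ #J) {S T Z : Finset V}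
    (hIS : ∀ i ∈ I, f (i - 1) ∈ S) (hJS : ∀ j ∈ J, j + 1 < n → f (j + 1) ∈ S)
    (hT : ∀ k < n, f k ∈ T → f k ∈ Z)
    (Hc : ∀ A B, A ⊆ S → B ⊆ S → Disjoint A B → d ≤ #A → d ≤ #B →
      ∃ a ∈ A, ∃ b ∈ B, ∃ K, Conn G a b K ∧ K.length ≤ 2 ∧ ∀ x ∈ K, x ∈ T ∧ x ∉ Z) :
    ∃ L, ∃ K : List V, IsCyc G L ∧ (∀ x ∈ L, x ∈ vs f n ∨ x ∈ K) ∧ n ≤ L.length ∧ K.length ≤ 2 ∧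
      ∀ x ∈ K, x ∈ T := by
  have hI1 : ∀ i ∈ I, 1 ≤ i := by
    intro i hi
    by_contra h
    have : i = 0 := by omega
    subst this
    exact G.loopless.irrefl _ (hI 0 hi).2
  have hJ1 : ∀ j ∈ J, j + 1 < n := by
    intro j hj
    have h1 := (hJ j hj).1
    by_contra h
    have : j = n - 1 := by omega
    subst this
    exact G.loopless.irrefl _ (hJ _ hj).2
  obtain ⟨a, ha, b, hb, K, hK, hK2, hKT⟩ := Hc (J.image fun j => f (j + 1))
    (I.image fun i => f (i - 1)) (by
      intro x hx
      obtain ⟨j, hj, rfl⟩ := mem_image.1 hx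
      exact hJS j hj (hJ1 j hj)) (by
      intro x hx
      obtain ⟨j, hj, rfl⟩ := mem_image.1 hx
      exact hIS j hj) (by
      rw [disjoint_left]
      intro x hx hx'
      obtain ⟨j, hj, rfl⟩ := mem_image.1 hx
      obtain ⟨i, hi, h⟩ := mem_image.1 hx'
      have := hnc i hi j hj
      have := hJ1 j hj
      exact hf.inj _ _ (by omega) (by omega) h) (by
      rw [hf.card_image (s := fun j => j + 1) hJ1 (by intro i _ j _ h; simpa using h)]
      exact hJd) (by
      rw [hf.card_image (s := fun j => j - 1) (by intro i hi; have := (hI i hi).1; omega) (by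
        intro i hi j hj h
        have := hI1 i hi
        have := hI1 j hj
        simp at h
        omega)]
      exact hId)
  obtain ⟨j, hj, rfl⟩ := mem_image.1 ha
  obtain ⟨i, hi, rfl⟩ := mem_image.1 hb
  obtain ⟨L, h1, h2, h3⟩ := hf.close (hI1 i hi) (hnc i hi j hj) (hJ1 j hj) (hI i hi).2 (hJ j hj).2
    hK (by
      intro k hk hkK
      exact (hKT _ hkK).2 (hT k hk (hKT _ hkK).1))
  exact ⟨L, K, h1, h2, by omega, hK2, fun x hx => (hKT x hx).1⟩

/-- Dirac's theorem on long cycles, with connecting paths in place of connectivity. -/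
theorem exists_long_cycle {S T : Finset V} {d : ℕ} (hd : 2 ≤ d) (hS : S.Nonempty)
    (hdeg : ∀ v ∈ S, d ≤ dg G S v) (hST : Disjoint S T)
    (Hc : ∀ A B Z, A ⊆ S → B ⊆ S → Disjoint A B → d ≤ #A → d ≤ #B → #Z ≤ 2 →
      ∃ a ∈ A, ∃ b ∈ B, ∃ K, Conn G a b K ∧ K.length ≤ 2 ∧ ∀ x ∈ K, x ∈ T ∧ x ∉ Z) :
    ∃ L, IsCyc G L ∧ (∀ x ∈ L, x ∈ S ∨ x ∈ T) ∧ #(L.toFinset \ S) ≤ 4 ∧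
      (2 * d ≤ L.length ∨ #S ≤ L.length) := by
  obtain ⟨p, q, P, hP, hPS, hmax⟩ := exists_longest (G := G) hS
  obtain ⟨f, hf, hf0, hf1, hfP, -⟩ := exists_pathFn hP
  have hn := hP.length_pos
  set n := P.length with hndef
  have hPvs : ∀ x, x ∈ P ↔ x ∈ vs f n := fun x => by rw [hfP, mem_vs]
  have hfS : ∀ i < n, f i ∈ S := fun i hi => hPS _ ((hfP _).2 ⟨i, hi, rfl⟩)
  have hend : ∀ y ∈ S, G.Adj (f (n - 1)) y → y ∈ vs f n := by
    intro y hy hadj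
    rw [← hPvs]
    exact mem_of_longest_from hP hPS (hmax p) hy (hf1 ▸ hadj)
  have hstart : ∀ y ∈ S, G.Adj (f 0) y → y ∈ vs f n := by
    intro y hy hadj
    rw [← hPvs, ← List.mem_reverse]
    refine mem_of_longest_from hP.reverse (by simpa using hPS) ?_ hy (hf0 ▸ hadj)
    rw [List.length_reverse]
    exact hmax q
  set I := (range n).filter fun i => f i ∈ S ∧ G.Adj (f 0) (f i) with hIdef
  set J := (range n).filter fun i => f i ∈ S ∧ G.Adj (f (n - 1)) (f i) with hJdef
  have hI : ∀ i ∈ I, i < n ∧ G.Adj (f 0) (f i) := by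
    intro i hi; rw [hIdef, mem_filter, mem_range] at hi; exact ⟨hi.1, hi.2.2⟩
  have hJ : ∀ i ∈ J, i < n ∧ G.Adj (f (n - 1)) (f i) := by
    intro i hi; rw [hJdef, mem_filter, mem_range] at hi; exact ⟨hi.1, hi.2.2⟩
  have hId : d ≤ #I := (hdeg _ (hfS 0 hn)).trans (card_positions hstart)
  have hJd : d ≤ #J := (hdeg _ (hfS (n - 1) (by omega))).trans (card_positions hend)
  by_cases hnc : ∀ i ∈ I, ∀ j ∈ J, i ≤ j
  · obtain ⟨L, K, h1, h2, h3, h4, h5⟩ := hf.exists_close (S := S) (T := T) (Z := ∅) hI hJ hnc hId hJd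
      (fun i hi => hfS _ (by have := (hI i hi).1; omega)) (fun j hj hjn => hfS _ hjn)
      (fun k hk hkT => absurd hkT (disjoint_left.1 hST (hfS k hk)))
      (fun A B hA hB hAB hAd hBd => Hc A B ∅ hA hB hAB hAd hBd (by simp))
    refine ⟨L, h1, ?_, ?_, ?_⟩
    · intro x hx
      rcases h2 x hx with h | h
      · left; rw [← hPvs] at h; exact hPS x h
      · right; exact h5 x h
    · calc _ ≤ #K.toFinset := by
            apply card_le_card
            intro x hx
            rw [mem_sdiff, List.mem_toFinset] at hx
            rw [List.mem_toFinset]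
            rcases h2 x hx.1 with h | h
            · rw [← hPvs] at h; exact absurd (hPS x h) hx.2
            · exact h
        _ ≤ _ := (List.toFinset_card_le K).trans (by omega)
    · left
      refine le_trans ?_ h3
      obtain ⟨i₀, hi₀, hmax₀⟩ := exists_max_image I id (card_pos.1 (by omega))
      have hI' : I ⊆ Icc 1 i₀ := by
        intro i hi
        rw [mem_Icc]
        refine ⟨?_, hmax₀ i hi⟩
        by_contra h
        have : i = 0 := by omega
        subst this
        exact G.loopless.irrefl _ (hI 0 hi).2
      have hJ' : J ⊆ Ico i₀ n := by
        intro j hj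
        rw [mem_Ico]
        exact ⟨hnc _ hi₀ j hj, (hJ j hj).1⟩
      have e1 := card_le_card hI'
      have e2 := card_le_card hJ'
      have := (hI i₀ hi₀).1
      simp at e1 e2
      omega
  · push Not at hnc
    obtain ⟨g, ⟨j, hj, i, hi, hij, rfl⟩, hmin⟩ : ∃ g, (∃ j ∈ I, ∃ i ∈ J, i < j ∧ g = j - i) ∧
        ∀ g' < g, ¬ (∃ j ∈ I, ∃ i ∈ J, i < j ∧ g' = j - i) := by
      obtain ⟨j, hj, i, hi, hij⟩ := hnc
      have h : ∃ g, (∃ j ∈ I, ∃ i ∈ J, i < j ∧ g = j - i) := ⟨_, j, hj, i, hi, hij, rfl⟩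
      exact ⟨Nat.find h, Nat.find_spec h, fun g' hg' => Nat.find_min h hg'⟩
    have hmin' : ∀ j' ∈ I, ∀ i' ∈ J, i' < j' → j - i ≤ j' - i' := by
      intro j' hj' i' hi' hlt
      by_contra h
      exact hmin (j' - i') (by omega) ⟨j', hj', i', hi', hlt, rfl⟩
    have hjn := (hI j hj).1
    have hinn := (hJ i hi).1
    by_cases hj1 : j = i + 1
    · -- a Hamiltonian cycle on the path
      have hPd : n ≤ #S := length_le_card hP.1 hPS
      have hdn : d ≤ n := hId.trans ((card_filter_le _ _).trans (by simp))
      have hdn' : d + 1 ≤ n := by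
        have h1 : I ⊆ Ico 1 n := by
          intro i hi
          rw [mem_Ico]
          refine ⟨?_, (hI i hi).1⟩
          by_contra h
          have : i = 0 := by omega
          subst this
          exact G.loopless.irrefl _ (hI 0 hi).2
        have := card_le_card h1
        simp at this
        omega
      obtain ⟨L, hL, hLP, hLlen⟩ := hf.cross hij hjn (hI j hj).2 (hJ i hi).2 (by omega)
      have hLn : L.length = n := by omega
      by_cases hSn : #S ≤ n
      · refine ⟨L, hL, ?_, ?_, Or.inr (by omega)⟩
        · intro x hx
          left
          have := hLP x hx
          rw [← hPvs] at this
          exact hPS x this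
        · have : L.toFinset \ S = ∅ := by
            rw [sdiff_eq_empty_iff_subset]
            intro x hx
            have := hLP x (List.mem_toFinset.1 hx)
            rw [← hPvs] at this
            exact hPS x this
          rw [this]; simp
      · obtain ⟨h, hh, hhL⟩ := exists_cycFn hL
        rw [hLn] at hh hhL
        have hvs : vs h n = vs f n := by
          apply Finset.eq_of_subset_of_card_le
          · intro x hx
            rw [mem_vs, ← hhL] at hx
            exact hLP x hx
          · rw [hh.card_vs, hf.card_vs]
        set W := vs f n with hW
        have hWS : W ⊆ S := fun x hx => hPS x ((hPvs x).2 hx)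
        have hWn : #W = n := hf.card_vs
        have hsep : ∀ x ∈ W, ∀ y ∈ S \ W, ¬ G.Adj x y := by
          intro x hx y hy hxy
          rw [mem_sdiff] at hy
          rw [← hvs] at hx
          obtain ⟨g, hg, hg0, hgvs⟩ := hh.exists_shift hx
          have h1 := hg.isP_seg 0 (n - 1) (by omega)
          rw [hg0] at h1
          have hmem : ∀ z ∈ seg g 0 (n - 1 + 1), z ∈ W := by
            intro z hz
            rw [mem_seg] at hz
            obtain ⟨k, _, _, rfl⟩ := hz
            rw [← hvs, ← hgvs]
            exact hg.mem_vs k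
          have h2 := h1.cons hxy.symm (fun h => hy.2 (hmem _ h))
          have := hmax _ _ _ h2 (by
            intro z hz
            rw [List.mem_cons] at hz
            rcases hz with rfl | hz
            · exact hy.1
            · exact hWS (hmem z hz))
          simp only [List.length_cons, length_seg] at this
          omega
        have hdW : ∀ x ∈ W, d ≤ dg G W x := by
          intro x hx
          refine (hdeg x (hWS hx)).trans (card_le_card ?_)
          intro y hy
          rw [mem_filter] at hy ⊢
          refine ⟨?_, hy.2⟩
          by_contra hyW
          exact hsep x hx y (mem_sdiff.2 ⟨hy.1, hyW⟩) hy.2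
        have hdW' : ∀ x ∈ S \ W, d ≤ dg G (S \ W) x := by
          intro x hx
          refine (hdeg x (mem_sdiff.1 hx).1).trans (card_le_card ?_)
          intro y hy
          rw [mem_filter] at hy ⊢
          refine ⟨?_, hy.2⟩
          rw [mem_sdiff]
          refine ⟨hy.1, fun hyW => hsep y hyW x hx hy.2.symm⟩
        have hne : (S \ W).Nonempty := by
          rw [← card_pos, card_sdiff_of_subset hWS]; omega
        have hSW : d + 1 ≤ #(S \ W) := by
          obtain ⟨y, hy⟩ := hne
          exact (hdW' y hy).trans_lt (dg_lt_card hy)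
        obtain ⟨a, ha, b, hb, K, hK, hK2, hKT⟩ := Hc W (S \ W) ∅ hWS sdiff_subset disjoint_sdiff
          (by omega) (by omega) (by simp)
        rw [← hvs] at ha
        obtain ⟨g, hg, hg0, hgvs⟩ := hh.exists_shift ha
        have q1 := (hg.isP_seg 0 (n - 1) (by omega)).reverse
        rw [hg0] at q1
        have hmem : ∀ z ∈ (seg g 0 (n - 1 + 1)).reverse, z ∈ W := by
          intro z hz
          rw [List.mem_reverse, mem_seg] at hz
          obtain ⟨k, _, _, rfl⟩ := hz
          rw [← hvs, ← hgvs]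
          exact hg.mem_vs k
        obtain ⟨z, Q, hQ, hQS, hQmax⟩ := exists_longest_from (G := G) hb
        have hKS : ∀ x ∈ K, x ∉ S := fun x hx hxS => disjoint_left.1 hST hxS (hKT x hx).1
        have q := hK.join q1 hQ
          (fun x hx hx' => (mem_sdiff.1 (hQS x hx')).2 (hmem x hx))
          (fun x hx hx' => hKS x hx' (hWS (hmem x hx)))
          (fun x hx hx' => hKS x hx (mem_sdiff.1 (hQS x hx')).1)
        have hQd : d + 1 ≤ Q.length := by
          have h1 := hdW' z (hQS z hQ.last_mem)
          have h2 : dg G (S \ W) z ≤ dg G Q.toFinset z := by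
            apply card_le_card
            intro y hy
            rw [mem_filter] at hy ⊢
            rw [List.mem_toFinset]
            exact ⟨mem_of_longest_from hQ hQS hQmax hy.1 hy.2, hy.2⟩
          have h3 := dg_lt_card (G := G) (List.mem_toFinset.2 hQ.last_mem)
          have h4 := List.toFinset_card_le Q
          omega
        obtain ⟨F, hF, hF0, hF1, hFq, hFi⟩ := exists_pathFn q
        set N := ((seg g 0 (n - 1 + 1)).reverse ++ (K ++ Q)).length with hN
        have hNl : N = n + K.length + Q.length := by
          simp only [hN, List.length_append, List.length_reverse, length_seg]; omega
        have hl1 : (seg g 0 (n - 1 + 1)).reverse.length = n := by simp; omega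
        have F1 : ∀ i < n, F i ∈ W := by
          intro i hi
          rw [hFi i (by omega), List.getElem_append_left (by omega)]
          exact hmem _ (List.getElem_mem _)
        have F2 : ∀ i, n ≤ i → i < n + K.length → F i ∈ K := by
          intro i hi hi'
          rw [hFi i (by omega), List.getElem_append_right (by omega),
            List.getElem_append_left (by omega)]
          exact List.getElem_mem _
        have F3 : ∀ i, n + K.length ≤ i → i < N → F i ∈ Q := by
          intro i hi hi'
          rw [hFi i (by omega), List.getElem_append_right (by omega),
            List.getElem_append_right (by omega)]
          exact List.getElem_mem _
        have G1 : ∀ i < N, F i ∈ W → i < n := by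
          intro i hi hiW
          by_contra hlt
          by_cases h2 : i < n + K.length
          · exact hKS _ (F2 i (by omega) h2) (hWS hiW)
          · exact (mem_sdiff.1 (hQS _ (F3 i (by omega) hi))).2 hiW
        have G2 : ∀ i < N, F i ∈ S \ W → n + K.length ≤ i := by
          intro i hi hiW
          by_contra hlt
          by_cases h2 : i < n
          · exact (mem_sdiff.1 hiW).2 (F1 i h2)
          · exact hKS _ (F2 i (by omega) (by omega)) (mem_sdiff.1 hiW).1
        have hWN : ∀ y ∈ W, y ∈ vs F N := by
          intro y hy
          rw [mem_vs, ← hFq, List.mem_append]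
          left
          rw [← hvs, ← hgvs, mem_vs] at hy
          rw [List.mem_reverse, mem_seg]
          obtain ⟨i, hi, rfl⟩ := hy
          exact ⟨i, by omega, by omega, rfl⟩
        have hId' := card_positions (G := G) (f := F) (n := N) (S := W) (v := F 0)
          (fun y hy _ => hWN y hy)
        have hJd' := card_positions (G := G) (f := F) (n := N) (S := S \ W) (v := F (N - 1))
          (fun y hy hadj => by
            rw [mem_vs, ← hFq, List.mem_append, List.mem_append]
            right; right
            rw [hF1] at hadj
            exact mem_of_longest_from hQ hQS hQmax hy hadj)
        have hz : F (N - 1) ∈ S \ W := hF1 ▸ hQS z hQ.last_mem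
        obtain ⟨L', K', h1, h2, h3, h4, h5⟩ := hF.exists_close (S := S) (T := T) (Z := K.toFinset)
          (I := (range N).filter fun i => F i ∈ W ∧ G.Adj (F 0) (F i))
          (J := (range N).filter fun i => F i ∈ S \ W ∧ G.Adj (F (N - 1)) (F i)) (d := d)
          (fun i hi => by rw [mem_filter, mem_range] at hi; exact ⟨hi.1, hi.2.2⟩)
          (fun i hi => by rw [mem_filter, mem_range] at hi; exact ⟨hi.1, hi.2.2⟩)
          (by
            intro i hi j hj
            rw [mem_filter, mem_range] at hi hj
            have := G1 i hi.1 hi.2.1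
            have := G2 j hj.1 hj.2.1
            omega)
          ((hdW _ (F1 0 hn)).trans hId') ((hdW' _ hz).trans hJd')
          (by
            intro i hi
            rw [mem_filter, mem_range] at hi
            have := G1 i hi.1 hi.2.1
            exact hWS (F1 _ (by omega)))
          (by
            intro j hj hjN
            rw [mem_filter, mem_range] at hj
            have := G2 j hj.1 hj.2.1
            exact (mem_sdiff.1 (hQS _ (F3 (j + 1) (by omega) hjN))).1)
          (by
            intro k hk hkT
            rw [List.mem_toFinset]
            have hkS : F k ∉ S := fun h => disjoint_left.1 hST h hkT
            have : ¬ k < n := fun h => hkS (hWS (F1 k h))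
            have : k < n + K.length := by
              by_contra h
              exact hkS (mem_sdiff.1 (hQS _ (F3 k (by omega) hk))).1
            exact F2 k (by omega) this)
          (fun A B hA hB hAB hAd hBd => Hc A B _ hA hB hAB hAd hBd
            ((List.toFinset_card_le K).trans hK2))
        have hmemL : ∀ x ∈ L', x ∈ S ∨ x ∈ K ∨ x ∈ K' := by
          intro x hx
          rcases h2 x hx with h | h
          · rw [mem_vs, ← hFq, List.mem_append, List.mem_append] at h
            rcases h with h | h | h
            · exact Or.inl (hWS (hmem x h))
            · exact Or.inr (Or.inl h)
            · exact Or.inl (mem_sdiff.1 (hQS x h)).1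
          · exact Or.inr (Or.inr h)
        refine ⟨L', h1, ?_, ?_, Or.inl (by omega)⟩
        · intro x hx
          rcases hmemL x hx with h | h | h
          · exact Or.inl h
          · exact Or.inr (hKT x h).1
          · exact Or.inr (h5 x h)
        · calc _ ≤ #(K ++ K').toFinset := by
                apply card_le_card
                intro x hx
                rw [mem_sdiff, List.mem_toFinset] at hx
                rw [List.mem_toFinset, List.mem_append]
                exact (hmemL x hx.1).resolve_left hx.2
            _ ≤ (K ++ K').length := List.toFinset_card_le _
            _ ≤ _ := by rw [List.length_append]; omega
    · have hsum : d + d ≤ i + 1 + (n - j) := by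
        have h1 : I ∪ J.image (· + 1) ⊆ Icc 1 (i + 1) ∪ Ico j n := by
          intro k hk
          rw [mem_union, mem_image] at hk
          rw [mem_union, mem_Icc, mem_Ico]
          rcases hk with hk | ⟨k, hk, rfl⟩
          · have h2 := (hI k hk).1
            have : k ≠ 0 := by
              rintro rfl
              exact G.loopless.irrefl _ (hI 0 hk).2
            by_contra hcon
            have := hmin' k hk i hi (by omega)
            omega
          · have h2 := (hJ k hk).1
            have : k ≠ n - 1 := by
              rintro rfl
              exact G.loopless.irrefl _ (hJ _ hk).2
            by_contra hcon
            have := hmin' j hj k hk (by omega)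
            omega
        have h2 : Disjoint I (J.image (· + 1)) := by
          rw [disjoint_left]
          intro k hk hk'
          obtain ⟨k'', hk'', rfl⟩ := mem_image.1 hk'
          have := hmin' _ hk k'' hk'' (by omega)
          omega
        have h3 := card_le_card h1
        rw [card_union_of_disjoint h2, card_image_of_injective _ (add_left_injective 1)] at h3
        have h4 := card_union_le (Icc 1 (i + 1)) (Ico j n)
        simp at h4
        omega
      obtain ⟨L, hL, hLP, hLlen⟩ := hf.cross hij hjn (hI j hj).2 (hJ i hi).2 (by omega)
      have hLS : ∀ x ∈ L, x ∈ S := by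
        intro x hx
        have := hLP x hx
        rw [← hPvs] at this
        exact hPS x this
      refine ⟨L, hL, fun x hx => Or.inl (hLS x hx), ?_, Or.inl (by omega)⟩
      have : L.toFinset \ S = ∅ := by
        rw [sdiff_eq_empty_iff_subset]
        intro x hx
        exact hLS x (List.mem_toFinset.1 hx)
      rw [this]; simp

end Dirac

/-- Every vertex of a set `S` outside at most `e` exceptions is joined to `v` in `R` or `B`. -/
def Near {V : Type*} (R B : SimpleGraph V) (e : ℕ) : Prop :=
  ∀ v S, #S ≤ dg R S v + dg B S v + e

section Pancyclic

variable {V : Type*} {G R B : SimpleGraph V} {a b : V} {t e τ : ℕ}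

theorem Near.symm (h : Near R B e) : Near B R e := fun v S => by
  have := h v S
  omega

theorem dg_add_not (S : Finset V) (v : V) : dg G S v + #(S.filter fun w => ¬ G.Adj v w) = #S :=
  card_filter_add_card_filter_not _

/-- Dirac's condition (slightly strengthened) implies pancyclicity. -/
theorem pancyclic_of_dg {M : Finset V} (h3 : 3 ≤ #M) (h : ∀ v ∈ M, #M < 2 * dg G M v) {l : ℕ}
    (hl : 3 ≤ l) (hlM : l ≤ #M) : HasCyc G l := by
  obtain ⟨L, hL, hLM, -, hLlen⟩ := exists_long_cycle (G := G) (S := M) (T := ∅) (d := #M / 2 + 1)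
    (by omega) (card_pos.1 (by omega)) (fun v hv => by have := h v hv; omega) (by simp) (by
      intro A B Z hA hB hAB hA' hB' _
      have := card_le_card (union_subset hA hB)
      rw [card_union_of_disjoint hAB] at this
      omega)
  have hLM' : ∀ x ∈ L, x ∈ M := fun x hx => (hLM x hx).resolve_right (by simp)
  obtain ⟨f, hf, hfL⟩ := exists_cycFn hL
  have hsub : vs f L.length ⊆ M := by
    intro x hx
    rw [mem_vs, ← hfL] at hx
    exact hLM' x hx
  have hlen := hf.card_vs
  have hle := card_le_card hsub
  have heq : vs f L.length = M := eq_of_subset_of_card_le hsub (by omega)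
  have hLen : L.length = #M := by omega
  refine hf.pancyclic ?_ hl (by omega)
  rw [heq, hLen, es, mul_sum, ← smul_eq_mul, ← sum_const]
  exact sum_lt_sum_of_nonempty (card_pos.1 (by omega)) h

/-- A path alternating between a prescribed list and a set `Y` almost completely joined to it. -/
theorem exists_alternating {Y : Finset V} {L : List V} :
    ∀ {a : V} {Z : Finset V}, (a :: L).Nodup → (∀ x ∈ a :: L, #Y ≤ dg R Y x + τ) →
    (∀ x ∈ a :: L, x ∉ Y) → #Z + L.length + 2 * τ < #Y →
    ∃ P, IsP R a ((a :: L).getLast (List.cons_ne_nil _ _)) P ∧ P.length = 2 * L.length + 1 ∧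
      (∀ x ∈ P, x ∈ a :: L ∨ (x ∈ Y ∧ x ∉ Z)) := by
  induction L with
  | nil =>
    intro a Z _ _ _ _
    exact ⟨[a], IsP.single R a, by simp, by simp⟩
  | cons a' L ih =>
    intro a Z hnd hτ hLY hZ
    obtain ⟨y, hy⟩ : (((Y \ Z) \ Y.filter fun w => ¬ R.Adj a w) \
        Y.filter fun w => ¬ R.Adj a' w).Nonempty := by
      rw [← card_pos]
      have h1 := dg_add_not (G := R) Y a
      have h2 := dg_add_not (G := R) Y a'
      have h3 := hτ a (by simp)
      have h4 := hτ a' (by simp)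
      have h5 := le_card_sdiff Z Y
      have h6 := le_card_sdiff (Y.filter fun w => ¬ R.Adj a w) (Y \ Z)
      have h7 := le_card_sdiff (Y.filter fun w => ¬ R.Adj a' w)
        ((Y \ Z) \ Y.filter fun w => ¬ R.Adj a w)
      simp only [List.length_cons] at hZ
      omega
    simp only [mem_sdiff, mem_filter, not_and, not_not] at hy
    obtain ⟨⟨⟨hyY, hyZ⟩, h1⟩, h2⟩ := hy
    replace h1 := h1 hyY
    replace h2 := h2 hyY
    obtain ⟨P, hP, hPl, hPm⟩ := ih (a := a') (Z := insert y Z) (List.nodup_cons.1 hnd).2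
      (fun x hx => hτ x (List.mem_cons_of_mem _ hx))
      (fun x hx => hLY x (List.mem_cons_of_mem _ hx)) (by
        have := card_insert_le y Z
        simp only [List.length_cons] at hZ
        omega)
    have hyP : y ∉ P := by
      intro hyP
      rcases hPm y hyP with h | h
      · exact hLY y (List.mem_cons_of_mem _ h) hyY
      · exact h.2 (mem_insert_self _ _)
    have haP : a ∉ y :: P := by
      rw [List.mem_cons]
      rintro (rfl | h)
      · exact R.loopless.irrefl _ h1
      · rcases hPm a h with h | h
        · exact (List.nodup_cons.1 hnd).1 h
        · exact hLY a (by simp) h.1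
    refine ⟨a :: y :: P, (hP.cons h2.symm hyP).cons h1 haP, ?_, ?_⟩
    · simp only [List.length_cons]; omega
    · intro x hx
      simp only [List.mem_cons] at hx
      rcases hx with rfl | rfl | hx
      · left; simp
      · right; exact ⟨hyY, hyZ⟩
      · rcases hPm x hx with h | h
        · left; exact List.mem_cons_of_mem _ h
        · right; exact ⟨h.1, fun hz => h.2 (mem_insert_of_mem hz)⟩

/-- A list of distinct elements starting at a prescribed one. -/
theorem exists_list {A : Finset V} (ha : a ∈ A) {r : ℕ} (hr : r < #A) :
    ∃ L : List V, (a :: L).Nodup ∧ (∀ x ∈ a :: L, x ∈ A) ∧ L.length = r := by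
  obtain ⟨A', hA', hc⟩ := exists_subset_card_eq (s := A.erase a) (n := r)
    (by rw [card_erase_of_mem ha]; omega)
  refine ⟨A'.toList, ?_, ?_, by simpa using hc⟩
  · rw [List.nodup_cons]
    refine ⟨fun h => ?_, nodup_toList _⟩
    have := hA' (mem_toList.1 h)
    simp at this
  · intro x hx
    rw [List.mem_cons, mem_toList] at hx
    rcases hx with rfl | hx
    · exact ha
    · exact mem_of_mem_erase (hA' hx)

theorem exists_common_adj {Y N : Finset V} {x : V} (hN : N ⊆ Y) (hx : #Y ≤ dg R Y x + τ)
    (h : τ < #N) : ∃ y ∈ N, R.Adj x y := by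
  by_contra! hcon
  have h1 := dg_add_not (G := R) Y x
  have h2 : N ⊆ Y.filter fun w => ¬ R.Adj x w := fun y hy => mem_filter.2 ⟨hN hy, hcon y hy⟩
  have := card_le_card h2
  omega

/-- Two sets almost completely joined contain all not too long even cycles. -/
theorem even_cycle {A Y : Finset V} (hAY : Disjoint A Y) (hτ : ∀ a ∈ A, #Y ≤ dg R Y a + τ)
    {r : ℕ} (hr : 1 ≤ r) (hrA : r < #A) (hrY : r + 2 * τ + 1 < #Y) : HasCyc R (2 * r + 2) := by
  obtain ⟨a, ha⟩ : A.Nonempty := card_pos.1 (by omega)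
  obtain ⟨L, hL1, hL2, hL3⟩ := exists_list ha hrA
  have h0 := dg_add_not (G := R) Y a
  have h1 := hτ a ha
  obtain ⟨y, hy, hby⟩ := exists_common_adj (R := R) (τ := τ) (filter_subset (R.Adj a) Y)
    (hτ _ (hL2 _ (List.getLast_mem (List.cons_ne_nil a L)))) (by
      rw [dg] at h1; omega)
  rw [mem_filter] at hy
  obtain ⟨P, hP, hPl, hPm⟩ := exists_alternating hL1 (fun x hx => hτ x (hL2 x hx))
    (fun x hx => disjoint_left.1 hAY (hL2 x hx)) (Z := {y}) (by simp; omega)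
  have hyP : y ∉ P := by
    intro h
    rcases hPm y h with h | h
    · exact disjoint_left.1 hAY (hL2 y h) hy.1
    · exact h.2 (by simp)
  have := (hP.cons hy.2.symm hyP).hasCyc hby (by simp; omega)
  simpa [hPl, hL3, add_assoc] using this

theorem odd_cycle {A Y : Finset V} (hAY : Disjoint A Y) (hτ : ∀ a ∈ A, #Y ≤ dg R Y a + τ)
    {v : V} (ha : a ∈ A) (hva : R.Adj v a) (hv : τ < dg R Y v)
    {r : ℕ} (hrA : r + 1 < #A) (hrY : r + 2 * τ + 2 < #Y) : HasCyc R (2 * r + 3) := by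
  obtain ⟨L, hL1, hL2, hL3⟩ := exists_list (a := a) (A := A.erase v) (r := r)
    (mem_erase.2 ⟨hva.ne', ha⟩) (by have := pred_card_le_card_erase (s := A) (a := v); omega)
  replace hL2 : ∀ x ∈ a :: L, x ∈ A ∧ x ≠ v := fun x hx =>
    ⟨mem_of_mem_erase (hL2 x hx), ne_of_mem_erase (hL2 x hx)⟩
  obtain ⟨y, hy, hby⟩ := exists_common_adj (R := R) (τ := τ) (filter_subset (R.Adj v) Y)
    (hτ _ (hL2 _ (List.getLast_mem (List.cons_ne_nil a L))).1) hv
  rw [mem_filter] at hy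
  obtain ⟨P, hP, hPl, hPm⟩ := exists_alternating hL1 (fun x hx => hτ x (hL2 x hx).1)
    (fun x hx => disjoint_left.1 hAY (hL2 x hx).1) (Z := {v, y}) (by
      have := card_le_two (a := v) (b := y)
      omega)
  have hvP : v ∉ P := by
    intro h
    rcases hPm v h with h | h
    · exact (hL2 v h).2 rfl
    · exact h.2 (by simp)
  have hyP : y ∉ v :: P := by
    rw [List.mem_cons]
    rintro (h | h)
    · exact hy.2.ne' h
    rcases hPm y h with h | h
    · exact disjoint_left.1 hAY (hL2 y h).1 hy.1
    · exact h.2 (by simp)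
  have := ((hP.cons hva hvP).cons hy.2.symm hyP).hasCyc hby (by simp; omega)
  simpa [hPl, hL3, add_assoc] using this

/-- A set of `t` vertices in which `B` has large degrees. -/
theorem win_of_subset [Fintype V] {X P : Finset V} {q : ℕ} (ht : 3 ≤ t) (hX : t ≤ #X) (hPX : P ⊆ X)
    (hdeg : ∀ v ∈ X, ∀ S ⊆ P, #S ≤ dg B S v + q) (hP : t + 2 * q < 2 * #P) (hq : 2 * q < t) :
    Win B t := by
  obtain ⟨M, hMX, hMt, hM⟩ : ∃ M ⊆ X, #M = t ∧ t + 2 * q < 2 * #(P ∩ M) := by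
    by_cases h : #P ≤ t
    · obtain ⟨M, h1, h2, h3⟩ := exists_subsuperset_card_eq hPX h hX
      refine ⟨M, h2, h3, ?_⟩
      rwa [inter_eq_left.2 h1]
    · obtain ⟨M, h1, h2⟩ := exists_subset_card_eq (s := P) (n := t) (by omega)
      refine ⟨M, h1.trans hPX, h2, ?_⟩
      rw [inter_eq_right.2 h1]
      omega
  intro l hl hlt
  refine pancyclic_of_dg (M := M) (by omega) ?_ hl (by omega)
  intro v hv
  have h1 := hdeg v (hMX hv) (P ∩ M) inter_subset_left
  have h2 := dg_mono (G := B) (inter_subset_right : P ∩ M ⊆ M) v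
  omega

/-- If two disjoint sets `A` and `Y` of more than about `t / 2` vertices each are almost completely
joined in `R`, then one of the graphs has all short cycles. -/
theorem win_of_joined [Fintype V] (hcard : Fintype.card V + 1 = 2 * t) (hn : Near R B e)
    {A Y : Finset V} (hAY : Disjoint A Y) (hτ : ∀ a ∈ A, #Y ≤ dg R Y a + τ)
    (hA : t + 2 * e + 4 ≤ 2 * #A) (hY : t + 4 * τ + 2 * e + 6 ≤ 2 * #Y)
    (ht : 2 * e + 2 * τ + 3 ≤ t) : Win R t ∨ Win B t := by
  by_cases hcase : ∃ v, (∃ a ∈ A, R.Adj v a) ∧ τ < dg R Y v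
  · left
    obtain ⟨v, ⟨a, ha, hva⟩, hv⟩ := hcase
    intro l hl hlt
    rcases Nat.even_or_odd' l with ⟨k, rfl | rfl⟩
    · have := even_cycle hAY hτ (r := k - 1) (by omega) (by omega) (by omega)
      rwa [show 2 * (k - 1) + 2 = 2 * k by omega] at this
    · have := odd_cycle hAY hτ ha hva hv (r := k - 1) (by omega) (by omega)
      rwa [show 2 * (k - 1) + 3 = 2 * k + 1 by omega] at this
  · right
    push Not at hcase
    set A' := univ.filter fun v => ∀ a ∈ A, ¬ R.Adj v a with hA'
    set Y' := univ.filter fun v => dg R Y v ≤ τ with hY'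
    have hA1 : ∀ v ∈ A', ∀ S ⊆ A, #S ≤ dg B S v + e := by
      intro v hv S hS
      rw [hA', mem_filter] at hv
      have h1 := hn v S
      have h2 : dg R S v = 0 := by
        rw [dg, card_eq_zero, filter_eq_empty_iff]
        exact fun w hw => hv.2 w (hS hw)
      omega
    have hcov : univ ⊆ A' ∪ Y' := by
      intro v _
      rw [mem_union, hA', hY', mem_filter, mem_filter]
      by_cases h : ∃ a ∈ A, R.Adj v a
      · exact Or.inr ⟨mem_univ _, hcase v h⟩
      · left
        push Not at h
        exact ⟨mem_univ _, h⟩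
    have hcc := card_le_card hcov
    rw [card_univ] at hcc
    have hcu := card_union_le A' Y'
    have hAA' : A ⊆ A' := by
      intro a ha
      have := hcov (mem_univ a)
      rw [mem_union] at this
      refine this.resolve_right ?_
      rw [hY', mem_filter]
      have := hτ a ha
      omega
    by_cases hsz : t ≤ #A'
    · exact win_of_subset (q := e) (by omega) hsz hAA' hA1 (by omega) (by omega)
    · refine win_of_subset (X := Y') (P := Y ∩ Y') (q := e + τ) (by omega) (by omega)
        inter_subset_right ?_ ?_ (by omega)
      · intro v hv S hS
        have h1 := hn v S
        have h2 := dg_mono (G := R) (hS.trans inter_subset_left) v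
        rw [hY', mem_filter] at hv
        omega
      · obtain ⟨a, ha⟩ : A.Nonempty := card_pos.1 (by omega)
        have h1 : Y \ Y' ⊆ Y.filter fun w => ¬ R.Adj a w := by
          intro y hy
          rw [mem_sdiff] at hy
          have := hcov (mem_univ y)
          rw [mem_union] at this
          have := this.resolve_right hy.2
          rw [hA', mem_filter] at this
          rw [mem_filter]
          exact ⟨hy.1, fun h => this.2 a ha h.symm⟩
        have h2 := card_le_card h1
        have h3 := dg_add_not (G := R) Y a
        have h4 := hτ a ha
        have h5 := card_sdiff_add_card_inter Y Y'
        omega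

end Pancyclic

section Bondy

variable {V : Type*} {G R B : SimpleGraph V} {a b : V} {m t : ℕ} {f : ℕ → V}

/-- Replacing a stretch of a cycle by an outside path. -/
theorem CycFn.replace (hf : CycFn G m f) {i j : ℕ} (hij : i < j) (hj : j < i + m) {K : List V}
    (hK : IsP G a b K) (ha : G.Adj (f i) a) (hb : G.Adj b (f j)) (hd : ∀ x ∈ K, x ∉ vs f m) :
    IsCyc G (seg f j (i + m - j + 1) ++ K) := by
  have h1 := hf.isP_seg j (i + m - j) (by omega)
  rw [show j + (i + m - j) = i + m by omega, hf.per] at h1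
  have h2 := h1.append hK ha (by
    intro x hx hx'
    rw [mem_seg] at hx
    obtain ⟨k, _, _, rfl⟩ := hx
    exact hd _ hx' (hf.mem_vs k))
  refine ⟨_, _, h2, hb, ?_⟩
  have := hK.length_pos
  rw [List.length_append, length_seg]
  omega

theorem CycFn.sum_shift (h : CycFn G m f) (g : V → ℕ) (k : ℕ) :
    ∑ i ∈ range m, g (f (i + k)) = ∑ i ∈ range m, g (f i) := by
  induction k with
  | zero => rfl
  | succ k ih =>
    rw [← ih]
    have := (h.shift k).sum_succ g
    rw [← this]
    refine sum_congr rfl fun i _ => ?_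
    congr 2
    omega

/-- The indicator of adjacency. -/
noncomputable def ind (G : SimpleGraph V) (a x : V) : ℕ := if G.Adj a x then 1 else 0

theorem ind_le_one (a x : V) : ind G a x ≤ 1 := by
  unfold ind; split_ifs <;> simp

theorem adj_of_ind {a x : V} (h : 0 < ind G a x) : G.Adj a x := by
  unfold ind at h
  by_contra hn
  simp [hn] at h

theorem CycFn.dg_eq (h : CycFn G m f) (a : V) : dg G (vs f m) a = ∑ i ∈ range m, ind G a (f i) := by
  rw [dg, card_filter]
  exact sum_vs h (ind G a)

/-- No longer cycle than the one given by `f` is contained in `U`. -/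
def Longest (G : SimpleGraph V) (U : Finset V) (m : ℕ) : Prop :=
  ∀ L, IsCyc G L → (∀ x ∈ L, x ∈ U) → L.length ≤ m

theorem CycFn.length_le (hf : CycFn G m f) {U : Finset V} (hU : vs f m ⊆ U) (hmax : Longest G U m)
    {i j : ℕ} (hij : i < j) (hj : j < i + m) {K : List V}
    (hK : IsP G a b K) (ha : G.Adj (f i) a) (hb : G.Adj b (f j)) (hd : ∀ x ∈ K, x ∉ vs f m)
    (hKU : ∀ x ∈ K, x ∈ U) : K.length + i + 1 ≤ j := by
  have := hmax _ (hf.replace hij hj hK ha hb hd) (by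
    intro x hx
    rw [List.mem_append, mem_seg] at hx
    rcases hx with ⟨k, _, _, rfl⟩ | hx
    · exact hU (hf.mem_vs k)
    · exact hKU x hx)
  rw [List.length_append, length_seg] at this
  omega

theorem CycFn.ind_add_ind_le (hf : CycFn G m f) {U : Finset V} (hU : vs f m ⊆ U)
    (hmax : Longest G U m) (ha : a ∈ U \ vs f m) (i : ℕ) :
    ind G a (f i) + ind G a (f (i + 1)) ≤ 1 := by
  rw [mem_sdiff] at ha
  by_contra hcon
  have h1 := ind_le_one (G := G) a (f i)
  have h2 := ind_le_one (G := G) a (f (i + 1))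
  have h3 := hf.three_le
  have := hf.length_le hU hmax (i := i) (j := i + 1) (by omega) (by omega) (IsP.single G a)
    (adj_of_ind (by omega)).symm (adj_of_ind (by omega))
    (by intro x hx; rw [List.mem_singleton] at hx; exact hx ▸ ha.2)
    (by intro x hx; rw [List.mem_singleton] at hx; exact hx ▸ ha.1)
  simp only [List.length_singleton] at this
  omega

theorem CycFn.two_mul_dg_le (hf : CycFn G m f) {U : Finset V} (hU : vs f m ⊆ U)
    (hmax : Longest G U m) (ha : a ∈ U \ vs f m) : 2 * dg G (vs f m) a ≤ m := by
  have h1 : ∑ i ∈ range m, (ind G a (f i) + ind G a (f (i + 1))) ≤ m := by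
    calc _ ≤ ∑ i ∈ range m, 1 := sum_le_sum fun i _ => hf.ind_add_ind_le hU hmax ha i
      _ = _ := by simp
  rw [sum_add_distrib, hf.sum_succ (ind G a), ← hf.dg_eq] at h1
  omega

theorem CycFn.two_mul_dg_add_dg_le (hf : CycFn G m f) {U : Finset V} (hU : vs f m ⊆ U)
    (hm : 4 ≤ m) (hmax : Longest G U m) (ha : a ∈ U \ vs f m) (hb : b ∈ U \ vs f m) (hab : a ≠ b)
    {z : V} (hz : z ∈ U \ vs f m) (haz : G.Adj a z) (hzb : G.Adj z b) :
    2 * (dg G (vs f m) a + dg G (vs f m) b) ≤ m := by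
  have key : ∀ {a b}, a ∈ U \ vs f m → b ∈ U \ vs f m → a ≠ b → G.Adj a z → G.Adj z b →
      ∀ i j, i < j → j < i + 4 → ind G a (f i) + ind G b (f j) ≤ 1 := by
    intro a b ha hb hab haz hzb i j hij hj
    rw [mem_sdiff] at ha hb hz
    by_contra hcon
    have h1 := ind_le_one (G := G) a (f i)
    have h2 := ind_le_one (G := G) b (f j)
    have p := ((IsP.single G b).cons hzb (by simpa using hzb.ne)).cons haz
      (by simpa using ⟨haz.ne, hab⟩)
    have := hf.length_le hU hmax hij (by omega) p
      (adj_of_ind (by omega)).symm (adj_of_ind (by omega))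
      (by
        intro x hx
        simp only [List.mem_cons, List.not_mem_nil, or_false] at hx
        rcases hx with rfl | rfl | rfl
        · exact ha.2
        · exact hz.2
        · exact hb.2)
      (by
        intro x hx
        simp only [List.mem_cons, List.not_mem_nil, or_false] at hx
        rcases hx with rfl | rfl | rfl
        · exact ha.1
        · exact hz.1
        · exact hb.1)
    simp only [List.length_cons, List.length_nil] at this
    omega
  have hwin : ∀ i, (ind G a (f i) + ind G b (f i)) + (ind G a (f (i + 1)) + ind G b (f (i + 1))) +
      (ind G a (f (i + 2)) + ind G b (f (i + 2))) +
      (ind G a (f (i + 3)) + ind G b (f (i + 3))) ≤ 2 := by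
    intro i
    have k1 := key ha hb hab haz hzb
    have k2 := key hb ha hab.symm hzb.symm haz.symm
    have a01 := k1 i (i + 1) (by omega) (by omega)
    have a02 := k1 i (i + 2) (by omega) (by omega)
    have a03 := k1 i (i + 3) (by omega) (by omega)
    have a12 := k1 (i + 1) (i + 2) (by omega) (by omega)
    have a13 := k1 (i + 1) (i + 3) (by omega) (by omega)
    have a23 := k1 (i + 2) (i + 3) (by omega) (by omega)
    have b01 := k2 i (i + 1) (by omega) (by omega)
    have b02 := k2 i (i + 2) (by omega) (by omega)
    have b03 := k2 i (i + 3) (by omega) (by omega)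
    have b12 := k2 (i + 1) (i + 2) (by omega) (by omega)
    have b13 := k2 (i + 1) (i + 3) (by omega) (by omega)
    have b23 := k2 (i + 2) (i + 3) (by omega) (by omega)
    have c0 := hf.ind_add_ind_le hU hmax ha i
    have c1 := hf.ind_add_ind_le hU hmax ha (i + 1)
    have c2 := hf.ind_add_ind_le hU hmax ha (i + 2)
    have d0 := hf.ind_add_ind_le hU hmax hb i
    have d1 := hf.ind_add_ind_le hU hmax hb (i + 1)
    have d2 := hf.ind_add_ind_le hU hmax hb (i + 2)
    clear k1 k2
    generalize ind G a (f i) = p0 at *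
    generalize ind G a (f (i + 1)) = p1 at *
    generalize ind G a (f (i + 2)) = p2 at *
    generalize ind G a (f (i + 3)) = p3 at *
    generalize ind G b (f i) = q0 at *
    generalize ind G b (f (i + 1)) = q1 at *
    generalize ind G b (f (i + 2)) = q2 at *
    generalize ind G b (f (i + 3)) = q3 at *
    rcases Nat.eq_zero_or_pos p0 with h0 | h0 <;> rcases Nat.eq_zero_or_pos p1 with h1 | h1 <;>
    rcases Nat.eq_zero_or_pos p2 with h2 | h2 <;> rcases Nat.eq_zero_or_pos p3 with h3 | h3 <;>
    omega
  have hsum := sum_le_sum (s := range m) fun i _ => hwin i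
  simp only [sum_add_distrib, hf.sum_shift (ind G a), hf.sum_shift (ind G b), ← hf.dg_eq,
    sum_const, card_range, smul_eq_mul] at hsum
  omega

theorem sum_pairs_le {O : Finset V} (hO : 2 ≤ #O) {F : V → ℕ} {q : ℕ}
    (h : ∀ a ∈ O, ∀ b ∈ O, a ≠ b → F a + F b ≤ q) : 2 * ∑ a ∈ O, F a ≤ #O * q := by
  have h1 : ∑ a ∈ O, ∑ b ∈ O.erase a, (F a + F b) ≤ ∑ a ∈ O, ∑ b ∈ O.erase a, q :=
    sum_le_sum fun a ha => sum_le_sum fun b hb =>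
      h a ha b (mem_of_mem_erase hb) (ne_of_mem_erase hb).symm
  have h2 : ∑ a ∈ O, ∑ b ∈ O.erase a, q = #O * ((#O - 1) * q) := by
    simp only [sum_const, smul_eq_mul]
    rw [sum_congr rfl fun a ha => by rw [card_erase_of_mem ha]]
    simp
  have h3 : ∑ a ∈ O, ∑ b ∈ O.erase a, (F a + F b) + 2 * ∑ a ∈ O, F a = 2 * (#O * ∑ a ∈ O, F a) := by
    rw [mul_sum, ← sum_add_distrib]
    have : ∀ a ∈ O, ∑ b ∈ O.erase a, (F a + F b) + 2 * F a = #O * F a + ∑ b ∈ O, F b := by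
      intro a ha
      have e := sum_erase_add O (fun b => F a + F b) ha
      rw [sum_add_distrib (s := O)] at e
      simp only [sum_const, smul_eq_mul] at e
      omega
    rw [sum_congr rfl this, sum_add_distrib, ← mul_sum]
    simp only [sum_const, smul_eq_mul]
    ring
  obtain ⟨k, hk⟩ : ∃ k, #O = k + 2 := ⟨#O - 2, by omega⟩
  rw [hk, show k + 2 - 1 = k + 1 by omega] at h2
  rw [hk] at h3 ⊢
  nlinarith

/-- Passing to the vertex set of a longest cycle does not decrease twice the number of edges minus
half the square of the number of vertices. -/
theorem CycFn.es_le (hf : CycFn G m f) {U : Finset V} (hU : vs f m ⊆ U)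
    (hm : 4 ≤ m) (hmax : Longest G U m) (hO : #(U \ vs f m) ≤ m) :
    2 * es G U + m * m ≤ 2 * es G (vs f m) + #U * #U := by
  set O := U \ vs f m with hOdef
  have hUm : #U = m + #O := by
    rw [← hf.card_vs, hOdef, add_comm, card_sdiff_add_card_eq_card hU]
  have hes := es_union (G := G) (disjoint_sdiff : Disjoint (vs f m) (U \ vs f m))
  rw [union_sdiff_of_subset hU] at hes
  have hF : es G U = es G (vs f m) + ∑ a ∈ O, (2 * dg G (vs f m) a + dg G O a) := by
    rw [hes, sum_add_distrib, ← mul_sum]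
    simp only [es]
    ring
  have key : 2 * ∑ a ∈ O, (2 * dg G (vs f m) a + dg G O a) ≤ #O * (2 * m + #O) := by
    rcases Nat.lt_or_ge #O 2 with h | h
    · rcases Nat.eq_zero_or_pos #O with h0 | h0
      · rw [card_eq_zero] at h0
        simp [h0]
      · obtain ⟨a, ha⟩ := card_eq_one.1 (show #O = 1 by omega)
        have h1 : a ∈ O := by simp [ha]
        have h2 := hf.two_mul_dg_le hU hmax h1
        have h3 := dg_lt_card (G := G) h1
        rw [ha, card_singleton] at h3
        rw [ha, sum_singleton, card_singleton]
        omega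
    · refine sum_pairs_le h ?_
      intro a ha b hb hab
      by_cases hz : ∃ z ∈ O, G.Adj a z ∧ G.Adj z b
      · obtain ⟨z, hz, haz, hzb⟩ := hz
        have h1 := hf.two_mul_dg_add_dg_le hU hm hmax ha hb hab hz haz hzb
        have h2 := dg_lt_card (G := G) ha
        have h3 := dg_lt_card (G := G) hb
        omega
      · push Not at hz
        have h1 := hf.two_mul_dg_le hU hmax ha
        have h2 := hf.two_mul_dg_le hU hmax hb
        have h3 : dg G O a + dg G O b ≤ #O := by
          unfold dg
          rw [← card_union_of_disjoint]
          · exact card_le_card (union_subset (filter_subset _ _) (filter_subset _ _))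
          · rw [disjoint_left]
            intro z hz1 hz2
            rw [mem_filter] at hz1 hz2
            exact hz z hz1.1 hz1.2 hz2.2.symm
        omega
  rw [hF, hUm]
  nlinarith

theorem exists_longest_cycle {U : Finset V} {L : List V} (hL : IsCyc G L) (hLU : ∀ x ∈ L, x ∈ U) :
    ∃ m f, CycFn G m f ∧ vs f m ⊆ U ∧ Longest G U m ∧ L.length ≤ m := by
  obtain ⟨m, ⟨L', h1, h2, h3⟩, h4⟩ := exists_greatest (P := fun n => ∃ L, IsCyc G L ∧
    (∀ x ∈ L, x ∈ U) ∧ L.length = n) #U ⟨_, L, hL, hLU, rfl⟩ (by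
      rintro n ⟨L, ⟨a, b, h1, _⟩, h2, rfl⟩
      exact length_le_card h1.1 h2)
  obtain ⟨f, hf, hfL⟩ := exists_cycFn h1
  rw [h3] at hf hfL
  refine ⟨m, f, hf, ?_, fun L' k1 k2 => h4 _ ⟨L', k1, k2, rfl⟩, h4 _ ⟨L, hL, hLU, rfl⟩⟩
  intro x hx
  rw [mem_vs, ← hfL] at hx
  exact h2 x hx

/-- A graph of large circumference with many edges has all short cycles. -/
theorem win_of_long {U : Finset V} {L : List V} (hL : IsCyc G L) (hLU : ∀ x ∈ L, x ∈ U)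
    (ht : 4 ≤ t) (htL : t ≤ L.length) (hU : #U ≤ 2 * t) (he : #U * #U < 2 * es G U) : Win G t := by
  obtain ⟨m, f, hf, hfU, hmax, hm⟩ := exists_longest_cycle hL hLU
  have h1 := hf.es_le hfU (by omega) hmax (by
    rw [card_sdiff_of_subset hfU, hf.card_vs]; omega)
  intro l hl hlt
  exact hf.pancyclic (by omega) hl (by omega)

end Bondy

/-- The situation of two almost complementary graphs neither of which has all short cycles. -/
structure Ctx {V : Type*} [Fintype V] (R B : SimpleGraph V) (t e : ℕ) : Prop where
  card : Fintype.card V + 1 = 2 * t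
  near : Near R B e
  he : 1000000 * e ≤ t
  ht : 10 ^ 20 ≤ t
  nR : ¬ Win R t
  nB : ¬ Win B t

section Circumference

variable {V : Type*} {G R B : SimpleGraph V} {a b : V} {m t e : ℕ} {f : ℕ → V}

theorem CycFn.not_adj_succ (hf : CycFn G m f) {U : Finset V} (hU : vs f m ⊆ U)
    (hmax : Longest G U m) (ha : a ∈ U \ vs f m) {i j : ℕ} (hij : i < j) (hj : j < i + m)
    (hi : G.Adj a (f i)) (hj' : G.Adj a (f j)) : ¬ G.Adj (f (i + 1)) (f (j + 1)) := by
  intro hadj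
  rw [mem_sdiff] at ha
  have p1 := (hf.isP_seg (i + 1) (j - i - 1) (by omega)).reverse
  rw [show i + 1 + (j - i - 1) = j by omega] at p1
  have p2 := hf.isP_seg (j + 1) (i + m - j - 1) (by omega)
  rw [show j + 1 + (i + m - j - 1) = i + m by omega, hf.per] at p2
  have p := p1.append p2 hadj (by
    intro x hx hx'
    rw [List.mem_reverse, mem_seg] at hx
    rw [mem_seg] at hx'
    obtain ⟨k, _, _, rfl⟩ := hx
    obtain ⟨l, _, _, h⟩ := hx'
    exact hf.inj k l (by omega) (by omega) h.symm)
  have hmem : ∀ x ∈ (seg f (i + 1) (j - i - 1 + 1)).reverse ++ seg f (j + 1) (i + m - j - 1 + 1),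
      x ∈ vs f m := by
    intro x hx
    simp only [List.mem_append, List.mem_reverse, mem_seg] at hx
    rcases hx with ⟨k, _, _, rfl⟩ | ⟨k, _, _, rfl⟩ <;> exact hf.mem_vs k
  have q := p.cons hj' (fun h => ha.2 (hmem _ h))
  have h3 := hf.three_le
  have := hmax _ ⟨_, _, q, hi.symm, by
    simp only [List.length_cons, List.length_append, List.length_reverse, length_seg]; omega⟩ (by
    intro x hx
    rw [List.mem_cons] at hx
    rcases hx with rfl | hx
    · exact ha.1
    · exact hU (hmem x hx))
  simp only [List.length_cons, List.length_append, List.length_reverse, length_seg] at this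
  omega

theorem CycFn.exists_independent (hf : CycFn G m f) {U : Finset V} (hU : vs f m ⊆ U)
    (hmax : Longest G U m) (ha : a ∈ U \ vs f m) :
    ∃ I ⊆ vs f m, dg G (vs f m) a ≤ #I ∧ ∀ x ∈ I, ∀ y ∈ I, ¬ G.Adj x y := by
  refine ⟨((range m).filter fun i => f i ∈ vs f m ∧ G.Adj a (f i)).image fun i => f (i + 1),
    ?_, ?_, ?_⟩
  · intro x hx
    obtain ⟨i, _, rfl⟩ := mem_image.1 hx
    exact hf.mem_vs _
  · rw [card_image_of_injOn]
    · exact card_positions (fun y hy _ => hy)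
    · intro i hi j hj hij
      rw [mem_coe, mem_filter, mem_range] at hi hj
      by_contra hne
      rcases Nat.lt_or_gt_of_ne hne with h1 | h1
      · exact hf.inj (i + 1) (j + 1) (by omega) (by omega) hij
      · exact hf.inj (j + 1) (i + 1) (by omega) (by omega) hij.symm
  · intro x hx y hy
    obtain ⟨i, hi, rfl⟩ := mem_image.1 hx
    obtain ⟨j, hj, rfl⟩ := mem_image.1 hy
    rw [mem_filter, mem_range] at hi hj
    rcases lt_trichotomy i j with h | rfl | h
    · exact hf.not_adj_succ hU hmax ha h (by omega) hi.2.2 hj.2.2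
    · exact G.loopless.irrefl _
    · intro hadj
      exact hf.not_adj_succ hU hmax ha h (by omega) hj.2.2 hi.2.2 hadj.symm

theorem es_add_sq_le {I W : Finset V} (hI : I ⊆ W) (h : ∀ x ∈ I, ∀ y ∈ I, ¬ G.Adj x y) :
    es G W + #I * #I ≤ #W * #W := by
  have h1 := es_union (G := G) (sdiff_disjoint : Disjoint (W \ I) I)
  rw [sdiff_union_of_subset hI] at h1
  have h2 : es G I = 0 := by
    unfold es
    refine sum_eq_zero fun x hx => ?_
    rw [dg, card_eq_zero, filter_eq_empty_iff]
    exact fun y hy => h x hx y hy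
  have h3 := es_le_card_sq (G := G) (W \ I)
  have h4 : ∑ v ∈ I, dg G (W \ I) v ≤ #I * #(W \ I) := by
    calc _ ≤ ∑ v ∈ I, #(W \ I) := sum_le_sum fun v _ => dg_le_card _ v
      _ = _ := by simp
  have h5 := card_sdiff_add_card_eq_card hI
  rw [← h5]
  nlinarith

theorem es_erase {W : Finset V} {v : V} (hv : v ∈ W) :
    es G (W.erase v) + 2 * dg G W v = es G W := by
  have h1 := es_union (G := G) (S := W.erase v) (T := {v}) (by simp)
  have h2 : W.erase v ∪ {v} = W := by
    rw [union_comm, ← insert_eq, insert_erase hv]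
  have h3 := dg_union (G := G) (S := W.erase v) (T := {v}) (by simp) v
  have h4 : dg G {v} v = 0 := by
    rw [dg, card_eq_zero, filter_eq_empty_iff]
    simp
  rw [h2] at h1 h3
  simp only [sum_singleton, es, h4] at h1 ⊢
  omega

/-- A subset with large minimum degree, found by maximization. -/
theorem exists_max_subset (U : Finset V) (d k : ℕ) (hk : k ≤ #U) : ∃ W ⊆ U, k ≤ #W ∧
    es G U + 2 * d * #W ≤ es G W + 2 * d * #U ∧ (k < #W → ∀ v ∈ W, d ≤ dg G W v) := by
  obtain ⟨W, hW, hmax⟩ := exists_max_image (U.powerset.filter fun W => k ≤ #W)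
    (fun W => (es G W : ℤ) - 2 * d * #W) ⟨U, by simp [hk]⟩
  simp only [mem_filter, mem_powerset, and_imp] at hW hmax
  refine ⟨W, hW.1, hW.2, ?_, ?_⟩
  · have := hmax U subset_rfl hk
    zify
    linarith
  · intro hkW v hv
    have h1 := card_erase_of_mem hv
    have h2 := hmax (W.erase v) ((erase_subset _ _).trans hW.1) (by omega)
    have h3 := es_erase (G := G) hv
    have h4 : #(W.erase v) + 1 = #W := by omega
    zify at h3 h4
    rw [← h3, ← h4] at h2
    have : (d : ℤ) ≤ dg G W v := by linarith
    exact_mod_cast this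

variable [Fintype V]

theorem Ctx.exists_adj (h : Ctx R B t e) {A Y : Finset V} (hAY : Disjoint A Y)
    (hA : 5001 * t ≤ 10000 * #A) (hY : 5001 * t ≤ 10000 * #Y) : ∃ a ∈ A, ∃ y ∈ Y, R.Adj a y := by
  by_contra! hcon
  have h1 := h.he
  have h2 := h.ht
  rcases win_of_joined h.card h.near.symm (A := A) (Y := Y) (τ := e) hAY (by
    intro a ha
    have h3 := h.near a Y
    have h4 : dg R Y a = 0 := by
      rw [dg, card_eq_zero, filter_eq_empty_iff]
      exact fun y hy => hcon a ha y hy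
    omega) (by omega) (by omega) (by omega) with h3 | h3
  · exact h.nB h3
  · exact h.nR h3

theorem card_bound {d w u t E F : ℤ} (ht : 10 ^ 20 ≤ t) (hd1 : 5001 * t ≤ 10000 * d)
    (hd2 : 10000 * d ≤ 5001 * t + 10000) (hu : 19989 * t ≤ 10000 * u)
    (hE : u * u < 2 * E) (hF : E + 2 * d * w ≤ F + 2 * d * u) :
    40000 * (d * w) ≤ 20000 * F + 31 * (t * t) := by
  have h1 : (u - 2 * d) * (u - 2 * d) + 4 * (d * w) ≤ 2 * F + 4 * (d * d) := by nlinarith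
  have h2 : (9986 * t) * (9986 * t) ≤ (10000 * (u - 2 * d)) * (10000 * (u - 2 * d)) := by
    apply mul_self_le_mul_self <;> linarith
  have h3 : (10000 * d) * (10000 * d) ≤ (5001 * t + 10000) * (5001 * t + 10000) := by
    apply mul_self_le_mul_self <;> linarith
  nlinarith

/-- Large sets contain at most half of the possible edges. -/
theorem Ctx.es_le (h : Ctx R B t e) {U : Finset V} (hU : 19989 * t ≤ 10000 * #U) :
    2 * es R U ≤ #U * #U := by
  by_contra! hcon
  have he := h.he
  have ht := h.ht
  have hV : ∀ S : Finset V, #S + 1 ≤ 2 * t := fun S => by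
    have := card_le_univ S
    have := h.card
    omega
  obtain ⟨d, hd1, hd2⟩ : ∃ d, 5001 * t ≤ 10000 * d ∧ 10000 * d ≤ 5001 * t + 10000 :=
    ⟨(5001 * t + 9999) / 10000, by omega, by omega⟩
  obtain ⟨W, hWU, hWt, hWe, hWd⟩ := exists_max_subset (G := R) U d (t / 2) (by omega)
  have hb : 40000 * (d * #W) ≤ 20000 * es R W + 31 * (t * t) := by
    have := card_bound (d := d) (w := #W) (u := #U) (t := t) (E := es R U) (F := es R W)
      (by exact_mod_cast ht) (by exact_mod_cast hd1) (by exact_mod_cast hd2) (by exact_mod_cast hU)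
      (by exact_mod_cast hcon) (by exact_mod_cast hWe)
    exact_mod_cast this
  have hes := es_le_card_sq (G := R) W
  have hdw : 5001 * t * #W ≤ 10000 * d * #W := Nat.mul_le_mul_right _ hd1
  have hw : 998 * t ≤ 1000 * #W := by
    by_contra! hlt
    have h1 : t ≤ 2 * #W + 1 := by omega
    zify at *
    nlinarith [mul_nonneg (sub_nonneg.2 h1) (sub_nonneg.2 hlt.le),
      mul_nonneg (sub_nonneg.2 hlt.le) (by linarith : (0 : ℤ) ≤ t)]
  have hdeg := hWd (by omega)
  have hc0 : ∀ A B : Finset V, Disjoint A B → d ≤ #A → d ≤ #B →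
      ∃ a ∈ A, ∃ b ∈ B, R.Adj a b := fun A B hAB hA hB => h.exists_adj hAB (by omega) (by omega)
  obtain ⟨L, hL, hLW, -, hLlen⟩ := exists_long_cycle (G := R) (S := W) (T := ∅) (d := d)
    (by omega) (card_pos.1 (by omega)) hdeg (by simp) (by
      intro A B Z hA hB hAB hA' hB' _
      obtain ⟨a, ha, b, hb, hab⟩ := hc0 A B hAB hA' hB'
      exact ⟨a, ha, b, hb, [], Or.inl ⟨rfl, hab⟩, by simp, by simp⟩)
  replace hLW : ∀ x ∈ L, x ∈ W := fun x hx => (hLW x hx).resolve_right (by simp)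
  have hUV := hV U
  by_cases hWt' : t ≤ #W
  · exact h.nR (win_of_long hL (fun x hx => hWU (hLW x hx)) (by omega) (by omega) (by omega) hcon)
  -- enlarge `W` to `t` vertices
  set X := (univ \ W).filter fun v => t ≤ 10 * dg R W v with hX
  have hXc : t ≤ #X + #W := by
    by_contra! hlt
    have h1 : #(univ \ W) = #((univ \ W).filter fun v => t ≤ 10 * dg R W v) +
      #((univ \ W).filter fun v => ¬ t ≤ 10 * dg R W v) :=
      (card_filter_add_card_filter_not _).symm
    rw [← hX] at h1
    have h2 := card_sdiff_add_card_eq_card (subset_univ W)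
    rw [card_univ] at h2
    have h3 := h.card
    rcases win_of_joined h.card h.near.symm
      (A := (univ \ W).filter fun v => ¬ t ≤ 10 * dg R W v) (Y := W) (τ := t / 10 + e)
      (disjoint_left.2 fun x hx hxW => (mem_sdiff.1 (mem_filter.1 hx).1).2 hxW) (by
      intro a ha
      have h3 := h.near a W
      have h4 := (mem_filter.1 ha).2
      omega) (by omega) (by omega) (by omega) with h3 | h3
    · exact h.nB h3
    · exact h.nR h3
  obtain ⟨X', hX', hX'c⟩ := exists_subset_card_eq (s := X) (n := t - #W) (by omega)
  have hdis : Disjoint W X' := disjoint_left.2 fun x hxW hx =>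
    (mem_sdiff.1 (mem_filter.1 (hX' hx)).1).2 hxW
  have hMc : #(W ∪ X') = t := by rw [card_union_of_disjoint hdis]; omega
  obtain ⟨m, f, hf, hfM, hmax, hm⟩ := exists_longest_cycle hL
    (U := W ∪ X') (fun x hx => mem_union_left _ (hLW x hx))
  have hmt : m ≤ t := by
    rw [← hf.card_vs, ← hMc]
    exact card_le_card hfM
  have hmono := es_mono (G := R) (subset_union_left : W ⊆ W ∪ X')
  rcases hmt.eq_or_lt with rfl | hmt
  · apply h.nR
    intro l hl hlm
    refine hf.pancyclic ?_ hl hlm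
    rw [eq_of_subset_of_card_le hfM (by rw [hf.card_vs]; omega)]
    zify at *
    nlinarith
  · obtain ⟨y, hy⟩ : ((W ∪ X') \ vs f m).Nonempty := by
      rw [← card_pos, card_sdiff_of_subset hfM, hf.card_vs]; omega
    obtain ⟨I, hI, hIc, hind⟩ := hf.exists_independent hfM hmax hy
    have hyW : t ≤ 10 * dg R W y := by
      rcases mem_union.1 (mem_sdiff.1 hy).1 with h1 | h1
      · have := hdeg y h1
        omega
      · exact (mem_filter.1 (hX' h1)).2
    have h1 : dg R W y ≤ dg R (vs f m) y + #((W ∪ X') \ vs f m) := by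
      calc _ ≤ dg R (vs f m ∪ ((W ∪ X') \ vs f m)) y := dg_mono (by
            rw [union_sdiff_of_subset hfM]; exact subset_union_left) y
        _ ≤ _ := by
          rw [dg_union disjoint_sdiff]
          have := dg_le_card (G := R) ((W ∪ X') \ vs f m) y
          omega
    rw [card_sdiff_of_subset hfM, hf.card_vs] at h1
    have h2 : #I ≤ #(I ∩ W) + #X' := by
      rw [← card_sdiff_add_card_inter I W]
      have : I \ W ⊆ X' := by
        intro x hx
        rw [mem_sdiff] at hx
        exact (mem_union.1 (hfM (hI hx.1))).resolve_left hx.2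
      have := card_le_card this
      omega
    have h3 := es_add_sq_le (G := R) (I := I ∩ W) inter_subset_right
      (fun x hx y hy => hind x (mem_inter.1 hx).1 y (mem_inter.1 hy).1)
    have h4 : 96 * t ≤ 1000 * #(I ∩ W) + 2 := by omega
    have h5 : (95 * t) * (95 * t) ≤ (1000 * #(I ∩ W)) * (1000 * #(I ∩ W)) :=
      Nat.mul_self_le_mul_self (by omega)
    have h6 : #W * #W ≤ t * #W := Nat.mul_le_mul_right _ (by omega)
    have h7 : 0 < t * t := by positivity
    nlinarith

end Circumference

section Core

variable {V : Type*} {G R B : SimpleGraph V} {t e : ℕ}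

/-- A set of minimum degree at least `d` contains a path on `d + 1` vertices. -/
theorem exists_path_of_dg {D : Finset V} {d : ℕ} (hD : D.Nonempty) (h : ∀ v ∈ D, d ≤ dg G D v) :
    ∃ f, PathFn G (d + 1) f ∧ ∀ i < d + 1, f i ∈ D := by
  obtain ⟨x, hx⟩ := hD
  obtain ⟨b, L, hL, hLD, hmax⟩ := exists_longest_from (G := G) hx
  obtain ⟨f, hf, -, -, hfL, -⟩ := exists_pathFn hL
  have h1 : d + 1 ≤ L.length := by
    have h2 := h b (hLD b hL.last_mem)
    have h3 : D.filter (G.Adj b) ⊆ L.toFinset.erase b := by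
      intro y hy
      rw [mem_filter] at hy
      rw [mem_erase, List.mem_toFinset]
      exact ⟨hy.2.ne', mem_of_longest_from hL hLD hmax hy.1 hy.2⟩
    have h4 := card_le_card h3
    rw [card_erase_of_mem (List.mem_toFinset.2 hL.last_mem),
      List.toFinset_card_of_nodup hL.1] at h4
    have := hL.length_pos
    unfold dg at h2
    omega
  exact ⟨f, ⟨fun i j hij hj => hf.inj i j hij (by omega), fun i hi => hf.adj i (by omega)⟩,
    fun i hi => hLD _ ((hfL _).2 ⟨i, by omega, rfl⟩)⟩

theorem fan_hasCyc {D : Finset V} {d l : ℕ} {x : V} (hD : D.Nonempty) (h : ∀ v ∈ D, d ≤ dg G D v)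
    (hx : ∀ v ∈ D, G.Adj x v) (hl : 3 ≤ l) (hld : l ≤ d + 2) : HasCyc G l := by
  obtain ⟨f, hf, hfD⟩ := exists_path_of_dg hD h
  have h1 := hf.isP_seg 0 (l - 2) (by omega)
  have h2 := h1.cons (hx _ (hfD 0 (by omega))) (by
    rw [mem_seg]
    rintro ⟨i, _, hi, hix⟩
    exact (hx _ (hfD i (by omega))).ne hix.symm)
  have h3 := h2.hasCyc (hx _ (hfD _ (by omega))).symm (by simp; omega)
  simp only [List.length_cons, length_seg] at h3
  rwa [show l - 2 + 1 + 1 = l by omega] at h3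

variable [Fintype V]

theorem removal_arith {t k n e N E U : ℤ} (ht : 10 ^ 20 ≤ t) (he : 1000000 * e ≤ t)
    (hn : n + 1 = 2 * t) (hk1 : t ≤ 1000 * k) (hk2 : 1000 * k ≤ t + 1000) (hN : N = n - k)
    (hE : n * n ≤ 2 * E + n * e) (hU : 1000 * E ≤ 1000 * U + 2 * (k * (999 * t))) :
    N * N < 2 * U := by
  subst hN
  obtain rfl : n = 2 * t - 1 := by linarith
  have h1 : 1000000 * ((2 * t - 1) * e) ≤ (2 * t - 1) * t := by nlinarith
  have h2 : k * (1000 * k) ≤ k * (t + 1000) := by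
    apply mul_le_mul_of_nonneg_left hk2; linarith
  have h3 : t * t ≤ 1000 * (k * t) := by nlinarith
  have h4 : 10 ^ 20 * t ≤ t * t := by nlinarith
  nlinarith

/-- Almost all vertices have large degree in the denser graph. -/
theorem Ctx.exists_core (h : Ctx R B t e) (hRB : es B univ ≤ es R univ) :
    ∃ V₀ : Finset V, 1999 * t ≤ 1000 * #V₀ + 1000 ∧ ∀ v ∈ V₀, 998 * t ≤ 1000 * dg R V₀ v := by
  have ht := h.ht
  have he := h.he
  have hcard := h.card
  set X := (univ : Finset V).filter fun v => 1000 * dg R univ v < 999 * t with hX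
  have hXc : 1000 * #X ≤ t := by
    by_contra! hcon
    obtain ⟨X', hX', hX'c⟩ := exists_subset_card_eq (s := X) (n := t / 1000 + 1) (by omega)
    have hu := card_sdiff_add_card_eq_card (subset_univ X')
    rw [card_univ] at hu
    have h1 := h.es_le (U := univ \ X') (by omega)
    have h2 := es_union (G := R) (sdiff_disjoint : Disjoint (univ \ X') X')
    rw [sdiff_union_of_subset (subset_univ X')] at h2
    have h3 : es R X' = ∑ v ∈ X', dg R X' v := rfl
    have h4 : ∑ v ∈ X', dg R univ v = ∑ v ∈ X', dg R (univ \ X') v + ∑ v ∈ X', dg R X' v := by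
      rw [← sum_add_distrib]
      exact sum_congr rfl fun v _ => (dg_sdiff_add (subset_univ X') v).symm
    have h5 : 1000 * ∑ v ∈ X', dg R univ v ≤ #X' * (999 * t) := by
      rw [mul_sum]
      calc _ ≤ ∑ v ∈ X', 999 * t := sum_le_sum fun v hv => (mem_filter.1 (hX' hv)).2.le
        _ = _ := by simp
    have h6 : Fintype.card V * Fintype.card V ≤ 2 * es R univ + Fintype.card V * e := by
      calc Fintype.card V * Fintype.card V = ∑ v : V, #(univ : Finset V) := by simp
        _ ≤ ∑ v : V, (dg R univ v + dg B univ v + e) := sum_le_sum fun v _ => h.near v univ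
        _ = es R univ + es B univ + Fintype.card V * e := by
          rw [sum_add_distrib, sum_add_distrib]
          simp [es]
        _ ≤ _ := by omega
    have := removal_arith (t := t) (k := #X') (n := Fintype.card V) (e := e) (N := #(univ \ X'))
      (E := es R univ) (U := es R (univ \ X')) (by exact_mod_cast ht) (by exact_mod_cast he)
      (by exact_mod_cast hcard) (by omega) (by omega) (by omega) (by exact_mod_cast h6)
      (by
        have : 1000 * es R univ ≤ 1000 * es R (univ \ X') + 2 * (#X' * (999 * t)) := by omega
        exact_mod_cast this)
    have h7 : #(univ \ X') * #(univ \ X') < 2 * es R (univ \ X') := by exact_mod_cast this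
    omega
  have hu := card_sdiff_add_card_eq_card (subset_univ X)
  rw [card_univ] at hu
  refine ⟨univ \ X, by omega, fun v hv => ?_⟩
  have h1 := dg_sdiff_add (G := R) (subset_univ X) v
  have h2 := dg_le_card (G := R) X v
  have h3 : ¬ 1000 * dg R univ v < 999 * t := fun h => (mem_sdiff.1 hv).2 (by simp [hX, h])
  omega

/-- The neighbourhood of a core vertex contains a set with linear minimum degree. -/
theorem Ctx.exists_fan (h : Ctx R B t e) {V₀ : Finset V} (h1 : 1999 * t ≤ 1000 * #V₀ + 1000)
    (h2 : ∀ v ∈ V₀, 998 * t ≤ 1000 * dg R V₀ v) {x : V} (hx : x ∈ V₀) :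
    ∃ D ⊆ V₀, D.Nonempty ∧ (∀ v ∈ D, R.Adj x v) ∧ ∀ v ∈ D, t / 25 ≤ dg R D v := by
  have ht := h.ht
  have he := h.he
  have hcard := h.card
  have hV₀ := card_le_univ V₀
  obtain ⟨N, hN, hNc⟩ := exists_subset_card_eq (s := V₀.filter (R.Adj x)) (n := 99 * t / 100) (by
    have := h2 x hx
    unfold dg at this
    omega)
  have hNV : N ⊆ V₀ := hN.trans (filter_subset _ _)
  obtain ⟨D, hDN, -, hDe, hDd⟩ := exists_max_subset (G := R) N (t / 25) 0 (by omega)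
  refine ⟨D, hDN.trans hNV, ?_, fun v hv => (mem_filter.1 (hN (hDN hv))).2, fun v hv =>
    hDd (card_pos.2 ⟨v, hv⟩) v hv⟩
  rw [nonempty_iff_ne_empty]
  rintro rfl
  simp only [card_empty, mul_zero, add_zero] at hDe
  have h3 : es R (∅ : Finset V) = 0 := by simp [es]
  rw [h3, zero_add] at hDe
  have hA := card_filter_add_card_filter_not (s := N) (fun v => 5 * dg R N v < t)
  have hes : #(N.filter fun v => ¬ 5 * dg R N v < t) * t ≤ 5 * es R N := by
    calc _ = ∑ v ∈ N.filter fun v => ¬ 5 * dg R N v < t, t := by simp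
      _ ≤ ∑ v ∈ N.filter fun v => ¬ 5 * dg R N v < t, 5 * dg R N v :=
        sum_le_sum fun v hv => not_lt.1 (mem_filter.1 hv).2
      _ ≤ ∑ v ∈ N, 5 * dg R N v := sum_le_sum_of_subset (filter_subset _ _)
      _ = _ := by rw [es, mul_sum]
  have hsmall : 5 * #(N.filter fun v => ¬ 5 * dg R N v < t) ≤ 2 * #N := by
    have h4 : 25 * (t / 25) ≤ t := Nat.mul_div_le t 25
    have h5 : 25 * (t / 25) * #N ≤ t * #N := Nat.mul_le_mul_right _ h4
    have h6 : 0 < t := by omega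
    by_contra hcon
    rw [not_le] at hcon
    have h7 := Nat.mul_lt_mul_of_pos_right hcon h6
    nlinarith
  have hsd := card_sdiff_add_card_eq_card hNV
  rcases win_of_joined h.card h.near (A := N.filter fun v => 5 * dg R N v < t) (Y := V₀ \ N)
    (τ := 213 * t / 1000) (disjoint_left.2 fun y hy hy' =>
      (mem_sdiff.1 hy').2 (mem_filter.1 hy).1) (by
    intro a ha
    rw [mem_filter] at ha
    have h4 := dg_sdiff_add (G := R) hNV a
    have h5 := h2 a (hNV ha.1)
    omega) (by omega) (by omega) (by omega) with h4 | h4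
  · exact h.nR h4
  · exact h.nB h4

end Core

section Rounding

variable {V ι : Type*}

theorem card_insert_inter {v : V} {S N : Finset V} (hv : v ∉ S) :
    (#(insert v S ∩ N) : ℚ) = #(S ∩ N) + if v ∈ N then 1 else 0 := by
  split_ifs with h
  · rw [insert_inter_of_mem h, card_insert_of_notMem fun h' => hv (mem_inter.1 h').1]
    push_cast; ring
  · rw [insert_inter_of_notMem h, add_zero]

/-- Derandomized second moment method: some subset of density `q` meets many given sets in about
the expected number of elements. -/
theorem exists_subset_sq_le (I : Finset ι) (N : ι → Finset V) {q : ℚ} (h0 : 0 ≤ q) (h1 : q ≤ 1)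
    (T : Finset V) : ∀ c : ι → ℚ, ∃ S ⊆ T,
      ∑ i ∈ I, (c i + #(S ∩ N i) - q * #(T ∩ N i)) ^ 2 ≤
        ∑ i ∈ I, (c i) ^ 2 + q * (1 - q) * ∑ i ∈ I, (#(T ∩ N i) : ℚ) := by
  induction T using Finset.induction_on with
  | empty => exact fun c => ⟨∅, subset_rfl, by simp⟩
  | insert v T hv ih =>
    intro c
    set z : ι → ℚ := fun i => if v ∈ N i then 1 else 0 with hz
    have hsum : (1 - q) * ∑ i ∈ I, (c i - q * z i) ^ 2 + q * ∑ i ∈ I, (c i + (1 - q) * z i) ^ 2 =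
        ∑ i ∈ I, (c i) ^ 2 + q * (1 - q) * ∑ i ∈ I, z i := by
      rw [mul_sum, mul_sum, mul_sum, ← sum_add_distrib, ← sum_add_distrib]
      refine sum_congr rfl fun i _ => ?_
      simp only [hz]
      split_ifs <;> ring
    have hT : ∑ i ∈ I, (#(insert v T ∩ N i) : ℚ) = ∑ i ∈ I, (#(T ∩ N i) : ℚ) + ∑ i ∈ I, z i := by
      rw [← sum_add_distrib]
      exact sum_congr rfl fun i _ => card_insert_inter hv
    rw [hT]
    by_cases hA : ∑ i ∈ I, (c i - q * z i) ^ 2 ≤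
        ∑ i ∈ I, (c i) ^ 2 + q * (1 - q) * ∑ i ∈ I, z i
    · obtain ⟨S, hS, hS'⟩ := ih fun i => c i - q * z i
      refine ⟨S, hS.trans (subset_insert _ _), ?_⟩
      calc _ = ∑ i ∈ I, (c i - q * z i + #(S ∩ N i) - q * #(T ∩ N i)) ^ 2 := by
            refine sum_congr rfl fun i _ => ?_
            rw [card_insert_inter hv]
            ring
        _ ≤ _ := by linarith
    · have hB : ∑ i ∈ I, (c i + (1 - q) * z i) ^ 2 ≤
          ∑ i ∈ I, (c i) ^ 2 + q * (1 - q) * ∑ i ∈ I, z i := by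
        by_contra hB
        rw [not_le] at hA hB
        rcases h0.eq_or_lt with rfl | h0
        · simp at hA
        · nlinarith [mul_lt_mul_of_pos_left hB h0,
            mul_le_mul_of_nonneg_left hA.le (sub_nonneg.2 h1)]
      obtain ⟨S, hS, hS'⟩ := ih fun i => c i + (1 - q) * z i
      refine ⟨insert v S, insert_subset_insert _ hS, ?_⟩
      calc _ = ∑ i ∈ I, (c i + (1 - q) * z i + #(S ∩ N i) - q * #(T ∩ N i)) ^ 2 := by
            refine sum_congr rfl fun i _ => ?_
            rw [card_insert_inter hv, card_insert_inter fun h => hv (hS h)]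
            ring
        _ ≤ _ := by linarith

/-- A subset of density `q` meeting the sets `M` in the expected number of elements, and likewise
for all but few members of the families `N₁`, `N₂`. -/
theorem exists_rounded [Fintype V] [Nonempty V] (N₁ N₂ : V → Finset V) (M₁ M₂ : Finset V) {q r : ℚ}
    (h0 : 0 ≤ q) (h1 : q ≤ 1) (hr : 0 < r) (hV : Fintype.card V < r ^ 2) (T : Finset V) :
    ∃ S ⊆ T, ∃ W : Finset V, #W * r ^ 2 ≤ (Fintype.card V : ℚ) ^ 2 ∧
      |(#(S ∩ M₁) : ℚ) - q * #(T ∩ M₁)| ≤ r ∧ |(#(S ∩ M₂) : ℚ) - q * #(T ∩ M₂)| ≤ r ∧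
      ∀ v ∉ W, |(#(S ∩ N₁ v) : ℚ) - q * #(T ∩ N₁ v)| ≤ r ∧
        |(#(S ∩ N₂ v) : ℚ) - q * #(T ∩ N₂ v)| ≤ r := by
  set n : ℚ := (Fintype.card V : ℚ) with hn
  obtain ⟨S, hST, hS⟩ := exists_subset_sq_le (univ : Finset (V × Fin 4))
    (fun i => ![N₁ i.1, N₂ i.1, M₁, M₂] i.2) h0 h1 T fun _ => 0
  simp only [zero_add, ne_eq, OfNat.ofNat_ne_zero, not_false_eq_true, zero_pow, sum_const_zero,
    Fintype.sum_prod_type, Fin.sum_univ_four, Matrix.cons_val_zero, Matrix.cons_val_one,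
    Matrix.cons_val] at hS
  have hq : q * (1 - q) ≤ 1 / 4 := by nlinarith [sq_nonneg (q - 1 / 2)]
  have hle : ∀ X : Finset V, (#(T ∩ X) : ℚ) ≤ n := fun X => by
    rw [hn]; exact_mod_cast card_le_univ _
  have hn0 : 0 < n := by rw [hn]; exact_mod_cast Fintype.card_pos
  have hbound : ∑ v : V, ((#(T ∩ N₁ v) : ℚ) + #(T ∩ N₂ v) + #(T ∩ M₁) + #(T ∩ M₂)) ≤
      n * (4 * n) := by
    calc _ ≤ ∑ v : V, 4 * n := sum_le_sum fun v _ => by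
          linarith [hle (N₁ v), hle (N₂ v), hle M₁, hle M₂]
      _ = _ := by rw [sum_const, card_univ, nsmul_eq_mul]
  have hnonneg : 0 ≤ ∑ v : V, ((#(T ∩ N₁ v) : ℚ) + #(T ∩ N₂ v) + #(T ∩ M₁) + #(T ∩ M₂)) :=
    sum_nonneg fun v _ => by positivity
  have htot := hS.trans ((mul_le_mul hq hbound hnonneg (by norm_num)).trans_eq
    (by ring : 1 / 4 * (n * (4 * n)) = n ^ 2))
  set W := (univ : Finset V).filter fun v => ¬ (|(#(S ∩ N₁ v) : ℚ) - q * #(T ∩ N₁ v)| ≤ r ∧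
        |(#(S ∩ N₂ v) : ℚ) - q * #(T ∩ N₂ v)| ≤ r) with hW
  have hsq : ∀ y : ℚ, ¬ |y| ≤ r → r ^ 2 ≤ y ^ 2 := fun y hy => by
    rw [← sq_abs y]
    exact pow_le_pow_left₀ hr.le (not_le.1 hy).le 2
  have hM : ∀ y : ℚ, n * y ^ 2 ≤ n ^ 2 → |y| ≤ r := by
    intro y hy
    by_contra hcon
    rw [not_le] at hcon
    have h3 : r ^ 2 ≤ y ^ 2 := hsq y (not_le.2 hcon)
    have h4 : y ^ 2 ≤ n := by nlinarith
    linarith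
  refine ⟨S, hST, W, ?_, hM _ ?_, hM _ ?_, fun v hv => ?_⟩
  · calc (#W : ℚ) * r ^ 2 = ∑ v ∈ W, r ^ 2 := by simp
      _ ≤ ∑ v ∈ W, (((#(S ∩ N₁ v) : ℚ) - q * #(T ∩ N₁ v)) ^ 2 +
          ((#(S ∩ N₂ v) : ℚ) - q * #(T ∩ N₂ v)) ^ 2 + ((#(S ∩ M₁) : ℚ) - q * #(T ∩ M₁)) ^ 2 +
          ((#(S ∩ M₂) : ℚ) - q * #(T ∩ M₂)) ^ 2) := by
        refine sum_le_sum fun v hv => ?_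
        rcases not_and_or.1 (mem_filter.1 hv).2 with h | h
        · have := hsq _ h
          linarith [sq_nonneg ((#(S ∩ N₂ v) : ℚ) - q * #(T ∩ N₂ v)),
            sq_nonneg ((#(S ∩ M₁) : ℚ) - q * #(T ∩ M₁)),
            sq_nonneg ((#(S ∩ M₂) : ℚ) - q * #(T ∩ M₂))]
        · have := hsq _ h
          linarith [sq_nonneg ((#(S ∩ N₁ v) : ℚ) - q * #(T ∩ N₁ v)),
            sq_nonneg ((#(S ∩ M₁) : ℚ) - q * #(T ∩ M₁)),
            sq_nonneg ((#(S ∩ M₂) : ℚ) - q * #(T ∩ M₂))]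
      _ ≤ _ := (sum_le_univ_sum_of_nonneg fun v => by positivity).trans htot
  · refine le_trans ?_ htot
    calc _ = ∑ v : V, ((#(S ∩ M₁) : ℚ) - q * #(T ∩ M₁)) ^ 2 := by rw [sum_const, card_univ, nsmul_eq_mul]
      _ ≤ _ := sum_le_sum fun v _ => by
        linarith [sq_nonneg ((#(S ∩ N₁ v) : ℚ) - q * #(T ∩ N₁ v)),
          sq_nonneg ((#(S ∩ N₂ v) : ℚ) - q * #(T ∩ N₂ v)),
          sq_nonneg ((#(S ∩ M₂) : ℚ) - q * #(T ∩ M₂))]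
  · refine le_trans ?_ htot
    calc _ = ∑ v : V, ((#(S ∩ M₂) : ℚ) - q * #(T ∩ M₂)) ^ 2 := by rw [sum_const, card_univ, nsmul_eq_mul]
      _ ≤ _ := sum_le_sum fun v _ => by
        linarith [sq_nonneg ((#(S ∩ N₁ v) : ℚ) - q * #(T ∩ N₁ v)),
          sq_nonneg ((#(S ∩ N₂ v) : ℚ) - q * #(T ∩ N₂ v)),
          sq_nonneg ((#(S ∩ M₁) : ℚ) - q * #(T ∩ M₁))]
  · by_contra hcon
    exact hv (by simp only [hW, mem_filter, mem_univ, true_and]; exact hcon)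

end Rounding

section Positions

variable {V : Type*} {G : SimpleGraph V} {x y : V} {m g : ℕ} {f : ℕ → V}

/-- Two vertices with many neighbours on a cycle have neighbours at a short distance. -/
theorem CycFn.exists_close (hf : CycFn G m f) (hg : 1 ≤ g) (hgm : g < m)
    (hx : 0 < dg G (vs f m) x) (hy : 0 < dg G (vs f m) y)
    (h : m + 2 ≤ dg G (vs f m) x + dg G (vs f m) y + g) :
    ∃ i j, i < j ∧ j ≤ i + g ∧ G.Adj x (f i) ∧ G.Adj y (f j) := by
  by_contra! hcon
  obtain ⟨w, hw⟩ := card_pos.1 hy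
  rw [mem_filter, _root_.MonoCycle.mem_vs] at hw
  obtain ⟨⟨j₀, hj₀, rfl⟩, hyj⟩ := hw
  obtain ⟨w, hw⟩ := card_pos.1 hx
  rw [mem_filter, _root_.MonoCycle.mem_vs] at hw
  obtain ⟨⟨i₀, hi₀, rfl⟩, hxi⟩ := hw
  obtain ⟨i, ⟨hi, hxi'⟩, hmax⟩ := exists_greatest
    (P := fun i => i < j₀ + m ∧ G.Adj x (f i)) (j₀ + m) ⟨i₀, by omega, hxi⟩ fun i hi => hi.1.le
  have hfar : i + g < j₀ + m := by
    by_contra hlt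
    refine hcon i (j₀ + m) hi (by omega) hxi' ?_
    rwa [hf.per]
  have hh := hf.shift i
  have hxg : ∀ p, 1 ≤ p → p ≤ g → ¬ G.Adj x (f (p + i)) := by
    intro p hp hpg hadj
    have := hmax (p + i) ⟨by omega, hadj⟩
    omega
  rw [← hf.vs_shift i] at h
  have hX := card_positions (G := G) (S := vs (fun p => f (p + i)) m) (v := x)
    (f := fun p => f (p + i)) (n := m) fun y hy _ => hy
  have hY := card_positions (G := G) (S := vs (fun p => f (p + i)) m) (v := y)
    (f := fun p => f (p + i)) (n := m) fun y hy _ => hy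
  have hX' : (range m).filter (fun p => f (p + i) ∈ vs (fun p => f (p + i)) m ∧
      G.Adj x (f (p + i))) ⊆ insert 0 ((Ico (g + 1) m).filter fun p => G.Adj x (f (p + i))) := by
    intro p hp
    rw [mem_filter, mem_range] at hp
    rw [mem_insert, mem_filter, mem_Ico]
    by_cases hp0 : p = 0
    · exact Or.inl hp0
    · refine Or.inr ⟨⟨?_, hp.1⟩, hp.2.2⟩
      by_contra hpg
      exact hxg p (by omega) (by omega) hp.2.2
  have hY' : ((range m).filter fun p => f (p + i) ∈ vs (fun p => f (p + i)) m ∧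
      G.Adj y (f (p + i))).image (fun p => if p = 0 then m - 1 else p - 1) ⊆
      (Ico g m).filter fun p => ¬ G.Adj x (f (p + i)) := by
    intro p hp
    obtain ⟨r, hr, rfl⟩ := mem_image.1 hp
    rw [mem_filter, mem_range] at hr
    rw [mem_filter, mem_Ico]
    split_ifs with hr0
    · subst hr0
      refine ⟨by omega, fun hadj => hcon _ (m - 1 + i + 1) (by omega) (by omega) hadj ?_⟩
      rw [show m - 1 + i + 1 = 0 + i + m by omega, hf.per]
      exact hr.2.2
    · have h5 : g < r := by
        by_contra hlt
        exact hcon i (r + i) (by omega) (by omega) hxi' hr.2.2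
      refine ⟨by omega, fun hadj => hcon _ (r + i) (by omega) (by omega) hadj hr.2.2⟩
  have c1 := card_le_card hX'
  have c2 := card_le_card hY'
  rw [card_image_of_injOn (by
    intro p hp r hr hpr
    simp only [coe_filter, mem_range, Set.mem_ofPred_eq] at hp hr
    simp only at hpr
    split_ifs at hpr <;> omega)] at c2
  have c3 := card_insert_le 0 ((Ico (g + 1) m).filter fun p => G.Adj x (f (p + i)))
  have c4 := card_filter_add_card_filter_not (s := Ico g m) fun p => G.Adj x (f (p + i))
  have c5 : #((Ico (g + 1) m).filter fun p => G.Adj x (f (p + i))) ≤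
      #((Ico g m).filter fun p => G.Adj x (f (p + i))) :=
    card_le_card (filter_subset_filter _ (Ico_subset_Ico_left (by omega)))
  rw [Nat.card_Ico] at c4
  omega

end Positions

section Sample

variable {V : Type*} [Fintype V] {R B : SimpleGraph V} {t e l : ℕ} {V₀ D : Finset V} {x : V}

/-- A random-like subset of the core with slightly fewer than `l` elements. -/
theorem Ctx.exists_sample (h : Ctx R B t e) (h1 : 1999 * t ≤ 1000 * #V₀ + 1000)
    (h2 : ∀ v ∈ V₀, 998 * t ≤ 1000 * dg R V₀ v) (hx : x ∈ V₀) (hDV : D ⊆ V₀)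
    (hl : t ≤ 25 * l) (hlt : l ≤ t) :
    ∃ S ⊆ V₀, ∃ W : Finset V, #W ≤ 1600000000 ∧ 10000 * #S + 9 * t ≤ 10000 * l ∧
      10000 * l ≤ 10000 * #S + 11 * t ∧ 5000 * l ≤ 10000 * dg R S x + 17 * t ∧
      ∀ v ∈ V₀, v ∉ W → 5000 * l ≤ 10000 * dg R S v + 17 * t ∧
        10000 * dg R S v + 9979 * t ≤ 10000 * dg R V₀ v + 5000 * l ∧
        (t / 25 ≤ dg R D v → 10000 * #(S ∩ D.filter (R.Adj v)) + 195 * t ≤ 10000 * dg R D v) := by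
  have ht := h.ht
  have hcard := h.card
  have hV₀ := card_le_univ V₀
  have : Nonempty V := ⟨x⟩
  have htq : (10 : ℚ) ^ 20 ≤ t := by exact_mod_cast ht
  have hlq : (t : ℚ) ≤ 25 * l := by exact_mod_cast hl
  have hltq : (l : ℚ) ≤ t := by exact_mod_cast hlt
  have hn1 : (1999 * t : ℚ) ≤ 1000 * #V₀ + 1000 := by exact_mod_cast h1
  have hn2 : (#V₀ : ℚ) ≤ 2 * t := by
    have : #V₀ ≤ 2 * t := by omega
    exact_mod_cast this
  have hn0 : (0 : ℚ) < #V₀ := by linarith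
  obtain ⟨q, hq⟩ : ∃ q : ℚ, q * #V₀ = l - t / 1000 :=
    ⟨(l - t / 1000) / #V₀, div_mul_cancel₀ _ hn0.ne'⟩
  have hq0 : 0 ≤ q := by
    by_contra hcon
    have := mul_neg_of_neg_of_pos (not_le.1 hcon) hn0
    linarith
  have hq1 : q ≤ 1 / 2 := by
    by_contra hcon
    have := mul_lt_mul_of_pos_right (not_le.1 hcon) hn0
    linarith
  have hqt : (l - t / 1000 : ℚ) ≤ 2 * (q * t) := by
    rw [← hq]
    nlinarith [mul_le_mul_of_nonneg_left hn2 hq0]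
  have hqt' : 1998 * (q * t) ≤ 1000 * (l - t / 1000 : ℚ) := by
    rw [← hq]
    nlinarith [mul_le_mul_of_nonneg_left (show (1998 * t : ℚ) ≤ 1000 * #V₀ by linarith) hq0]
  have hcq : (Fintype.card V : ℚ) ≤ 2 * t := by
    have : Fintype.card V ≤ 2 * t := by omega
    exact_mod_cast this
  obtain ⟨S, hS, W, hW, hM₁, hM₂, hN⟩ := exists_rounded (fun v => univ.filter (R.Adj v))
    (fun v => D.filter (R.Adj v)) univ (univ.filter (R.Adj x)) hq0 (by linarith)
    (r := (t : ℚ) / 20000) (by linarith) (by nlinarith) V₀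
  have e1 : ∀ X : Finset V, ∀ v, #(X ∩ univ.filter (R.Adj v)) = dg R X v := fun X v => by
    rw [inter_filter, inter_univ, dg]
  have e2 : ∀ v, #(V₀ ∩ D.filter (R.Adj v)) = dg R D v := fun v => by
    rw [inter_eq_right.2 ((filter_subset _ _).trans hDV), dg]
  simp only [e1, e2, inter_univ, abs_le] at hM₁ hM₂ hN
  have hdq : ∀ v ∈ V₀, (998 * t : ℚ) ≤ 1000 * dg R V₀ v := fun v hv => by exact_mod_cast h2 v hv
  have hlow : ∀ v ∈ V₀, q * (998 * t) ≤ q * (1000 * dg R V₀ v) := fun v hv =>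
    mul_le_mul_of_nonneg_left (hdq v hv) hq0
  refine ⟨S, hS, W, ?_, ?_, ?_, ?_, fun v hv hvW => ⟨?_, ?_, fun hD => ?_⟩⟩
  · have h3 : (Fintype.card V : ℚ) ^ 2 ≤ (2 * t) ^ 2 := pow_le_pow_left₀ (by positivity) hcq 2
    have h4 : (0 : ℚ) < t ^ 2 := by positivity
    have h5 : (#W : ℚ) * t ^ 2 ≤ 1600000000 * t ^ 2 := by nlinarith
    have := le_of_mul_le_mul_right h5 h4
    exact_mod_cast this
  · have : (10000 * #S + 9 * t : ℚ) ≤ 10000 * l := by linarith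
    exact_mod_cast this
  · have : (10000 * l : ℚ) ≤ 10000 * #S + 11 * t := by linarith
    exact_mod_cast this
  · have : (5000 * l : ℚ) ≤ 10000 * dg R S x + 17 * t := by linarith [hlow x hx]
    exact_mod_cast this
  · have : (5000 * l : ℚ) ≤ 10000 * dg R S v + 17 * t := by linarith [hlow v hv, (hN v hvW).1.1]
    exact_mod_cast this
  · have h3 : (1 - q) * (998 * t) ≤ (1 - q) * (1000 * dg R V₀ v) :=
      mul_le_mul_of_nonneg_left (hdq v hv) (by linarith)
    have : (10000 * dg R S v + 9979 * t : ℚ) ≤ 10000 * dg R V₀ v + 5000 * l := by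
      linarith [(hN v hvW).1.2]
    exact_mod_cast this
  · have h3 : (t : ℚ) ≤ 25 * dg R D v + 25 := by
      have : t ≤ 25 * dg R D v + 25 := by omega
      exact_mod_cast this
    have h4 : (dg R D v : ℚ) / 2 ≤ (1 - q) * dg R D v := by
      have : (0 : ℚ) ≤ dg R D v := by positivity
      nlinarith
    have : (10000 * #(S ∩ D.filter (R.Adj v)) + 195 * t : ℚ) ≤ 10000 * dg R D v := by
      linarith [(hN v hvW).2.2]
    exact_mod_cast this

end Sample

section Assembly

variable {V : Type*} {R B : SimpleGraph V} {t e l : ℕ} {V₀ D : Finset V} {x : V}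

/-- Replacing a short segment of a cycle by a path of adjustable length. -/
theorem CycFn.hasCyc_of_gadget {m K g d : ℕ} {f p : ℕ → V} {y : V} (hf : CycFn R m f)
    (hp : PathFn R (K + 1) p) (hxp : ∀ i < K + 1, R.Adj x (p i)) (hy : p K = y)
    (hxf : x ∉ vs f m) (hpf : ∀ i < K + 1, p i ∉ vs f m) (hg : 1 ≤ g) (hgm : g < m)
    (hdx : d ≤ dg R (vs f m) x) (hdy : d ≤ dg R (vs f m) y) (hd : m + 2 ≤ 2 * d + g)
    (hml : m + 2 ≤ l) (hlK : l + g ≤ m + K + 3) : HasCyc R l := by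
  obtain ⟨i, j, hij, hjg, hi, hj⟩ := hf.exists_close hg hgm (by omega) (by omega)
    (show m + 2 ≤ dg R (vs f m) x + dg R (vs f m) y + g by omega)
  obtain ⟨r, hr⟩ : ∃ r, r + m + 3 = l + (j - i) := ⟨l + (j - i) - m - 3, by omega⟩
  have hP := hp.isP_seg (K - r) r (by omega)
  rw [show K - r + r = K by omega, hy] at hP
  have hQ := hP.cons (hxp _ (by omega)) (by
    rw [mem_seg]
    rintro ⟨k, _, hk, hkx⟩
    exact (hxp k (by omega)).ne hkx.symm)
  refine ⟨_, hf.replace hij (by omega) hQ hi.symm hj ?_, ?_⟩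
  · intro z hz
    rw [List.mem_cons, mem_seg] at hz
    rcases hz with rfl | ⟨k, _, hk, rfl⟩
    · exact hxf
    · exact hpf k (by omega)
  · simp only [List.length_append, List.length_cons, length_seg]
    omega

variable [Fintype V]

/-- Connecting two large sets by a path with at most two inner vertices in `T`. -/
theorem Ctx.exists_conn (h : Ctx R B t e) {S T A C Z : Finset V} (hST : Disjoint S T) (hA : A ⊆ S)
    (hC : C ⊆ S) (hAC : Disjoint A C) (hA0 : A.Nonempty) (hC0 : C.Nonempty)
    (hA' : ∀ a ∈ A, 5001 * t ≤ 10000 * (#A + dg R (T \ Z) a))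
    (hC' : ∀ a ∈ C, 5001 * t ≤ 10000 * (#C + dg R (T \ Z) a)) :
    ∃ a ∈ A, ∃ b ∈ C, ∃ K, Conn R a b K ∧ K.length ≤ 2 ∧ ∀ x ∈ K, x ∈ T ∧ x ∉ Z := by
  obtain ⟨a, ha⟩ := hA0
  obtain ⟨b, hb⟩ := hC0
  set NA := (T \ Z).filter (R.Adj a) with hNA
  set NC := (T \ Z).filter (R.Adj b) with hNC
  have hTZ : ∀ {x v}, x ∈ (T \ Z).filter (R.Adj v) → R.Adj v x ∧ x ∈ T ∧ x ∉ Z := by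
    intro x v hx
    rw [mem_filter, mem_sdiff] at hx
    exact ⟨hx.2, hx.1⟩
  have hdis : ∀ {X : Finset V} {v}, X ⊆ S → Disjoint X ((T \ Z).filter (R.Adj v)) :=
    fun hX => disjoint_left.2 fun z hz hz' => disjoint_left.1 hST (hX hz) (hTZ hz').2.1
  by_cases hN : Disjoint NA NC
  · have hU : Disjoint (A ∪ NA) (C ∪ NC) := by
      rw [disjoint_union_left, disjoint_union_right, disjoint_union_right]
      exact ⟨⟨hAC, hdis hA⟩, (hdis hC).symm, hN⟩
    obtain ⟨u, hu, v, hv, huv⟩ := h.exists_adj hU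
      (by rw [card_union_of_disjoint (hdis hA)]; exact hA' a ha)
      (by rw [card_union_of_disjoint (hdis hC)]; exact hC' b hb)
    rcases mem_union.1 hu with hu | hu <;> rcases mem_union.1 hv with hv | hv
    · exact ⟨u, hu, v, hv, [], Or.inl ⟨rfl, huv⟩, by simp, by simp⟩
    · exact ⟨u, hu, b, hb, [v], Or.inr ⟨v, v, huv, IsP.single R v, (hTZ hv).1.symm⟩, by simp,
        by simpa using (hTZ hv).2⟩
    · exact ⟨a, ha, v, hv, [u], Or.inr ⟨u, u, (hTZ hu).1, IsP.single R u, huv⟩, by simp,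
        by simpa using (hTZ hu).2⟩
    · exact ⟨a, ha, b, hb, [u, v], Or.inr ⟨u, v, (hTZ hu).1,
        (IsP.single R v).cons huv (by simpa using huv.ne), (hTZ hv).1.symm⟩, by simp,
        by simpa using ⟨(hTZ hu).2, (hTZ hv).2⟩⟩
  · obtain ⟨z, hz, hz'⟩ := not_disjoint_iff.1 hN
    exact ⟨a, ha, b, hb, [z], Or.inr ⟨z, z, (hTZ hz).1, IsP.single R z, (hTZ hz').1.symm⟩,
      by simp, by simpa using (hTZ hz).2⟩

theorem Ctx.hasCyc_of_le (h : Ctx R B t e) (h1 : 1999 * t ≤ 1000 * #V₀ + 1000)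
    (h2 : ∀ v ∈ V₀, 998 * t ≤ 1000 * dg R V₀ v) (hx : x ∈ V₀) (hDV : D ⊆ V₀) (hD : D.Nonempty)
    (hxD : ∀ v ∈ D, R.Adj x v) (hDd : ∀ v ∈ D, t / 25 ≤ dg R D v) (hl : t ≤ 25 * l) (hlt : l ≤ t) :
    HasCyc R l := by
  have ht := h.ht
  obtain ⟨S, hS, W, hW, hSc, hSc', hSx, hSv⟩ := h.exists_sample h1 h2 hx hDV hl hlt
  -- the gadget
  set D₁ := (D \ S) \ W with hD₁
  have hD₁d : ∀ v ∈ D, v ∉ W → 19 * t / 1000 ≤ dg R D₁ v := by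
    intro v hv hvW
    have h3 := (hSv v (hDV hv) hvW).2.2 (hDd v hv)
    have h4 : D.filter (R.Adj v) ⊆ (S ∩ D.filter (R.Adj v)) ∪ (W ∪ D₁.filter (R.Adj v)) := by
      intro z hz
      simp only [hD₁, mem_filter, mem_union, mem_inter, mem_sdiff] at hz ⊢
      tauto
    have h5 := card_le_card h4
    have h6 := card_union_le (S ∩ D.filter (R.Adj v)) (W ∪ D₁.filter (R.Adj v))
    have h7 := card_union_le W (D₁.filter (R.Adj v))
    simp only [dg] at h3 ⊢
    omega
  have hD₁n : D₁.Nonempty := by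
    obtain ⟨v, hv⟩ := hD
    have h3 := (hDd v hv).trans (dg_le_card D v)
    obtain ⟨w, hw⟩ : (D \ W).Nonempty := by
      rw [← card_pos]
      have := le_card_sdiff W D
      omega
    rw [mem_sdiff] at hw
    have h4 := hD₁d w hw.1 hw.2
    have h5 := dg_le_card (G := R) D₁ w
    rw [← card_pos]
    omega
  have hD₁m : ∀ v ∈ D₁, v ∈ D ∧ v ∉ S ∧ v ∉ W := fun v hv => by
    rw [hD₁, mem_sdiff, mem_sdiff] at hv
    tauto
  set K := 19 * t / 1000 with hK
  obtain ⟨p, hp, hpD⟩ := exists_path_of_dg (G := R) hD₁n fun v hv =>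
    hD₁d v (hD₁m v hv).1 (hD₁m v hv).2.2
  -- the long cycle
  set S₁ := (S \ W).erase x with hS₁
  set F := insert x (vs p (K + 1)) with hF
  set T := V₀ \ (S₁ ∪ F) with hT
  have hFc : #F ≤ K + 2 := by
    have h3 := card_insert_le x (vs p (K + 1))
    rw [hp.card_vs] at h3
    exact h3
  have hS₁S : S₁ ⊆ S := (erase_subset _ _).trans sdiff_subset
  have hS₁m : ∀ v ∈ S₁, v ∈ S ∧ v ∉ W := fun v hv => mem_sdiff.1 (mem_of_mem_erase hv)
  have hsub : ∀ P : V → Prop, #(S.filter P) ≤ #(S₁.filter P) + #W + 1 := by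
    intro P
    have h3 : S.filter P ⊆ insert x (S₁.filter P ∪ W) := by
      intro z hz
      simp only [hS₁, mem_filter, mem_insert, mem_union, mem_erase, mem_sdiff] at hz ⊢
      tauto
    have h4 := card_le_card h3
    have h5 := card_insert_le x (S₁.filter P ∪ W)
    have h6 := card_union_le (S₁.filter P) W
    omega
  have hS₁d : ∀ v, dg R S v ≤ dg R S₁ v + #W + 1 := fun v => hsub _
  have hS₁c : #S ≤ #S₁ + #W + 1 := by simpa using hsub fun _ => True
  have hS₁c' := card_le_card hS₁S
  set d := (5000 * l - 18 * t) / 10000 with hd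
  have hTn : ∀ A Z : Finset V, A ⊆ S₁ → d ≤ #A → #Z ≤ 2 → ∀ a ∈ A,
      5001 * t ≤ 10000 * (#A + dg R (T \ Z) a) := by
    intro A Z hA hdA hZ a ha
    have h3 := (hSv a (hS (hS₁S (hA ha))) (hS₁m a (hA ha)).2).2.1
    have h4 : V₀.filter (R.Adj a) ⊆
        S.filter (R.Adj a) ∪ (F ∪ (Z ∪ (T \ Z).filter (R.Adj a))) := by
      intro z hz
      have := @hS₁S z
      simp only [hT, mem_filter, mem_union, mem_sdiff] at hz ⊢
      tauto
    have h5 := card_le_card h4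
    have h6 := card_union_le (S.filter (R.Adj a)) (F ∪ (Z ∪ (T \ Z).filter (R.Adj a)))
    have h7 := card_union_le F (Z ∪ (T \ Z).filter (R.Adj a))
    have h8 := card_union_le Z ((T \ Z).filter (R.Adj a))
    simp only [dg] at h3 ⊢
    omega
  have hST : Disjoint S₁ T := disjoint_left.2 fun z hz hz' =>
    (mem_sdiff.1 hz').2 (mem_union_left _ hz)
  obtain ⟨L, hL, hLST, hL4, hLlen⟩ := exists_long_cycle (G := R) (S := S₁) (T := T) (d := d)
    (by omega) (card_pos.1 (by omega)) (by
      intro v hv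
      have h3 := (hSv v (hS (hS₁S hv)) (hS₁m v hv).2).1
      have h4 := hS₁d v
      omega) hST (by
      intro A C Z hA hC hAC hdA hdC hZ
      exact h.exists_conn hST hA hC hAC (card_pos.1 (by omega)) (card_pos.1 (by omega))
        (hTn A Z hA hdA hZ) (hTn C Z hC hdC hZ))
  obtain ⟨f, hf, hfL⟩ := exists_cycFn hL
  set m := L.length with hm
  have hvs : L.toFinset = vs f m := by
    ext z
    rw [List.mem_toFinset, hfL, MonoCycle.mem_vs]
  rw [hvs] at hL4
  have hfF : ∀ z ∈ vs f m, z ∉ S → z ∉ F := by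
    intro z hz hzS hzF
    rw [← hvs, List.mem_toFinset] at hz
    rcases hLST z hz with h3 | h3
    · exact hzS (hS₁S h3)
    · exact (mem_sdiff.1 h3).2 (mem_union_right _ hzF)
  have hxf : x ∉ vs f m := by
    intro hz
    rw [← hvs, List.mem_toFinset] at hz
    rcases hLST x hz with h3 | h3
    · exact notMem_erase x _ h3
    · exact (mem_sdiff.1 h3).2 (mem_union_right _ (mem_insert_self _ _))
  have c1 := card_sdiff_add_card_inter (vs f m) S₁
  have c2 := card_sdiff_add_card_inter S₁ (vs f m)
  rw [inter_comm, hf.card_vs] at c1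
  have hdeg : ∀ v, 5000 * l ≤ 10000 * dg R S v + 17 * t → d ≤ dg R (vs f m) v + #(S₁ \ vs f m) := by
    intro v hv
    have h3 : dg R S₁ v ≤ dg R (vs f m ∪ (S₁ \ vs f m)) v := dg_mono (by
      rw [union_sdiff_self_eq_union]; exact subset_union_right) v
    rw [dg_union disjoint_sdiff] at h3
    have h4 := dg_le_card (G := R) (S₁ \ vs f m) v
    have h5 := hS₁d v
    omega
  have hyp := hD₁m _ (hpD K (by omega))
  have hdx := hdeg x hSx
  have hdy := hdeg (p K) (hSv _ (hDV hyp.1) hyp.2.2).1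
  exact hf.hasCyc_of_gadget (g := t / 100 + 1) (d := d - #(S₁ \ vs f m)) hp
    (fun i hi => hxD _ (hD₁m _ (hpD i hi)).1) rfl hxf
    (fun i hi hz => hfF _ hz (hD₁m _ (hpD i hi)).2.1
      (mem_insert_of_mem (_root_.MonoCycle.mem_vs.2 ⟨i, hi, rfl⟩)))
    (by omega) (by omega) (by omega) (by omega) (by omega) (by omega) (by omega)

/-- One of two almost complementary graphs on `2 * t - 1` vertices has all cycles up to length `t`. -/
theorem win_of_near (hcard : Fintype.card V + 1 = 2 * t) (hn : Near R B e) (he : 1000000 * e ≤ t)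
    (ht : 10 ^ 20 ≤ t) : Win R t ∨ Win B t := by
  by_contra! hcon
  wlog hRB : es B univ ≤ es R univ generalizing R B
  · exact this hn.symm hcon.symm (by omega)
  have h : Ctx R B t e := ⟨hcard, hn, he, ht, hcon.1, hcon.2⟩
  obtain ⟨V₀, h1, h2⟩ := h.exists_core hRB
  obtain ⟨x, hx⟩ : V₀.Nonempty := card_pos.1 (by omega)
  obtain ⟨D, hDV, hD, hxD, hDd⟩ := h.exists_fan h1 h2 hx
  refine h.nR fun l hl hlt => ?_
  by_cases hsmall : l ≤ t / 25 + 2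
  · exact fan_hasCyc hD hDd hxD hl hsmall
  · exact h.hasCyc_of_le h1 h2 hx hDV hD hxD hDd (by omega) hlt

end Assembly

section Coloring

variable {V : Type*} {G : SimpleGraph V} {l t : ℕ}

theorem HasCyc.exists_isCycle (h : HasCyc G l) :
    ∃ (v : V) (w : G.Walk v v), w.IsCycle ∧ w.length = l := by
  obtain ⟨L, ⟨a, b, ⟨h1, h2, h3, h4⟩, hba, hl⟩, rfl⟩ := h
  have hne : L ≠ [] := by rintro rfl; simp at hl
  obtain rfl : L.head hne = a := by rwa [List.head?_eq_some_head hne, Option.some_inj] at h3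
  obtain rfl : L.getLast hne = b := by rwa [List.getLast?_eq_some_getLast hne, Option.some_inj] at h4
  refine ⟨_, SimpleGraph.Walk.cons hba (.ofSupport L hne h2), ?_, by simp; omega⟩
  rw [SimpleGraph.Walk.isCycle_iff_isPath_tail_and_le_length]
  refine ⟨?_, by simp; omega⟩
  simpa [SimpleGraph.Walk.isPath_def] using h1

/-- The graph of the edges of color `i`. -/
def colorGraph (H : SimpleGraph V) {k : ℕ} (c : H.edgeSet → Fin k) (i : Fin k) :
    SimpleGraph V where
  Adj u v := ∃ h : H.Adj u v, c ⟨s(u, v), h⟩ = i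
  symm := ⟨fun u v ⟨h, hc⟩ => ⟨h.symm, by
    rw [← hc]; congr 2; exact Sym2.eq_swap⟩⟩
  loopless := ⟨fun u ⟨h, _⟩ => H.loopless.irrefl u h⟩

theorem hasMonoCycle_of_hasCyc {H : SimpleGraph V} {k : ℕ} {c : H.edgeSet → Fin k} {i : Fin k}
    (h : HasCyc (colorGraph H c i) l) : HasMonoCycle H c i l := by
  obtain ⟨v, w, hw, rfl⟩ := h.exists_isCycle
  have hle : colorGraph H c i ≤ H := fun u v ⟨h, _⟩ => h
  refine ⟨v, w.mapLe hle, hw.mapLe hle, by simp, fun e he => ?_⟩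
  have he' : e ∈ (colorGraph H c i).edgeSet := by
    simp only [SimpleGraph.Walk.edges_mapLe_eq_edges] at he
    exact w.edges_subset_edgeSet he
  induction e with
  | h u v =>
    obtain ⟨_, hc⟩ := he'
    exact hc

theorem near_colorGraph [Fintype V] {H : SimpleGraph V} (c : H.edgeSet → Fin 2)
    (hcard : Fintype.card V + 1 = 2 * t)
    (hH : ∀ v, (2 - 10 ^ (-6 : ℤ) : ℝ) * t ≤ (Nat.card (H.neighborSet v) : ℝ)) :
    Near (colorGraph H c 0) (colorGraph H c 1) (t / 1000000) := by
  intro v S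
  have h1 : Nat.card (H.neighborSet v) = dg H univ v := by
    rw [dg, Nat.card_eq_fintype_card, ← Set.toFinset_card]
    congr 1
    ext w
    simp
  have h2 := hH v
  rw [h1] at h2
  have h3 : 2000000 * t ≤ 1000000 * dg H univ v + t := by
    have : (2000000 * t : ℝ) ≤ 1000000 * dg H univ v + t := by
      norm_num at h2 ⊢
      linarith
    exact_mod_cast this
  have h4 := dg_add_not (G := H) S v
  have h5 := dg_add_not (G := H) univ v
  have h6 : #(S.filter fun w => ¬ H.Adj v w) ≤ #(univ.filter fun w => ¬ H.Adj v w) :=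
    card_le_card (filter_subset_filter _ (subset_univ S))
  have h7 : dg H S v ≤ dg (colorGraph H c 0) S v + dg (colorGraph H c 1) S v := by
    refine le_trans (card_le_card ?_) (card_union_le _ _)
    intro w hw
    rw [mem_filter] at hw
    rw [mem_union, mem_filter, mem_filter]
    have : c ⟨s(v, w), hw.2⟩ = 0 ∨ c ⟨s(v, w), hw.2⟩ = 1 := by omega
    exact this.imp (fun h => ⟨hw.1, hw.2, h⟩) fun h => ⟨hw.1, hw.2, h⟩
  rw [card_univ] at h5
  omega

end Coloring

end MonoCycle

theorem stmt12 : ∃ t₀ : ℕ, ∀ t : ℕ, t₀ ≤ t → ∀ {V : Type*} [Fintype V] (H : SimpleGraph V),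
    Fintype.card V = 2 * t - 1 →
    (∀ v : V, (2 - 10 ^ (-6 : ℤ) : ℝ) * t ≤ (Nat.card (H.neighborSet v) : ℝ)) →
    ∀ c : H.edgeSet → Fin 2, ∃ i : Fin 2, ∀ s : ℕ, 3 ≤ s → s ≤ t →
      HasMonoCycle H c i s := by
  refine ⟨10 ^ 20, fun t ht V _ H hcard hH c => ?_⟩
  have hcard' : Fintype.card V + 1 = 2 * t := by omega
  rcases MonoCycle.win_of_near hcard' (MonoCycle.near_colorGraph c hcard' hH) (by omega) ht with
    h | h
  · exact ⟨0, fun s hs hst => MonoCycle.hasMonoCycle_of_hasCyc (h s hs hst)⟩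
  · exact ⟨1, fun s hs hst => MonoCycle.hasMonoCycle_of_hasCyc (h s hs hst)⟩
end

section
/- Let ε be a real with 0 < ε < 1/4 and let t₁ ≥ t₂ ≥ 1 be integers. Let H be a graph on T vertices with T ≥ t₁ + ⌊(t₂+1)/2⌋ + 150·√ε·t₁ and with at least (1−ε)·C(T,2) edges. Then for every function c from the edge set of H to {1,2}, either H contains a path on t₁ vertices all of whose edges receive color 1, or H contains a path on t₂ vertices all of whose edges receive color 2. -/
/-- `l` lists, without repetition, the vertices of a path of the relation `r` inside `S`. -/
structure IsPathIn {V : Type*} (r : V → V → Prop) (S : Finset V) (l : List V) : Prop where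
  nodup : l.Nodup
  chain : l.IsChain r
  mem : ∀ x ∈ l, x ∈ S

/-- A nonempty `r`-chain whose two ends lie in `Y`. -/
structure IsSegment {V : Type*} (r : V → V → Prop) (Y : Finset V) (l : List V) : Prop where
  chain : l.IsChain r
  head : ∃ a ∈ Y, l.head? = some a
  last : ∃ b ∈ Y, l.getLast? = some b

theorem List.IsChain.reverse_of_symm {V : Type*} {r : V → V → Prop} (hr : ∀ ⦃a b⦄, r a b → r b a)
    {l : List V} (h : l.IsChain r) : l.reverse.IsChain r :=
  List.isChain_reverse.2 (h.imp hr)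

theorem IsSegment.link {V : Type*} {r : V → V → Prop} (hr : ∀ ⦃a b⦄, r a b → r b a) {Y : Finset V}
    {l₁ l₂ : List V} (h₁ : IsSegment r Y l₁) (h₂ : IsSegment r Y l₂) {x : V}
    (hx₁ : ∀ a ∈ l₁.head?, r a x) (hx₂ : ∀ a ∈ l₂.head?, r a x) :
    IsSegment r Y (l₁.reverse ++ x :: l₂) := by
  obtain ⟨c₁, ⟨a₁, ha₁, e₁⟩, ⟨b₁, hb₁, f₁⟩⟩ := h₁
  obtain ⟨c₂, ⟨a₂, ha₂, e₂⟩, ⟨b₂, hb₂, f₂⟩⟩ := h₂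
  refine ⟨?_, ⟨b₁, hb₁, ?_⟩, ⟨b₂, hb₂, ?_⟩⟩
  · rw [List.isChain_append, List.isChain_cons]
    refine ⟨c₁.reverse_of_symm hr, ⟨fun y hy => hr (hx₂ y hy), c₂⟩, ?_⟩
    intro a ha b hb
    simp only [List.getLast?_reverse] at ha
    simp only [List.head?_cons, Option.mem_def, Option.some.injEq] at hb
    exact hb ▸ hx₁ a ha
  · simp [List.head?_append, f₁]
  · simp [List.getLast?_append, List.getLast?_cons, f₂]

theorem exists_two_segments {V ι : Type*} [DecidableEq V] [DecidableEq ι] {r : V → V → Prop}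
    (hr : ∀ ⦃a b⦄, r a b → r b a) (Y U : Finset V) (e : ι → Finset V) (bad : V → Finset ι) (d : ℕ)
    (hbad : ∀ y ∈ Y, (bad y).card ≤ d) (n : ℕ) :
    ∀ (L : List (List V)) (J : Finset ι), L.length = n + 2 → (∀ l ∈ L, IsSegment r Y l) →
      L.flatten.Nodup → (∀ j ∈ J, ∀ x ∈ e j, x ∉ L.flatten) →
      (∀ i ∈ J, ∀ j ∈ J, ∀ x ∈ e i, x ∈ e j → i = j) →
      (∀ j ∈ J, ∀ a ∈ Y, ∀ b ∈ Y, ∀ c ∈ Y, j ∉ bad a → j ∉ bad b → j ∉ bad c →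
        ∃ x ∈ e j, (r a x ∧ r b x) ∨ (r a x ∧ r c x) ∨ (r b x ∧ r c x)) →
      n + 3 * d ≤ J.card → (∀ j ∈ J, e j ⊆ U) → (∀ x ∈ L.flatten, x ∈ U) →
      ∃ l₁ l₂, IsSegment r Y l₁ ∧ IsSegment r Y l₂ ∧ (l₁ ++ l₂).Nodup ∧
        (∀ x ∈ l₁ ++ l₂, x ∈ U) ∧ (l₁ ++ l₂).length = L.flatten.length + n := by
  induction n with
  | zero =>
    intro L J hL hseg hnd _ _ _ _ _ hU
    match L, hL with
    | [l₁, l₂], _ =>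
      simp only [List.flatten_cons, List.flatten_nil, List.append_nil] at hnd hU ⊢
      exact ⟨l₁, l₂, hseg _ (by simp), hseg _ (by simp), hnd, hU, by simp⟩
  | succ n ih =>
    intro L J hL hseg hnd hdisj hpw hgood hcard hJU hU
    match L, hL with
    | l₁ :: l₂ :: l₃ :: L, hL =>
      have s₁ := hseg l₁ (by simp)
      have s₂ := hseg l₂ (by simp)
      have s₃ := hseg l₃ (by simp)
      obtain ⟨a, haY, ha⟩ := s₁.head
      obtain ⟨b, hbY, hb⟩ := s₂.head
      obtain ⟨c, hcY, hc⟩ := s₃.head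
      have hlt : (bad a ∪ bad b ∪ bad c).card < J.card := by
        have h1 := Finset.card_union_le (bad a ∪ bad b) (bad c)
        have h2 := Finset.card_union_le (bad a) (bad b)
        have := hbad a haY
        have := hbad b hbY
        have := hbad c hcY
        omega
      obtain ⟨j, hjJ, hj⟩ := Finset.exists_mem_notMem_of_card_lt_card hlt
      simp only [Finset.mem_union, not_or] at hj
      obtain ⟨x, hxj, hx⟩ := hgood j hjJ a haY b hbY c hcY hj.1.1 hj.1.2 hj.2
      have key : ∀ L' : List (List V), L'.length = n + 2 → (∀ l ∈ L', IsSegment r Y l) →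
          L'.flatten.Perm (x :: (l₁ :: l₂ :: l₃ :: L).flatten) →
          ∃ l₁' l₂', IsSegment r Y l₁' ∧ IsSegment r Y l₂' ∧ (l₁' ++ l₂').Nodup ∧
            (∀ x ∈ l₁' ++ l₂', x ∈ U) ∧
            (l₁' ++ l₂').length = (l₁ :: l₂ :: l₃ :: L).flatten.length + (n + 1) := by
        intro L' hL' hs hp
        obtain ⟨m₁, m₂, h1, h2, h3, h4, h5⟩ := ih L' (J.erase j) hL' hs
          (hp.nodup_iff.2 (List.nodup_cons.2 ⟨hdisj j hjJ x hxj, hnd⟩))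
          (by
            intro i hi y hy hyL
            rw [hp.mem_iff, List.mem_cons] at hyL
            rcases hyL with rfl | hyL
            · exact Finset.ne_of_mem_erase hi
                (hpw i (Finset.mem_of_mem_erase hi) j hjJ y hy hxj)
            · exact hdisj i (Finset.mem_of_mem_erase hi) y hy hyL)
          (fun i hi k hk => hpw i (Finset.mem_of_mem_erase hi) k (Finset.mem_of_mem_erase hk))
          (fun i hi => hgood i (Finset.mem_of_mem_erase hi))
          (by rw [Finset.card_erase_of_mem hjJ]; omega)
          (fun i hi => hJU i (Finset.mem_of_mem_erase hi))
          (by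
            intro y hy
            rw [hp.mem_iff, List.mem_cons] at hy
            rcases hy with rfl | hy
            · exact hJU j hjJ hxj
            · exact hU y hy)
        refine ⟨m₁, m₂, h1, h2, h3, h4, ?_⟩
        rw [h5, hp.length_eq, List.length_cons]
        omega
      have hsL : ∀ l ∈ L, IsSegment r Y l := fun l hl => hseg l (by simp [hl])
      simp only [List.length_cons] at hL
      rcases hx with ⟨h1, h2⟩ | ⟨h1, h2⟩ | ⟨h1, h2⟩
      · refine key ((l₁.reverse ++ x :: l₂) :: l₃ :: L) (by simp; omega) ?_ ?_
        · have := s₁.link hr s₂ (x := x) (by simpa [ha] using h1) (by simpa [hb] using h2)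
          simp only [List.mem_cons]
          rintro l (rfl | rfl | hl)
          exacts [this, s₃, hsL l hl]
        · rw [List.perm_iff_count]
          intro z
          simp [List.count_cons]
          omega
      · refine key ((l₁.reverse ++ x :: l₃) :: l₂ :: L) (by simp; omega) ?_ ?_
        · have := s₁.link hr s₃ (x := x) (by simpa [ha] using h1) (by simpa [hc] using h2)
          simp only [List.mem_cons]
          rintro l (rfl | rfl | hl)
          exacts [this, s₂, hsL l hl]
        · rw [List.perm_iff_count]
          intro z
          simp [List.count_cons]
          omega
      · refine key ((l₂.reverse ++ x :: l₃) :: l₁ :: L) (by simp; omega) ?_ ?_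
        · have := s₂.link hr s₃ (x := x) (by simpa [hb] using h1) (by simpa [hc] using h2)
          simp only [List.mem_cons]
          rintro l (rfl | rfl | hl)
          exacts [this, s₁, hsL l hl]
        · rw [List.perm_iff_count]
          intro z
          simp [List.count_cons]
          omega

theorem exists_path_of_segments {V ι : Type*} [DecidableEq V] [DecidableEq ι] {r : V → V → Prop}
    (hr : ∀ ⦃a b⦄, r a b → r b a) (Y U S : Finset V) (e : ι → Finset V) (bad : V → Finset ι) (d n : ℕ)
    (hbad : ∀ y ∈ Y, (bad y).card ≤ d) (L : List (List V)) (J : Finset ι)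
    (hL : L.length = n + 2) (hseg : ∀ l ∈ L, IsSegment r Y l) (hnd : L.flatten.Nodup)
    (hdisj : ∀ j ∈ J, ∀ x ∈ e j, x ∉ L.flatten)
    (hpw : ∀ i ∈ J, ∀ j ∈ J, ∀ x ∈ e i, x ∈ e j → i = j)
    (hgood : ∀ j ∈ J, ∀ a ∈ Y, ∀ b ∈ Y, ∀ c ∈ Y, j ∉ bad a → j ∉ bad b → j ∉ bad c →
        ∃ x ∈ e j, (r a x ∧ r b x) ∨ (r a x ∧ r c x) ∨ (r b x ∧ r c x))
    (hcard : n + 3 * d ≤ J.card) (hJU : ∀ j ∈ J, e j ⊆ U) (hLU : ∀ x ∈ L.flatten, x ∈ U)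
    (hUS : U ⊆ S) (x₀ : V) (hx₀ : x₀ ∈ S) (hx₀U : x₀ ∉ U) (hY : ∀ y ∈ Y, r y x₀) :
    ∃ l, IsPathIn r S l ∧ l.length = L.flatten.length + n + 1 := by
  obtain ⟨l₁, l₂, s₁, s₂, hn, hU, hlen⟩ := exists_two_segments hr Y U e bad d hbad n L J hL hseg
    hnd hdisj hpw hgood hcard hJU hLU
  obtain ⟨a, haY, ha⟩ := s₁.head
  obtain ⟨b, hbY, hb⟩ := s₂.head
  have s := s₁.link hr s₂ (x := x₀) (by simpa [ha] using hY a haY) (by simpa [hb] using hY b hbY)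
  have hp : (l₁.reverse ++ x₀ :: l₂).Perm (x₀ :: (l₁ ++ l₂)) := by
    rw [List.perm_iff_count]
    intro z
    simp [List.count_cons]
    omega
  refine ⟨_, ⟨hp.nodup_iff.2 (List.nodup_cons.2 ⟨fun h => hx₀U (hU _ h), hn⟩), s.chain, ?_⟩, ?_⟩
  · intro x hx
    rw [hp.mem_iff, List.mem_cons] at hx
    rcases hx with rfl | hx
    exacts [hx₀, hUS (hU x hx)]
  · rw [hp.length_eq, List.length_cons, hlen]

theorem exists_path_to_of_extension {V : Type*} [DecidableEq V] {r : V → V → Prop} {S : Finset V}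
    {y : V} (hy : y ∈ S) (n : ℕ)
    (hext : ∀ T ⊆ S, T.card ≤ n → ∀ v ∈ T, ∃ w ∈ S, w ∉ T ∧ r w v) :
    ∃ l, IsPathIn r S l ∧ l.length = n + 1 ∧ l.getLast? = some y := by
  induction n with
  | zero => exact ⟨[y], ⟨by simp, by simp, by simpa using hy⟩, by simp, by simp⟩
  | succ n ih =>
    obtain ⟨l, hl, hlen, hlast⟩ := ih fun T hT hc => hext T hT (by omega)
    match l, hlen with
    | v :: l, hlen =>
      obtain ⟨w, hwS, hw, hr⟩ := hext (v :: l).toFinset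
        (fun x hx => hl.mem x (List.mem_toFinset.1 hx))
        (by rw [List.toFinset_card_of_nodup hl.nodup, hlen]) v (by simp)
      rw [List.mem_toFinset] at hw
      refine ⟨w :: v :: l, ⟨List.nodup_cons.2 ⟨hw, hl.nodup⟩,
        List.isChain_cons_cons.2 ⟨hr, hl.chain⟩, ?_⟩, by simp [← hlen], ?_⟩
      · simpa [hwS] using hl.mem
      · rw [List.getLast?_cons_cons, hlast]

theorem exists_path_to_of_dense {V : Type*} [DecidableEq V] {r : V → V → Prop} [DecidableRel r]
    {S : Finset V} {d : ℕ} {y : V} (hy : y ∈ S)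
    (hdeg : ∀ v ∈ S, (S.filter fun w => w ≠ v ∧ ¬ r w v).card ≤ d) (n : ℕ)
    (hn : n + d < S.card) :
    ∃ l, IsPathIn r S l ∧ l.length = n + 1 ∧ l.getLast? = some y := by
  refine exists_path_to_of_extension hy n fun T hT hc v hv => ?_
  have hlt : (T ∪ S.filter fun w => w ≠ v ∧ ¬ r w v).card < S.card := by
    have h1 := Finset.card_union_le T (S.filter fun w => w ≠ v ∧ ¬ r w v)
    have h2 := hdeg v (hT hv)
    omega
  obtain ⟨w, hw, hw'⟩ := Finset.exists_mem_notMem_of_card_lt_card hlt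
  simp only [Finset.mem_union, Finset.mem_filter, not_or, not_and, not_not] at hw'
  exact ⟨w, hw, hw'.1, hw'.2 hw fun h => hw'.1 (h ▸ hv)⟩

theorem exists_card_neighbors_lt {V : Type*} [DecidableEq V] {r : V → V → Prop} [DecidableRel r]
    (hr : ∀ ⦃a b⦄, r a b → r b a) {S : Finset V} (hS : S.Nonempty) {n : ℕ}
    (h : ∀ l, IsPathIn r S l → l.length ≤ n) :
    ∃ v ∈ S, (S.filter fun w => r v w).card ≤ n := by
  by_contra! hcon
  obtain ⟨y, hy⟩ := hS
  obtain ⟨l, hl, hlen, -⟩ := exists_path_to_of_extension (r := r) hy n fun T hT hc v hv => by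
    obtain ⟨w, hw, hw'⟩ := Finset.exists_mem_notMem_of_card_lt_card (hc.trans_lt (hcon v (hT hv)))
    rw [Finset.mem_filter] at hw
    exact ⟨w, hw.1, hw', hr hw.2⟩
  have := h l hl
  omega

/-- A weak form of the Erdős–Gallai theorem on graphs without long paths. -/
theorem sum_card_neighbors_le {V : Type*} [DecidableEq V] {r : V → V → Prop} [DecidableRel r]
    (hr : ∀ ⦃a b⦄, r a b → r b a) {n : ℕ} (S : Finset V)
    (h : ∀ l, IsPathIn r S l → l.length ≤ n) :
    ∑ v ∈ S, (S.filter fun w => r v w).card ≤ 2 * n * S.card := by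
  induction hk : S.card generalizing S with
  | zero => simp [Finset.card_eq_zero.1 hk]
  | succ k ih =>
    obtain ⟨v, hv, hdeg⟩ := exists_card_neighbors_lt hr
      (Finset.card_pos.1 (by omega : 0 < S.card)) h
    have ih' := ih (S.erase v)
      (fun l hl => h l ⟨hl.nodup, hl.chain, fun x hx => Finset.mem_of_mem_erase (hl.mem x hx)⟩)
      (by rw [Finset.card_erase_of_mem hv]; omega)
    have hstep : ∀ u ∈ S.erase v, (S.filter fun w => r u w).card ≤
        ((S.erase v).filter fun w => r u w).card + if r v u then 1 else 0 := by
      intro u _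
      split_ifs with hvu
      · rw [Finset.filter_erase]
        exact Nat.sub_le_iff_le_add.1 Finset.pred_card_le_card_erase
      · rw [Finset.filter_erase, Finset.erase_eq_of_notMem]
        · simp
        · simp only [Finset.mem_filter, not_and]
          exact fun _ huv => hvu (hr huv)
    have hsum := Finset.sum_le_sum hstep
    rw [Finset.sum_add_distrib, ← Finset.card_filter] at hsum
    have hle : ((S.erase v).filter fun w => r v w).card ≤ n :=
      (Finset.card_le_card (Finset.filter_subset_filter _ (Finset.erase_subset v S))).trans hdeg
    rw [← Finset.add_sum_erase S _ hv]
    calc _ ≤ n + (2 * n * k + n) := by omega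
      _ = 2 * n * (k + 1) := by ring

theorem exists_matching_or_independent {V : Type*} [DecidableEq V] (r : V → V → Prop)
    (Y : Finset V) (s : ℕ) :
    (∃ M : List (List V), M.length = s ∧ M.flatten.length = 2 * s ∧
      (∀ l ∈ M, ∃ a b, l = [a, b] ∧ r a b) ∧ M.flatten.Nodup ∧ ∀ x ∈ M.flatten, x ∈ Y) ∨
    ∃ Y₀ ⊆ Y, Y.card ≤ Y₀.card + 2 * s ∧ ∀ a ∈ Y₀, ∀ b ∈ Y₀, a ≠ b → ¬ r a b := by
  induction s with
  | zero => exact Or.inl ⟨[], by simp⟩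
  | succ s ih =>
    rcases ih with ⟨M, hM, hlen, hpair, hnd, hY⟩ | ⟨Y₀, h1, h2, h3⟩
    · by_cases h : ∃ a ∈ Y \ M.flatten.toFinset, ∃ b ∈ Y \ M.flatten.toFinset, a ≠ b ∧ r a b
      · obtain ⟨a, ha, b, hb, hab, hr⟩ := h
        rw [Finset.mem_sdiff, List.mem_toFinset] at ha hb
        refine Or.inl ⟨[a, b] :: M, by simp [hM], ?_, ?_, ?_, ?_⟩
        · rw [List.flatten_cons, List.length_append, hlen]
          simp only [List.length_cons, List.length_nil]
          ring
        · simp only [List.mem_cons]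
          rintro l (rfl | hl)
          exacts [⟨a, b, rfl, hr⟩, hpair l hl]
        · rw [List.flatten_cons, List.cons_append, List.cons_append, List.nil_append,
            List.nodup_cons, List.nodup_cons, List.mem_cons, not_or]
          exact ⟨⟨hab, ha.2⟩, hb.2, hnd⟩
        · rw [List.flatten_cons, List.cons_append, List.cons_append, List.nil_append]
          simp only [List.mem_cons]
          rintro x (rfl | rfl | hx)
          exacts [ha.1, hb.1, hY x hx]
      · refine Or.inr ⟨Y \ M.flatten.toFinset, Finset.sdiff_subset, ?_, ?_⟩
        · have := Finset.le_card_sdiff M.flatten.toFinset Y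
          rw [List.toFinset_card_of_nodup hnd] at this
          omega
        · intro a ha b hb hab hr
          exact h ⟨a, ha, b, hb, hab, hr⟩
    · exact Or.inr ⟨Y₀, h1, by omega, h3⟩

theorem exists_segments_of_matching {V : Type*} [DecidableEq V] {r : V → V → Prop} {Y : Finset V}
    {M : List (List V)} {s : ℕ} (hM : M.length = s) (hlen : M.flatten.length = 2 * s)
    (hpair : ∀ l ∈ M, ∃ a b, l = [a, b] ∧ r a b) (hnd : M.flatten.Nodup)
    (hY : ∀ x ∈ M.flatten, x ∈ Y) {m : ℕ} (hm : 2 * s + m ≤ Y.card) :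
    ∃ L : List (List V), L.length = s + m ∧ L.flatten.length = 2 * s + m ∧
      (∀ l ∈ L, IsSegment r Y l) ∧ L.flatten.Nodup ∧ ∀ x ∈ L.flatten, x ∈ Y := by
  have hc : m ≤ (Y \ M.flatten.toFinset).card := by
    have := Finset.le_card_sdiff M.flatten.toFinset Y
    rw [List.toFinset_card_of_nodup hnd] at this
    omega
  obtain ⟨Z, hZ, hZc⟩ := Finset.exists_subset_card_eq hc
  have hf : (M ++ Z.toList.map fun y => [y]).flatten = M.flatten ++ Z.toList := by
    rw [List.flatten_append]
    congr 1
    induction Z.toList with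
    | nil => rfl
    | cons a l ih => simp [ih]
  refine ⟨M ++ Z.toList.map fun y => [y], by simp [hM, hZc], ?_, ?_, ?_, ?_⟩
  · rw [hf, List.length_append, hlen, Finset.length_toList, hZc]
  · intro l hl
    rw [List.mem_append, List.mem_map] at hl
    rcases hl with hl | ⟨y, hy, rfl⟩
    · obtain ⟨a, b, rfl, hr⟩ := hpair l hl
      have hsub : ∀ x ∈ [a, b], x ∈ Y := fun x hx => hY x (List.mem_flatten.2 ⟨_, hl, hx⟩)
      exact ⟨by simpa using hr, ⟨a, hsub a (by simp), by simp⟩, ⟨b, hsub b (by simp), by simp⟩⟩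
    · have hyY : y ∈ Y := (Finset.mem_sdiff.1 (hZ (Finset.mem_toList.1 hy))).1
      exact ⟨by simp, ⟨y, hyY, by simp⟩, ⟨y, hyY, by simp⟩⟩
  · rw [hf, List.nodup_append]
    refine ⟨hnd, Z.nodup_toList, ?_⟩
    rintro a ha b hb rfl
    exact (Finset.mem_sdiff.1 (hZ (Finset.mem_toList.1 hb))).2 (List.mem_toFinset.2 ha)
  · rw [hf]
    intro x hx
    rw [List.mem_append] at hx
    rcases hx with hx | hx
    exacts [hY x hx, (Finset.mem_sdiff.1 (hZ (Finset.mem_toList.1 hx))).1]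

theorem card_bad_connectors_le {V ι : Type*} [DecidableEq V] {R B : V → V → Prop}
    [DecidableRel R] [DecidableRel B] {S : Finset V} {d : ℕ} {e : ι → Finset V} {J : Finset ι}
    (hpw : ∀ i ∈ J, ∀ j ∈ J, ∀ x ∈ e i, x ∈ e j → i = j) {y : V}
    (hdeg : (S.filter fun w => w ≠ y ∧ ¬ R y w ∧ ¬ B y w).card ≤ d)
    (he : ∀ j ∈ J, e j ⊆ S.erase y) :
    (J.filter fun j => ∃ x ∈ e j, ¬ R y x ∧ ¬ B y x).card ≤ d := by
  refine le_trans (Finset.card_le_card_of_forall_subsingleton (fun j x => x ∈ e j) ?_ ?_) hdeg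
  · intro j hj
    obtain ⟨hjJ, x, hx, hn⟩ := Finset.mem_filter.1 hj
    have := Finset.mem_erase.1 (he j hjJ hx)
    exact ⟨x, Finset.mem_filter.2 ⟨this.2, this.1, hn⟩, hx⟩
  · rintro x - i ⟨hi, hxi⟩ j ⟨hj, hxj⟩
    exact hpw i (Finset.mem_filter.1 hi).1 j (Finset.mem_filter.1 hj).1 x hxi hxj

theorem not_adj_pair_of_longest {V : Type*} {R : V → V → Prop}
    (hR : ∀ ⦃a b⦄, R a b → R b a) {S : Finset V} {l₁ l₂ : List V} {u v y : V}
    (hl : IsPathIn R S (l₁ ++ u :: v :: l₂))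
    (hmax : ∀ l, IsPathIn R S l → l.length ≤ (l₁ ++ u :: v :: l₂).length)
    (hyS : y ∈ S) (hy : y ∉ l₁ ++ u :: v :: l₂) (hu : R y u) (hv : R y v) : False := by
  classical
  have hp : (l₁ ++ u :: y :: v :: l₂).Perm (y :: (l₁ ++ u :: v :: l₂)) := by
    rw [List.perm_iff_count]
    intro z
    simp [List.count_cons]
    omega
  have := hmax (l₁ ++ u :: y :: v :: l₂)
    ⟨hp.nodup_iff.2 (List.nodup_cons.2 ⟨hy, hl.nodup⟩), ?_, ?_⟩
  · simp only [List.length_append, List.length_cons] at this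
    omega
  · have hc := List.isChain_split.1 hl.chain
    exact List.isChain_split.2 ⟨hc.1, List.isChain_cons_cons.2
      ⟨hR hu, List.isChain_cons_cons.2 ⟨hv, (List.isChain_cons_cons.1 hc.2).2⟩⟩⟩
  · intro x hx
    rw [hp.mem_iff, List.mem_cons] at hx
    rcases hx with rfl | hx
    exacts [hyS, hl.mem x hx]

theorem exists_path_of_pair_connectors {V : Type*} [DecidableEq V] {R B : V → V → Prop}
    [DecidableRel R] [DecidableRel B] (hR : ∀ ⦃a b⦄, R a b → R b a)
    (hB : ∀ ⦃a b⦄, B a b → B b a) {S : Finset V} {d : ℕ}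
    (hdeg : ∀ v ∈ S, (S.filter fun w => w ≠ v ∧ ¬ R v w ∧ ¬ B v w).card ≤ d)
    {x₀ : V} {l : List V} (hl : IsPathIn R S (x₀ :: l))
    (hmax : ∀ l', IsPathIn R S l' → l'.length ≤ (x₀ :: l).length)
    {Y : Finset V} (hYS : Y ⊆ S) (hYl : ∀ y ∈ Y, y ∉ x₀ :: l) (hY : ∀ y ∈ Y, B y x₀)
    {L : List (List V)} {n : ℕ} (hL : L.length = n + 2) (hseg : ∀ s ∈ L, IsSegment B Y s)
    (hnd : L.flatten.Nodup) (hLY : ∀ x ∈ L.flatten, x ∈ Y) (hn : n + 3 * d ≤ l.length / 2) :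
    ∃ l', IsPathIn B S l' ∧ l'.length = L.flatten.length + n + 1 := by
  have hx₀l := List.nodup_cons.1 hl.nodup
  set e : ℕ → Finset V := fun j => l.toFinset.filter fun x => l.idxOf x / 2 = j with he
  have hmem : ∀ j x, x ∈ e j ↔ x ∈ l ∧ l.idxOf x / 2 = j := by
    intro j x
    simp [he]
  have hlS : ∀ x ∈ l, x ∈ S := fun x hx => hl.mem x (by simp [hx])
  have hYl' : ∀ y ∈ Y, y ∉ l := fun y hy h => hYl y hy (by simp [h])
  have hpw : ∀ i ∈ Finset.range (l.length / 2), ∀ j ∈ Finset.range (l.length / 2),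
      ∀ x ∈ e i, x ∈ e j → i = j := by
    intro i _ j _ x hi hj
    rw [hmem] at hi hj
    exact hi.2.symm.trans hj.2
  refine exists_path_of_segments hB Y (Y ∪ l.toFinset) S e
    (fun y => (Finset.range (l.length / 2)).filter fun j => ∃ x ∈ e j, ¬ R y x ∧ ¬ B y x) d n
    (fun y hy => card_bad_connectors_le hpw (hdeg y (hYS hy)) ?_) L
    (Finset.range (l.length / 2)) hL hseg hnd ?_ hpw ?_ (by simpa using hn) ?_ ?_ ?_ x₀
    (hl.mem _ (by simp)) ?_ hY
  · intro j _ x hx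
    rw [hmem] at hx
    refine Finset.mem_erase.2 ⟨?_, hlS x hx.1⟩
    rintro rfl
    exact hYl' _ hy hx.1
  · intro j _ x hx hxL
    exact hYl' x (hLY x hxL) ((hmem j x).1 hx).1
  · intro j hj
    rw [Finset.mem_range] at hj
    have h1 : 2 * j < l.length := by omega
    have h2 : 2 * j + 1 < l.length := by omega
    have hue : l[2 * j] ∈ e j := by
      rw [hmem, hx₀l.2.idxOf_getElem]
      exact ⟨List.getElem_mem _, by omega⟩
    have hve : l[2 * j + 1] ∈ e j := by
      rw [hmem, hx₀l.2.idxOf_getElem]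
      exact ⟨List.getElem_mem _, by omega⟩
    have hsplit : x₀ :: l = (x₀ :: l.take (2 * j)) ++ l[2 * j] :: l[2 * j + 1] ::
        l.drop (2 * j + 1 + 1) := by
      rw [← List.drop_eq_getElem_cons h2, ← List.drop_eq_getElem_cons h1, List.cons_append,
        List.take_append_drop]
    have hone : ∀ y ∈ Y, j ∉ ((Finset.range (l.length / 2)).filter fun j =>
        ∃ x ∈ e j, ¬ R y x ∧ ¬ B y x) → B y l[2 * j] ∨ B y l[2 * j + 1] := by
      intro y hy hyj
      by_contra! hcon
      simp only [Finset.mem_filter, Finset.mem_range, not_and, not_exists, not_not] at hyj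
      have hu : R y l[2 * j] := by
        by_contra h
        exact hcon.1 (hyj hj _ hue h)
      have hv : R y l[2 * j + 1] := by
        by_contra h
        exact hcon.2 (hyj hj _ hve h)
      have hy' := hYl y hy
      rw [hsplit] at hl hmax hy'
      exact not_adj_pair_of_longest hR hl hmax (hYS hy) hy' hu hv
    intro a ha b hb c hc hja hjb hjc
    rcases hone a ha hja with h | h <;> rcases hone b hb hjb with h' | h' <;>
      rcases hone c hc hjc with h'' | h''
    · exact ⟨_, hue, Or.inl ⟨h, h'⟩⟩
    · exact ⟨_, hue, Or.inl ⟨h, h'⟩⟩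
    · exact ⟨_, hue, Or.inr (Or.inl ⟨h, h''⟩)⟩
    · exact ⟨_, hve, Or.inr (Or.inr ⟨h', h''⟩)⟩
    · exact ⟨_, hue, Or.inr (Or.inr ⟨h', h''⟩)⟩
    · exact ⟨_, hve, Or.inr (Or.inl ⟨h, h''⟩)⟩
    · exact ⟨_, hve, Or.inl ⟨h, h'⟩⟩
    · exact ⟨_, hve, Or.inl ⟨h, h'⟩⟩
  · intro j _ x hx
    exact Finset.mem_union_right _ (List.mem_toFinset.2 ((hmem j x).1 hx).1)
  · exact fun x hx => Finset.mem_union_left _ (hLY x hx)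
  · exact Finset.union_subset hYS fun x hx => hlS x (List.mem_toFinset.1 hx)
  · rw [Finset.mem_union, List.mem_toFinset, not_or]
    exact ⟨fun h => hYl _ h (by simp), hx₀l.1⟩

theorem exists_path_of_vertex_connectors {V : Type*} [DecidableEq V] {R B : V → V → Prop}
    [DecidableRel R] [DecidableRel B]
    (hB : ∀ ⦃a b⦄, B a b → B b a) {S : Finset V} {d : ℕ}
    (hdeg : ∀ v ∈ S, (S.filter fun w => w ≠ v ∧ ¬ R v w ∧ ¬ B v w).card ≤ d)
    {x₀ : V} {l : List V} (hl : IsPathIn R S (x₀ :: l))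
    {Y : Finset V} (hYS : Y ⊆ S) (hYl : ∀ y ∈ Y, y ∉ x₀ :: l) (hY : ∀ y ∈ Y, B y x₀)
    (hnR : ∀ y ∈ Y, ∀ x ∈ l, ¬ R y x)
    {L : List (List V)} {n : ℕ} (hL : L.length = n + 2) (hseg : ∀ s ∈ L, IsSegment B Y s)
    (hnd : L.flatten.Nodup) (hLY : ∀ x ∈ L.flatten, x ∈ Y) (hn : n + 3 * d ≤ l.length) :
    ∃ l', IsPathIn B S l' ∧ l'.length = L.flatten.length + n + 1 := by
  have hx₀l := List.nodup_cons.1 hl.nodup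
  have hlS : ∀ x ∈ l, x ∈ S := fun x hx => hl.mem x (by simp [hx])
  have hYl' : ∀ y ∈ Y, y ∉ l := fun y hy h => hYl y hy (by simp [h])
  have hpw : ∀ i ∈ l.toFinset, ∀ j ∈ l.toFinset,
      ∀ x ∈ ({i} : Finset V), x ∈ ({j} : Finset V) → i = j := by
    intro i _ j _ x hi hj
    rw [Finset.mem_singleton] at hi hj
    exact hi.symm.trans hj
  refine exists_path_of_segments hB Y (Y ∪ l.toFinset) S (fun x => {x})
    (fun y => l.toFinset.filter fun j => ∃ x ∈ ({j} : Finset V), ¬ R y x ∧ ¬ B y x) d n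
    (fun y hy => card_bad_connectors_le hpw (hdeg y (hYS hy)) ?_) L
    l.toFinset hL hseg hnd ?_ hpw ?_ (by rwa [List.toFinset_card_of_nodup hx₀l.2]) ?_ ?_ ?_ x₀
    (hl.mem _ (by simp)) ?_ hY
  · intro j hj x hx
    rw [Finset.mem_singleton] at hx
    subst hx
    rw [List.mem_toFinset] at hj
    refine Finset.mem_erase.2 ⟨?_, hlS x hj⟩
    rintro rfl
    exact hYl' _ hy hj
  · intro j hj x hx hxL
    rw [Finset.mem_singleton] at hx
    subst hx
    exact hYl' x (hLY x hxL) (List.mem_toFinset.1 hj)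
  · intro j hj a ha b hb _ _ hja hjb _
    have hone : ∀ y ∈ Y, j ∉ (l.toFinset.filter fun j =>
        ∃ x ∈ ({j} : Finset V), ¬ R y x ∧ ¬ B y x) → B y j := by
      intro y hy hyj
      by_contra hcon
      exact hyj (Finset.mem_filter.2 ⟨hj, j, by simp, hnR y hy j (List.mem_toFinset.1 hj), hcon⟩)
    exact ⟨j, by simp, Or.inl ⟨hone a ha hja, hone b hb hjb⟩⟩
  · intro j hj
    simpa using Or.inr (List.mem_toFinset.1 hj)
  · exact fun x hx => Finset.mem_union_left _ (hLY x hx)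
  · exact Finset.union_subset hYS fun x hx => hlS x (List.mem_toFinset.1 hx)
  · rw [Finset.mem_union, List.mem_toFinset, not_or]
    exact ⟨fun h => hYl _ h (by simp), hx₀l.1⟩

theorem length_add_length_le_of_longest {V : Type*} {R : V → V → Prop}
    (hR : ∀ ⦃a b⦄, R a b → R b a) {S : Finset V} {p : ℕ} {l₁ l₂ q : List V} {x y : V}
    (hl : IsPathIn R S (l₁ ++ x :: l₂)) (hmax : ∀ l, IsPathIn R S l → l.length ≤ p)
    (hq : IsPathIn R S q) (hqy : q.getLast? = some y) (hdisj : ∀ z ∈ q, z ∉ l₁ ++ x :: l₂)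
    (hyx : R y x) : 2 * q.length + (l₁ ++ x :: l₂).length + 1 ≤ 2 * p := by
  have hnd := List.nodup_append.1 hl.nodup
  have hc := List.isChain_split.1 hl.chain
  have h1 := hmax (q ++ x :: l₂) (by
    refine ⟨List.nodup_append.2 ⟨hq.nodup, hnd.2.1, ?_⟩, ?_, ?_⟩
    · rintro a ha b hb rfl
      exact hdisj a ha (List.mem_append_right _ hb)
    · refine List.isChain_append.2 ⟨hq.chain, hc.2, ?_⟩
      simpa [hqy] using hyx
    · intro z hz
      rcases List.mem_append.1 hz with hz | hz
      exacts [hq.mem z hz, hl.mem z (List.mem_append_right _ hz)])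
  have h2 := hmax (q ++ (l₁ ++ [x]).reverse) (by
    have hsub : ∀ z ∈ (l₁ ++ [x]).reverse, z ∈ l₁ ++ x :: l₂ := by
      intro z hz
      simp only [List.mem_reverse, List.mem_append, List.mem_cons] at hz ⊢
      tauto
    refine ⟨List.nodup_append.2 ⟨hq.nodup, ?_, ?_⟩, ?_, ?_⟩
    · rw [List.nodup_reverse]
      refine hl.nodup.sublist ?_
      simp
    · rintro a ha b hb rfl
      exact hdisj a ha (hsub _ hb)
    · refine List.isChain_append.2 ⟨hq.chain, hc.1.reverse_of_symm hR, ?_⟩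
      simpa [hqy] using hyx
    · intro z hz
      rcases List.mem_append.1 hz with hz | hz
      exacts [hq.mem z hz, hl.mem z (hsub z hz)])
  simp only [List.length_append, List.length_cons, List.length_reverse, List.length_nil] at h1 h2 ⊢
  omega

/-- In an almost complete graph whose edges carry the colours `R` and `B`, the vertices outside a
longest `R`-path, together with those of the path, carry a long `B`-path. -/
theorem exists_path_of_longest_path {V : Type*} [DecidableEq V] {R B : V → V → Prop}
    [DecidableRel R] [DecidableRel B] (hR : ∀ ⦃a b⦄, R a b → R b a)
    (hB : ∀ ⦃a b⦄, B a b → B b a) {S : Finset V} {d p τ : ℕ}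
    (hdeg : ∀ v ∈ S, (S.filter fun w => w ≠ v ∧ ¬ R v w ∧ ¬ B v w).card ≤ d)
    {l₀ : List V} (hl₀ : IsPathIn R S l₀) (hlen : l₀.length = p) (hp : 1 ≤ p)
    (hmax : ∀ l, IsPathIn R S l → l.length ≤ p) (hτ : τ ≤ p + 1) (hd : 24 * d ≤ p)
    (hS : p + 1 + (τ + 1) / 2 + 100 * d ≤ S.card) :
    ∃ l, IsPathIn B S l ∧ τ ≤ l.length := by
  match l₀, hlen with
  | [], hlen => exact absurd hlen (by simp; omega)
  | x₀ :: l, hlen =>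
    have hx₀S : x₀ ∈ S := hl₀.mem _ (by simp)
    rcases Nat.lt_or_ge τ 2 with hτ2 | hτ2
    · exact ⟨[x₀], ⟨by simp, by simp, by simpa using hx₀S⟩, by simp; omega⟩
    have hll : l.length + 1 = p := by simpa using hlen
    set Y := (S \ (x₀ :: l).toFinset) \ S.filter (fun w => w ≠ x₀ ∧ ¬ R x₀ w ∧ ¬ B x₀ w) with hYdef
    have hYcard : S.card ≤ Y.card + p + d := by
      have h1 := Finset.le_card_sdiff (x₀ :: l).toFinset S
      have h2 := Finset.le_card_sdiff (S.filter (fun w => w ≠ x₀ ∧ ¬ R x₀ w ∧ ¬ B x₀ w))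
        (S \ (x₀ :: l).toFinset)
      rw [List.toFinset_card_of_nodup hl₀.nodup, hlen] at h1
      rw [← hYdef] at h2
      have h3 := hdeg x₀ hx₀S
      omega
    have hYS : Y ⊆ S := Finset.sdiff_subset.trans Finset.sdiff_subset
    have hYl : ∀ y ∈ Y, y ∉ x₀ :: l := by
      intro y hy h
      rw [hYdef, Finset.mem_sdiff, Finset.mem_sdiff, List.mem_toFinset] at hy
      exact hy.1.2 h
    have hYx₀ : ∀ y ∈ Y, B y x₀ := by
      intro y hy
      have hnR : ¬ R x₀ y := by
        intro h
        have := hmax (y :: x₀ :: l) ⟨List.nodup_cons.2 ⟨hYl y hy, hl₀.nodup⟩,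
          List.isChain_cons_cons.2 ⟨hR h, hl₀.chain⟩, by simpa [hYS hy] using hl₀.mem⟩
        simp at this
        omega
      have hne : y ≠ x₀ := fun h => hYl y hy (by simp [h])
      rw [hYdef, Finset.mem_sdiff, Finset.mem_filter] at hy
      by_contra h
      exact hy.2 ⟨(Finset.mem_sdiff.1 hy.1).1, hne, hnR, fun h' => h (hB h')⟩
    have hmax' : ∀ l', IsPathIn R S l' → l'.length ≤ (x₀ :: l).length := by rwa [hlen]
    by_cases hA : τ / 2 - 1 + 3 * d ≤ (p - 1) / 2
    · obtain ⟨L, h1, h2, h3, h4, h5⟩ := exists_segments_of_matching (r := B) (Y := Y) (M := [])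
        (s := 0) rfl rfl (by simp) (by simp) (by simp) (m := τ / 2 + 1) (by omega)
      obtain ⟨l', hl', hl'len⟩ := exists_path_of_pair_connectors hR hB hdeg hl₀ hmax' hYS hYl hYx₀
        (L := L) (n := τ / 2 - 1) (by omega) h3 h4 h5 (by omega)
      exact ⟨l', hl', by omega⟩
    rcases exists_matching_or_independent B Y (6 * d) with
      ⟨M, hM, hMlen, hpair, hMnd, hMY⟩ | ⟨Y₀, hY₀Y, hY₀card, hind⟩
    · obtain ⟨L, h1, h2, h3, h4, h5⟩ := exists_segments_of_matching hM hMlen hpair hMnd hMY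
        (m := τ / 2 + 1 + 3 * d - 12 * d) (by omega)
      obtain ⟨l', hl', hl'len⟩ := exists_path_of_pair_connectors hR hB hdeg hl₀ hmax' hYS hYl hYx₀
        (L := L) (n := τ / 2 - 1 - 3 * d) (by omega) h3 h4 h5 (by omega)
      exact ⟨l', hl', by omega⟩
    · have hnR : ∀ y ∈ Y₀, ∀ x ∈ l, ¬ R y x := by
        intro y hy x hx hyx
        obtain ⟨q, hq, hqlen, hqy⟩ := exists_path_to_of_dense (r := R) (S := Y₀) (d := d) hy
          (by
            intro v hv
            refine le_trans (Finset.card_le_card ?_) (hdeg v (hYS (hY₀Y hv)))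
            intro w hw
            rw [Finset.mem_filter] at hw ⊢
            exact ⟨hYS (hY₀Y hw.1), hw.2.1, fun h => hw.2.2 (hR h),
              hind v hv w hw.1 hw.2.1.symm⟩) (Y₀.card - d - 1) (by omega)
        obtain ⟨l₁, l₂, rfl⟩ := List.append_of_mem hx
        have := length_add_length_le_of_longest hR (l₁ := x₀ :: l₁) hl₀ hmax
          ⟨hq.nodup, hq.chain, fun z hz => hYS (hY₀Y (hq.mem z hz))⟩ hqy
          (fun z hz => hYl z (hY₀Y (hq.mem z hz))) hyx
        rw [List.cons_append, hlen] at this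
        omega
      obtain ⟨L, h1, h2, h3, h4, h5⟩ := exists_segments_of_matching (r := B) (Y := Y₀) (M := [])
        (s := 0) rfl rfl (by simp) (by simp) (by simp) (m := τ / 2 + 1) (by omega)
      obtain ⟨l', hl', hl'len⟩ := exists_path_of_vertex_connectors hB hdeg hl₀ (hY₀Y.trans hYS)
        (fun y hy => hYl y (hY₀Y hy)) (fun y hy => hYx₀ y (hY₀Y hy)) hnR
        (L := L) (n := τ / 2 - 1) (by omega) h3 h4 h5 (by omega)
      exact ⟨l', hl', by omega⟩

theorem exists_longest_path {V : Type*} [DecidableEq V] (r : V → V → Prop) (S : Finset V) :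
    ∃ l, IsPathIn r S l ∧ ∀ l', IsPathIn r S l' → l'.length ≤ l.length := by
  have hbdd : ∀ l, IsPathIn r S l → l.length ≤ S.card := by
    intro l hl
    rw [← List.toFinset_card_of_nodup hl.nodup]
    exact Finset.card_le_card fun x hx => hl.mem x (List.mem_toFinset.1 hx)
  by_contra! hcon
  have hlong : ∀ k : ℕ, ∃ l, IsPathIn r S l ∧ k ≤ l.length := by
    intro k
    induction k with
    | zero => exact ⟨[], ⟨by simp, by simp, by simp⟩, by simp⟩
    | succ k ih =>
      obtain ⟨l, hl, hk⟩ := ih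
      obtain ⟨l', hl', hlt⟩ := hcon l hl
      exact ⟨l', hl', by omega⟩
  obtain ⟨l, hl, hk⟩ := hlong (S.card + 1)
  have := hbdd l hl
  omega

/-- A Ramsey theorem for paths in graphs with bounded maximum degree of the complement. -/
theorem exists_monochromatic_path {V : Type*} [DecidableEq V] {R B : V → V → Prop}
    [DecidableRel R] [DecidableRel B] (hR : ∀ ⦃a b⦄, R a b → R b a)
    (hB : ∀ ⦃a b⦄, B a b → B b a) {S : Finset V} {d t₁ t₂ : ℕ} (h21 : t₂ ≤ t₁)
    (hdeg : ∀ v ∈ S, (S.filter fun w => w ≠ v ∧ ¬ R v w ∧ ¬ B v w).card ≤ d)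
    (hS : t₁ + (t₂ + 1) / 2 + 100 * d ≤ S.card) :
    (∃ l, IsPathIn R S l ∧ t₁ ≤ l.length) ∨ ∃ l, IsPathIn B S l ∧ t₂ ≤ l.length := by
  by_contra! hcon
  obtain ⟨hcR, hcB⟩ := hcon
  obtain ⟨lR, hlR, hmR⟩ := exists_longest_path R S
  obtain ⟨lB, hlB, hmB⟩ := exists_longest_path B S
  have h1 := hcR lR hlR
  have h2 := hcB lB hlB
  obtain ⟨x, hx⟩ : S.Nonempty := Finset.card_pos.1 (by omega)
  have hR1 : 1 ≤ lR.length := hmR [x] ⟨by simp, by simp, by simpa using hx⟩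
  have hB1 : 1 ≤ lB.length := hmB [x] ⟨by simp, by simp, by simpa using hx⟩
  have hlong : 24 * d ≤ max lR.length lB.length := by
    by_contra! hlt
    have eR := sum_card_neighbors_le hR S (n := 24 * d)
      fun l hl => (hmR l hl).trans ((le_max_left _ _).trans hlt.le)
    have eB := sum_card_neighbors_le hB S (n := 24 * d)
      fun l hl => (hmB l hl).trans ((le_max_right _ _).trans hlt.le)
    have hle : ∀ v ∈ S, S.card - 1 - d ≤
        (S.filter fun w => R v w).card + (S.filter fun w => B v w).card := by
      intro v hv
      have hsub : S.erase v ⊆ (S.filter fun w => R v w) ∪ (S.filter fun w => B v w) ∪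
          S.filter fun w => w ≠ v ∧ ¬ R v w ∧ ¬ B v w := by
        intro w hw
        simp only [Finset.mem_erase, Finset.mem_union, Finset.mem_filter] at hw ⊢
        tauto
      have h3 := Finset.card_le_card hsub
      rw [Finset.card_erase_of_mem hv] at h3
      have h4 := Finset.card_union_le ((S.filter fun w => R v w) ∪ (S.filter fun w => B v w))
        (S.filter fun w => w ≠ v ∧ ¬ R v w ∧ ¬ B v w)
      have h5 := Finset.card_union_le (S.filter fun w => R v w) (S.filter fun w => B v w)
      have := hdeg v hv
      omega
    have hsum := Finset.sum_le_sum hle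
    rw [Finset.sum_const, smul_eq_mul, Finset.sum_add_distrib] at hsum
    have h6 : S.card * (S.card - 1 - d) ≤ S.card * (96 * d) :=
      hsum.trans ((add_le_add eR eB).trans (by ring_nf; rfl))
    have h7 := Nat.le_of_mul_le_mul_left h6 (Finset.card_pos.2 ⟨x, hx⟩)
    omega
  rcases le_total lB.length lR.length with hle | hle
  · rw [max_eq_left hle] at hlong
    obtain ⟨l, hl, hτ⟩ := exists_path_of_longest_path hR hB (τ := min t₂ (lR.length + 1)) hdeg hlR
      rfl hR1 hmR (min_le_right _ _) hlong (by omega)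
    have := hmB l hl
    omega
  · rw [max_eq_right hle] at hlong
    obtain ⟨l, hl, hτ⟩ := exists_path_of_longest_path hB hR (τ := lB.length + 1)
      (by simpa only [and_comm] using hdeg) hlB rfl hB1 hmB le_rfl hlong (by omega)
    have := hmR l hl
    omega

/-- Adjacency by an edge of colour `i`. -/
def ColorAdj {V : Type*} {H : SimpleGraph V} (c : H.edgeSet → Fin 2) (i : Fin 2) (v w : V) : Prop :=
  ∃ h : s(v, w) ∈ H.edgeSet, c ⟨s(v, w), h⟩ = i

theorem ColorAdj.symm {V : Type*} {H : SimpleGraph V} {c : H.edgeSet → Fin 2} {i : Fin 2}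
    ⦃v w : V⦄ (h : ColorAdj c i v w) : ColorAdj c i w v := by
  unfold ColorAdj at h ⊢
  rwa [Sym2.eq_swap]

theorem adj_iff_colorAdj {V : Type*} {H : SimpleGraph V} (c : H.edgeSet → Fin 2) (v w : V) :
    H.Adj v w ↔ ColorAdj c 0 v w ∨ ColorAdj c 1 v w := by
  constructor
  · intro h
    rcases Fin.exists_fin_two.1 ⟨c ⟨s(v, w), h⟩, rfl⟩ with h' | h'
    exacts [Or.inl ⟨h, h'⟩, Or.inr ⟨h, h'⟩]
  · rintro (⟨h, -⟩ | ⟨h, -⟩) <;> exact h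

theorem exists_walk_of_isChain {V : Type*} {H : SimpleGraph V} {c : H.edgeSet → Fin 2} {i : Fin 2}
    (l : List V) (u : V) (hl : (u :: l).IsChain (ColorAdj c i)) :
    ∃ (v : V) (w : H.Walk u v), w.support = u :: l ∧
      ∀ e (h : e ∈ w.edges), c ⟨e, w.edges_subset_edgeSet h⟩ = i := by
  induction l generalizing u with
  | nil => exact ⟨u, .nil, by simp, by simp⟩
  | cons a l ih =>
    obtain ⟨⟨h, hc⟩, hl'⟩ := List.isChain_cons_cons.1 hl
    obtain ⟨v, w, hw, hcol⟩ := ih a hl'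
    have hadj : H.Adj u a := h
    refine ⟨v, .cons hadj w, by simp [hw], ?_⟩
    intro e he
    rw [SimpleGraph.Walk.edges_cons, List.mem_cons] at he
    rcases he with rfl | he
    exacts [hc, hcol e he]

theorem exists_walk_of_isPathIn {V : Type*} {H : SimpleGraph V} {c : H.edgeSet → Fin 2}
    {i : Fin 2} {S : Finset V} {l : List V} (hl : IsPathIn (ColorAdj c i) S l) {t : ℕ}
    (ht : 1 ≤ t) (htl : t ≤ l.length) :
    ∃ (u v : V) (w : H.Walk u v), w.IsPath ∧ w.length + 1 = t ∧
      ∀ e (h : e ∈ w.edges), c ⟨e, w.edges_subset_edgeSet h⟩ = i := by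
  obtain ⟨u, m, hm⟩ := List.exists_cons_of_length_pos
    (show 0 < (l.take t).length by rw [List.length_take]; omega)
  obtain ⟨v, w, hw, hc⟩ := exists_walk_of_isChain m u (hm ▸ hl.chain.take t)
  refine ⟨u, v, w, ?_, ?_, hc⟩
  · rw [SimpleGraph.Walk.isPath_def, hw, ← hm]
    exact hl.nodup.sublist (List.take_sublist t l)
  · rw [← SimpleGraph.Walk.length_support, hw, ← hm, List.length_take]
    omega

theorem sum_card_nonneighbors_add {V : Type*} [Fintype V] [DecidableEq V] (H : SimpleGraph V)
    [DecidableRel H.Adj] :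
    ∑ v, (Finset.univ.filter fun w => w ≠ v ∧ ¬ H.Adj v w).card + 2 * Nat.card H.edgeSet +
      Fintype.card V = Fintype.card V * Fintype.card V := by
  have hv : ∀ v, (Finset.univ.filter fun w => w ≠ v ∧ ¬ H.Adj v w).card + H.degree v + 1 =
      Fintype.card V := by
    intro v
    have h1 := Finset.card_filter_add_card_filter_not (s := Finset.univ.erase v) (H.Adj v)
    have h2 : (Finset.univ.erase v).filter (H.Adj v) = H.neighborFinset v := by
      ext w
      simp only [Finset.mem_filter, Finset.mem_erase, Finset.mem_univ, and_true,
        SimpleGraph.mem_neighborFinset, and_iff_right_iff_imp]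
      exact fun h => h.ne'
    have h3 : (Finset.univ.erase v).filter (fun w => ¬ H.Adj v w) =
        Finset.univ.filter fun w => w ≠ v ∧ ¬ H.Adj v w := by
      ext w
      simp
    rw [h2, h3, SimpleGraph.card_neighborFinset_eq_degree,
      Finset.card_erase_of_mem (Finset.mem_univ v), Finset.card_univ] at h1
    have : 0 < Fintype.card V := Fintype.card_pos_iff.2 ⟨v⟩
    omega
  have hs := Finset.sum_congr rfl fun v (_ : v ∈ (Finset.univ : Finset V)) => hv v
  rw [Finset.sum_add_distrib, Finset.sum_add_distrib, H.sum_degrees_eq_twice_card_edges] at hs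
  simp only [Finset.sum_const, Finset.card_univ, smul_eq_mul, mul_one] at hs
  rwa [Nat.card_eq_fintype_card, ← SimpleGraph.edgeFinset_card]

theorem stmt14 (ε : ℝ) (hε0 : 0 < ε) (hε : ε < 1 / 4) (t₁ t₂ : ℕ) (h21 : t₂ ≤ t₁)
    (h1 : 1 ≤ t₂) {V : Type*} [Fintype V] (H : SimpleGraph V) (T : ℕ)
    (hT : Fintype.card V = T)
    (hTge : (t₁ : ℝ) + (((t₂ + 1) / 2 : ℕ) : ℝ) + 150 * Real.sqrt ε * t₁ ≤ (T : ℝ))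
    (hE : (1 - ε) * (T.choose 2 : ℝ) ≤ (Nat.card H.edgeSet : ℝ)) :
    ∀ c : H.edgeSet → Fin 2,
      (∃ (u v : V) (w : H.Walk u v), w.IsPath ∧ w.length + 1 = t₁ ∧
        ∀ e (h : e ∈ w.edges), c ⟨e, w.edges_subset_edgeSet h⟩ = 0) ∨
      (∃ (u v : V) (w : H.Walk u v), w.IsPath ∧ w.length + 1 = t₂ ∧
        ∀ e (h : e ∈ w.edges), c ⟨e, w.edges_subset_edgeSet h⟩ = 1) := by
  intro c
  classical
  suffices hpath : ∃ S : Finset V, (∃ l, IsPathIn (ColorAdj c 0) S l ∧ t₁ ≤ l.length) ∨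
      ∃ l, IsPathIn (ColorAdj c 1) S l ∧ t₂ ≤ l.length by
    obtain ⟨S, ⟨l, hl, hlen⟩ | ⟨l, hl, hlen⟩⟩ := hpath
    · exact Or.inl (exists_walk_of_isPathIn hl (h1.trans h21) hlen)
    · exact Or.inr (exists_walk_of_isPathIn hl h1 hlen)
  set x := Real.sqrt ε with hx
  have hx0 : 0 < x := Real.sqrt_pos.2 hε0
  have hxx : x * x = ε := Real.mul_self_sqrt hε0.le
  have ht1 : (1 : ℝ) ≤ t₁ := by exact_mod_cast h1.trans h21
  have hT1 : (1 : ℝ) ≤ T := by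
    have : (0 : ℝ) ≤ 150 * x * t₁ := by positivity
    have : (0 : ℝ) ≤ (((t₂ + 1) / 2 : ℕ) : ℝ) := by positivity
    linarith
  have hmiss := sum_card_nonneighbors_add H
  rw [hT] at hmiss
  have hmissR : ((∑ v, (Finset.univ.filter fun w => w ≠ v ∧ ¬ H.Adj v w).card : ℕ) : ℝ) +
      2 * (Nat.card H.edgeSet : ℝ) + T = T * T := by exact_mod_cast hmiss
  set m := ∑ v, (Finset.univ.filter fun w => w ≠ v ∧ ¬ H.Adj v w).card with hm
  rw [Nat.cast_choose_two] at hE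
  have hmle : (m : ℝ) ≤ ε * (T * (T - 1)) := by linarith
  rcases le_or_gt (7.5 * (t₁ : ℝ)) T with hbig | hsmall
  · by_contra! hcon
    obtain ⟨hcR, hcB⟩ := hcon Finset.univ
    have eR := sum_card_neighbors_le (r := ColorAdj c 0) ColorAdj.symm Finset.univ (n := t₁)
      fun l hl => (hcR l hl).le
    have eB := sum_card_neighbors_le (r := ColorAdj c 1) ColorAdj.symm Finset.univ (n := t₁)
      fun l hl => (hcB l hl).le.trans h21
    have hdeg : ∀ v ∈ (Finset.univ : Finset V), H.degree v ≤
        (Finset.univ.filter fun w => ColorAdj c 0 v w).card +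
          (Finset.univ.filter fun w => ColorAdj c 1 v w).card := by
      intro v _
      refine le_trans ?_ (Finset.card_union_le _ _)
      rw [← SimpleGraph.card_neighborFinset_eq_degree]
      refine Finset.card_le_card fun w hw => ?_
      rw [SimpleGraph.mem_neighborFinset, adj_iff_colorAdj c] at hw
      simpa using hw
    have hsum := Finset.sum_le_sum hdeg
    rw [H.sum_degrees_eq_twice_card_edges, Finset.sum_add_distrib, SimpleGraph.edgeFinset_card,
      ← Nat.card_eq_fintype_card] at hsum
    rw [Finset.card_univ, hT] at eR eB
    have hle : 2 * Nat.card H.edgeSet ≤ 2 * t₁ * T + 2 * t₁ * T := by omega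
    have hleR : 2 * (Nat.card H.edgeSet : ℝ) ≤ 2 * t₁ * T + 2 * t₁ * T := by exact_mod_cast hle
    have h3 : (3 / 4 : ℝ) * (T * (T - 1)) ≤ 4 * t₁ * T := by
      have : 0 ≤ (1 / 4 - ε) * ((T : ℝ) * (T - 1)) :=
        mul_nonneg (by linarith) (mul_nonneg (by linarith) (by linarith))
      linarith
    have h4 : (3 / 4 : ℝ) * (T - 1) ≤ 4 * t₁ := by
      refine le_of_mul_le_mul_left ?_ (by linarith : (0 : ℝ) < T)
      linarith
    linarith
  · set d := ⌊x * T / 10⌋₊ with hd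
    have hdle : (d : ℝ) ≤ x * T / 10 := Nat.floor_le (by positivity)
    have hdlt : x * T / 10 < d + 1 := Nat.lt_floor_add_one _
    set f : V → ℕ := fun v => (Finset.univ.filter fun w => w ≠ v ∧ ¬ H.Adj v w).card with hf
    set Bad := Finset.univ.filter fun v => ¬ f v ≤ d with hBad
    have hbadsum : Bad.card * (d + 1) ≤ m := by
      rw [← smul_eq_mul, ← Finset.sum_const]
      calc ∑ _v ∈ Bad, (d + 1) ≤ ∑ v ∈ Bad, f v := by
            refine Finset.sum_le_sum fun v hv => ?_
            have := (Finset.mem_filter.1 hv).2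
            omega
        _ ≤ m := Finset.sum_le_sum_of_subset (Finset.subset_univ _)
    have hbadR : (Bad.card : ℝ) * (d + 1) ≤ m := by exact_mod_cast hbadsum
    have hxT : 0 < x * T := mul_pos hx0 (by linarith)
    have hbad : (Bad.card : ℝ) ≤ 10 * (x * T) := by
      have h3 : (Bad.card : ℝ) * (x * T) ≤ 10 * (x * T) * (x * T) := by
        have h4 : (Bad.card : ℝ) * (x * T / 10) ≤ Bad.card * (d + 1) :=
          mul_le_mul_of_nonneg_left hdlt.le (by positivity)
        have h5 : ε * ((T : ℝ) * (T - 1)) ≤ ε * (T * T) := by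
          gcongr
          linarith
        have h6 : (x * T) * (x * T) = ε * ((T : ℝ) * T) := by rw [← hxx]; ring
        linarith
      exact le_of_mul_le_mul_right h3 hxT
    have hS : (Finset.univ.filter fun v => f v ≤ d).card + Bad.card = T := by
      rw [hBad, Finset.card_filter_add_card_filter_not, Finset.card_univ, hT]
    have hSR : ((Finset.univ.filter fun v => f v ≤ d).card : ℝ) + Bad.card = T := by
      exact_mod_cast hS
    refine ⟨Finset.univ.filter fun v => f v ≤ d,
      exists_monochromatic_path (d := d) ColorAdj.symm ColorAdj.symm h21 ?_ ?_⟩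
    · intro v hv
      refine le_trans (Finset.card_le_card fun w hw => ?_) (Finset.mem_filter.1 hv).2
      rw [Finset.mem_filter] at hw ⊢
      rw [adj_iff_colorAdj c, not_or]
      exact ⟨Finset.mem_univ _, hw.2⟩
    · have h3 : 20 * (x * T) ≤ 150 * x * t₁ := by
        have := mul_le_mul_of_nonneg_left hsmall.le hx0.le
        linarith
      have h4 : ((t₁ + (t₂ + 1) / 2 + 100 * d : ℕ) : ℝ) ≤
          ((Finset.univ.filter fun v => f v ≤ d).card : ℝ) := by
        rw [Nat.cast_add, Nat.cast_add, Nat.cast_mul]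
        push_cast at hTge ⊢
        linarith
      exact_mod_cast h4
end

section
/- Let ε be a real with 0 < ε < 1, and let t be an integer with t ≥ ε^{−1/2}. Every graph H on t vertices with at least (1−ε)·C(t,2) edges contains an induced subgraph on at least (1−√ε)t vertices in which every vertex has degree greater than (1−3√ε)t − 1. -/
-- The number of neighbors of `v` lying in `S`.
open Classical in
noncomputable def degIn {V : Type*} (G : SimpleGraph V) (v : V) (S : Finset V) : ℕ :=
  (S.filter fun w => G.Adj v w).card

open Classical in
/-- Restricting the neighborhood of `v` to `S` loses at most the vertices outside `S`. -/
theorem degree_le_degIn_add_card_compl {V : Type*} [Fintype V] (G : SimpleGraph V) (v : V)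
    (S : Finset V) : G.degree v ≤ degIn G v S + Sᶜ.card := by
  rw [← G.card_neighborFinset_eq_degree, degIn]
  refine le_trans (Finset.card_le_card fun w hw => ?_) (Finset.card_union_le _ _)
  rw [SimpleGraph.mem_neighborFinset] at hw
  by_cases hS : w ∈ S <;> simp [hS, hw]

open Classical in
/-- The sum over all vertices of the number of missing neighbors. -/
theorem sum_card_sub_one_sub_degree {V : Type*} [Fintype V] (G : SimpleGraph V) :
    ∑ v, ((Fintype.card V : ℝ) - 1 - G.degree v) =
      Fintype.card V * ((Fintype.card V : ℝ) - 1) - 2 * Nat.card G.edgeSet := by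
  have h : ∑ v, (G.degree v : ℝ) = 2 * Nat.card G.edgeSet := by
    rw [Nat.card_eq_fintype_card, ← SimpleGraph.edgeFinset_card]
    exact_mod_cast G.sum_degrees_eq_twice_card_edges
  rw [Finset.sum_sub_distrib, h]
  simp [mul_sub]

theorem stmt15 (ε : ℝ) (hε0 : 0 < ε) (hε1 : ε < 1) (t : ℕ)
    (ht : ε ^ (-(1 : ℝ) / 2) ≤ (t : ℝ)) {V : Type*} [Fintype V] (H : SimpleGraph V)
    (hV : Fintype.card V = t) (hE : (1 - ε) * (t.choose 2 : ℝ) ≤ (Nat.card H.edgeSet : ℝ)) :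
    ∃ S : Finset V, (1 - Real.sqrt ε) * (t : ℝ) ≤ (S.card : ℝ) ∧
      ∀ v ∈ S, (1 - 3 * Real.sqrt ε) * (t : ℝ) - 1 < (degIn H v S : ℝ) := by
  classical
  subst hV
  set n : ℝ := (Fintype.card V : ℝ) with hn
  set s := Real.sqrt ε with hs
  have hs0 : 0 < s := Real.sqrt_pos.mpr hε0
  have hss : s * s = ε := Real.mul_self_sqrt hε0.le
  have hn0 : 0 < n := lt_of_lt_of_le (Real.rpow_pos_of_pos hε0 _) ht
  have hsn : 0 < s * n := mul_pos hs0 hn0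
  set S : Finset V := Finset.univ.filter fun v => n - 1 - H.degree v < s * n with hS
  have hmissing : ∑ v, (n - 1 - H.degree v) ≤ ε * (n * (n - 1)) := by
    rw [sum_card_sub_one_sub_degree]
    rw [Nat.cast_choose_two] at hE
    linarith
  have hnonneg (v : V) : 0 ≤ n - 1 - H.degree v := by
    have h : (H.degree v : ℝ) + 1 ≤ n := by
      rw [hn]
      exact_mod_cast H.degree_lt_card_verts v
    linarith
  have hmarkov : (Sᶜ.card : ℝ) * (s * n) ≤ ∑ v, (n - 1 - H.degree v) := by
    rw [← nsmul_eq_mul]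
    refine (Finset.card_nsmul_le_sum Sᶜ _ _ fun v hv => ?_).trans
      (Finset.sum_le_sum_of_subset_of_nonneg (Finset.subset_univ _) fun v _ _ => hnonneg v)
    simpa [hS] using hv
  have hcompl : (Sᶜ.card : ℝ) ≤ s * n := by
    refine le_of_mul_le_mul_right ?_ hsn
    nlinarith [mul_pos hε0 hn0]
  have hcard : (S.card : ℝ) + Sᶜ.card = n := by
    rw [hn]
    exact_mod_cast S.card_add_card_compl
  refine ⟨S, by linarith, fun v hv => ?_⟩
  have hdeg : n - 1 - H.degree v < s * n := (Finset.mem_filter.mp hv).2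
  have hle : (H.degree v : ℝ) ≤ degIn H v S + Sᶜ.card := by
    exact_mod_cast degree_le_degIn_add_card_compl H v S
  linarith
end
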